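/- arXiv:1710.08748 — 3 statements merged into one kernel-verified Lean document; each statement's English description precedes it below -/
import Mathlib

section
/- The class of languages of data trees recognized by BUDTA is effectively closed under intersection and under union: there are algorithms that, given two BUDTA A₁ and A₂ over the same finite alphabet 𝔸, compute a BUDTA accepting exactly those data trees over 𝔸 and 𝔻 accepted by both A₁ and A₂, and a BUDTA accepting exactly those accepted by A₁ or A₂. -/
namespace BUDA

/-- Positions in an unranked tree: finite sequences of natural numbers. -/
abbrev Pos : Type := List ℕ

/-- A data tree over a label alphabet `A` and data domain `D`. -/
structure DataTree (A D : Type) where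
  pos : Finset Pos
  label : Pos → A
  data : Pos → D
  root_mem : ([] : Pos) ∈ pos
  parent_closed : ∀ (x : Pos) (i : ℕ), x ++ [i] ∈ pos → x ∈ pos
  sibling_closed : ∀ (x : Pos) (i : ℕ), x ++ [i + 1] ∈ pos → x ++ [i] ∈ pos

/-- `x` is a leaf of `τ`. -/
def IsLeaf {A D : Type} (τ : DataTree A D) (x : Pos) : Prop :=
  ∀ i : ℕ, x ++ [i] ∉ τ.pos

/-- `p` is a downward path of `τ` starting at `x`: a nonempty sequence of
positions of `τ`, starting at `x`, in which each step goes from a node to one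
of its children. -/
def IsDownPath {A D : Type} (τ : DataTree A D) (x : Pos) (p : List Pos) : Prop :=
  p ≠ [] ∧ p.head? = some x ∧ (∀ y ∈ p, y ∈ τ.pos) ∧
    List.Chain' (fun y z => ∃ i : ℕ, z = y ++ [i]) p

/-- The data values occurring in the subtree rooted at `x`. -/
def subtreeData {A D : Type} (τ : DataTree A D) (x : Pos) : Set D :=
  {d | ∃ y ∈ τ.pos, x <+: y ∧ τ.data y = d}

/-- Basic tests of a BUDTA, over alphabet `A`, internal alphabet `B`, states `Q`. -/
inductive BTest (A B Q : Type) : Type where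
  | state : Q → BTest A B Q                                 -- p
  | eq : BTest A B Q                                        -- eq
  | deq : RegularExpression (A × B) → BTest A B Q           -- ⟨e⟩^=
  | dneq : RegularExpression (A × B) → BTest A B Q          -- ⟨e⟩^≠
  | root : BTest A B Q
  | leaf : BTest A B Q
  | lab : A → BTest A B Q                                   -- a
  | ilab : B → BTest A B Q                                  -- b

/-- Basic actions of a BUDTA. -/
inductive BAct (Q : Type) : Type where
  | accept : BAct Q
  | keep : Q → BAct Q
  | store : Q → BAct Q
  | guess : Q → BAct Q
  | univ : Q → BAct Q

/-- A transition: a conjunction of possibly negated basic tests (the Boolean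
flag `true` marks a negated test) together with a conjunction of basic actions. -/
abbrev Trans (A B Q : Type) : Type := List (Bool × BTest A B Q) × List (BAct Q)

/-- Satisfaction of a basic test by the thread `(q, d)` at position `x` of the
tree `τ` with internal labeling `bl`. -/
def basicHolds {A B Q D : Type} (τ : DataTree A D) (bl : Pos → B) (x : Pos)
    (q : Q) (d : D) : BTest A B Q → Prop
  | .state p => q = p
  | .eq => τ.data x = d
  | .deq e => ∃ p y, IsDownPath τ x p ∧ p.getLast? = some y ∧
      (p.map fun z => (τ.label z, bl z)) ∈ e.matches' ∧ τ.data y = d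
  | .dneq e => ∃ p y, IsDownPath τ x p ∧ p.getLast? = some y ∧
      (p.map fun z => (τ.label z, bl z)) ∈ e.matches' ∧ τ.data y ≠ d
  | .root => x = ([] : Pos)
  | .leaf => IsLeaf τ x
  | .lab a => τ.label x = a
  | .ilab b => bl x = b

/-- Satisfaction of a conjunction of possibly negated basic tests. -/
def testHolds {A B Q D : Type} (τ : DataTree A D) (bl : Pos → B) (x : Pos)
    (q : Q) (d : D) (t : List (Bool × BTest A B Q)) : Prop :=
  ∀ nt ∈ t, (basicHolds τ bl x q d nt.2 ↔ nt.1 = false)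

/-- The constraint imposed on the configuration `ρ y` of the parent `y` of `x`
by a basic action executed at `x` by a thread with register value `d`. -/
def actOK {A Q D : Type} (τ : DataTree A D) (x y : Pos)
    (ρ : Pos → Set (Q × D)) (d : D) : BAct Q → Prop
  | .accept => True
  | .keep p => (p, d) ∈ ρ y
  | .store p => (p, τ.data x) ∈ ρ y
  | .guess p => ∃ e : D, (p, e) ∈ ρ y
  | .univ p => ∀ e ∈ subtreeData τ x, (p, e) ∈ ρ y

/-- `ρ` is a run of the automaton with initial state `q0` and transitions `δ`
on the tree `τ` with internal labeling `bl`. -/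
def IsRun {A B Q D : Type} (q0 : Q) (δ : List (Trans A B Q))
    (τ : DataTree A D) (bl : Pos → B) (ρ : Pos → Set (Q × D)) : Prop :=
  (∀ x ∈ τ.pos, (ρ x).Finite) ∧
  (∀ x ∈ τ.pos, IsLeaf τ x → ∃ e : D, ρ x = {(q0, e)}) ∧
  (∀ (y : Pos) (i : ℕ), y ++ [i] ∈ τ.pos → ∀ qd ∈ ρ (y ++ [i]),
    ∃ tr ∈ δ, testHolds τ bl (y ++ [i]) qd.1 qd.2 tr.1 ∧
      ∀ a ∈ tr.2, actOK τ (y ++ [i]) y ρ qd.2 a)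

/-- `ρ` is an accepting run: a run in which every root thread satisfies the
test of some transition whose action is `accept`. -/
def IsAcceptingRun {A B Q D : Type} (q0 : Q) (δ : List (Trans A B Q))
    (τ : DataTree A D) (bl : Pos → B) (ρ : Pos → Set (Q × D)) : Prop :=
  IsRun q0 δ τ bl ρ ∧
  ∀ qd ∈ ρ ([] : Pos), ∃ t, (t, [BAct.accept]) ∈ δ ∧ testHolds τ bl [] qd.1 qd.2 t

/-- A Bottom-Up Data Automaton over the alphabet `A`: a finite internal
alphabet `B`, a finite set of states `Q`, an initial state and a finite set of
transitions. -/
structure BUDTA (A : Type) : Type 1 where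
  B : Type
  Bfin : Finite B
  Q : Type
  Qfin : Finite Q
  q0 : Q
  δ : List (Trans A B Q)

/-- The automaton `M` accepts the data tree `τ`: for some internal labeling
there is an accepting run. -/
def Accepts {A D : Type} (M : BUDTA A) (τ : DataTree A D) : Prop :=
  ∃ bl : Pos → M.B, ∃ ρ : Pos → Set (M.Q × D), IsAcceptingRun M.q0 M.δ τ bl ρ


section Helpers

open Classical

/-- All elements of a finite type, as a list. -/
noncomputable def elems (B : Type) [Finite B] : List B :=
  (@Finset.univ B (Fintype.ofFinite B)).toList

theorem mem_elems {B : Type} [Finite B] (b : B) : b ∈ elems B := by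
  simp [elems]

/-- The regular expression for the one-letter words with letter in `L`. -/
def sumChars {α : Type} : List α → RegularExpression α
  | [] => 0
  | a :: L => RegularExpression.char a + sumChars L

theorem mem_sumChars {α : Type} (L : List α) (w : List α) :
    w ∈ (sumChars L).matches' ↔ ∃ a ∈ L, w = [a] := by
  induction L with
  | nil => simp [sumChars]
  | cons a L ih =>
    simp only [sumChars, RegularExpression.matches'_add, Language.mem_add, ih,
      RegularExpression.matches'_char]
    simp only [List.mem_cons, exists_eq_or_imp]
    exact Iff.rfl

/-- Inverse image of a regular expression under a letter-to-letter map. -/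
noncomputable def recomap {α β : Type} [Finite β] (f : β → α) :
    RegularExpression α → RegularExpression β
  | .zero => 0
  | .epsilon => 1
  | .char a => sumChars ((elems β).filter fun b => f b = a)
  | .plus p q => recomap f p + recomap f q
  | .comp p q => recomap f p * recomap f q
  | .star p => (recomap f p).star

theorem mem_recomap {α β : Type} [Finite β] (f : β → α) (e : RegularExpression α) :
    ∀ w : List β, w ∈ (recomap f e).matches' ↔ w.map f ∈ e.matches' := by
  induction e with
  | zero => intro w; exact Iff.rfl
  | epsilon =>
    intro w
    show w ∈ (1 : Language β) ↔ w.map f ∈ (1 : Language α)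
    simp [Language.mem_one]
  | char a =>
    intro w
    simp only [recomap, mem_sumChars, List.mem_filter, mem_elems, true_and]
    show _ ↔ w.map f = [a]
    simp [List.map_eq_cons_iff, and_comm]
  | plus p q ihp ihq =>
    intro w
    show w ∈ (recomap f p).matches' + (recomap f q).matches' ↔ w.map f ∈ p.matches' + q.matches'
    simp [Language.mem_add, ihp, ihq]
  | comp p q ihp ihq =>
    intro w
    show w ∈ (recomap f p).matches' * (recomap f q).matches' ↔ w.map f ∈ p.matches' * q.matches'
    simp only [Language.mem_mul, ihp, ihq]
    constructor
    · rintro ⟨u, hu, v, hv, rfl⟩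
      exact ⟨_, hu, _, hv, by simp⟩
    · rintro ⟨u, hu, v, hv, h⟩
      obtain ⟨u', v', rfl, rfl, rfl⟩ := List.map_eq_append_iff.1 h.symm
      exact ⟨_, hu, _, hv, rfl⟩
  | star p ih =>
    intro w
    show w ∈ KStar.kstar (recomap f p).matches' ↔ w.map f ∈ KStar.kstar p.matches'
    simp only [Language.mem_kstar]
    constructor
    · rintro ⟨L, rfl, hL⟩
      refine ⟨L.map (List.map f), by simp [List.map_flatten], ?_⟩
      intro y hy
      obtain ⟨z, hz, rfl⟩ := List.mem_map.1 hy
      exact (ih z).1 (hL z hz)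
    · rintro ⟨L, hw, hL⟩
      induction L generalizing w with
      | nil =>
        refine ⟨[], by simpa using hw, by simp⟩
      | cons l L ihL =>
        obtain ⟨u', v', rfl, rfl, h⟩ := List.map_eq_append_iff.1 (hw.trans List.flatten_cons)
        obtain ⟨L', rfl, hL'⟩ := ihL v' h (fun y hy => hL y (List.mem_cons_of_mem _ hy))
        refine ⟨u' :: L', by simp, ?_⟩
        intro y hy
        rcases List.mem_cons.1 hy with rfl | hy
        · exact (ih _).2 (hL _ (List.mem_cons_self))
        · exact hL' y hy

/-- Relabeling of a signed basic test along `f`: a conjunction of tests. -/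
noncomputable def recolorB {A B B' Q : Type} [Finite A] [Finite B'] (f : B' → B) :
    Bool × BTest A B Q → List (Bool × BTest A B' Q)
  | (n, .state p) => [(n, .state p)]
  | (n, .eq) => [(n, .eq)]
  | (n, .deq e) => [(n, .deq (recomap (Prod.map id f) e))]
  | (n, .dneq e) => [(n, .dneq (recomap (Prod.map id f) e))]
  | (n, .root) => [(n, .root)]
  | (n, .leaf) => [(n, .leaf)]
  | (n, .lab a) => [(n, .lab a)]
  | (n, .ilab b) =>
      ((elems B').filter fun b' => ¬ (f b' = b ↔ n = false)).map fun b' => (true, .ilab b')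

theorem testHolds_recolorB {A B B' Q D : Type} [Finite A] [Finite B'] (f : B' → B)
    (τ : DataTree A D) (bl : Pos → B') (x : Pos) (q : Q) (d : D) (nt : Bool × BTest A B Q) :
    testHolds τ bl x q d (recolorB f nt) ↔
      (basicHolds τ (f ∘ bl) x q d nt.2 ↔ nt.1 = false) := by
  obtain ⟨n, bt⟩ := nt
  have key : ∀ (e : RegularExpression (A × B)) (p : List Pos),
      (p.map fun z => (τ.label z, bl z)) ∈ (recomap (Prod.map id f) e).matches' ↔
      (p.map fun z => (τ.label z, (f ∘ bl) z)) ∈ e.matches' := by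
    intro e p
    rw [mem_recomap, List.map_map]
    rfl
  cases bt with
  | ilab b =>
    simp only [recolorB, testHolds, List.mem_map, List.mem_filter, mem_elems, true_and,
      decide_eq_true_eq]
    constructor
    · intro h
      by_contra hc
      have := h (true, .ilab (bl x)) ⟨bl x, hc, rfl⟩
      simp [basicHolds] at this
    · rintro h nt ⟨b', hb', rfl⟩
      simp only [basicHolds, Bool.true_eq_false, iff_false]
      rintro rfl
      exact hb' h
  | deq e => simp only [recolorB, testHolds, List.mem_singleton, forall_eq, basicHolds, key]
  | dneq e => simp only [recolorB, testHolds, List.mem_singleton, forall_eq, basicHolds, key]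
  | _ => simp [recolorB, testHolds, basicHolds]

/-- Relabeling of conjunctions of tests. -/
noncomputable def recolorT {A B B' Q : Type} [Finite A] [Finite B'] (f : B' → B)
    (t : List (Bool × BTest A B Q)) : List (Bool × BTest A B' Q) :=
  t.flatMap (recolorB f)

theorem testHolds_recolorT {A B B' Q D : Type} [Finite A] [Finite B'] (f : B' → B)
    (τ : DataTree A D) (bl : Pos → B') (x : Pos) (q : Q) (d : D)
    (t : List (Bool × BTest A B Q)) :
    testHolds τ bl x q d (recolorT f t) ↔ testHolds τ (f ∘ bl) x q d t := by
  have h : testHolds τ bl x q d (recolorT f t) ↔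
      ∀ nt ∈ t, testHolds τ bl x q d (recolorB f nt) := by
    simp only [testHolds, recolorT, List.mem_flatMap]
    constructor
    · intro h nt hnt a ha; exact h a ⟨nt, hnt, ha⟩
    · rintro h a ⟨nt, hnt, ha⟩; exact h nt hnt a ha
  rw [h]
  simp only [testHolds_recolorB]
  rfl

/-- Evaluate the state tests at state `q`. -/
noncomputable def specB {A B Q : Type} (q : Q) : Bool × BTest A B Q → Bool × BTest A B Unit
  | (n, .state p) => (if q = p then n else !n, .state ())
  | (n, .eq) => (n, .eq)
  | (n, .deq e) => (n, .deq e)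
  | (n, .dneq e) => (n, .dneq e)
  | (n, .root) => (n, .root)
  | (n, .leaf) => (n, .leaf)
  | (n, .lab a) => (n, .lab a)
  | (n, .ilab b) => (n, .ilab b)

theorem testHolds_spec {A B Q D : Type} (τ : DataTree A D) (bl : Pos → B) (x : Pos)
    (q : Q) (d : D) (t : List (Bool × BTest A B Q)) :
    testHolds τ bl x () d (t.map (specB q)) ↔ testHolds τ bl x q d t := by
  simp only [testHolds, List.mem_map, forall_exists_index, and_imp, forall_apply_eq_imp_iff₂]
  refine forall₂_congr fun nt _ => ?_
  obtain ⟨n, bt⟩ := nt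
  cases bt with
  | state p => by_cases h : q = p <;> cases n <;> simp [specB, basicHolds, h]
  | _ => exact Iff.rfl

/-- Put a state in place of the trivial one. -/
def liftB {A B Q : Type} (q : Q) : Bool × BTest A B Unit → Bool × BTest A B Q
  | (n, .state _) => (n, .state q)
  | (n, .eq) => (n, .eq)
  | (n, .deq e) => (n, .deq e)
  | (n, .dneq e) => (n, .dneq e)
  | (n, .root) => (n, .root)
  | (n, .leaf) => (n, .leaf)
  | (n, .lab a) => (n, .lab a)
  | (n, .ilab b) => (n, .ilab b)

theorem testHolds_lift {A B Q D : Type} (τ : DataTree A D) (bl : Pos → B) (x : Pos)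
    (q : Q) (d : D) (t : List (Bool × BTest A B Unit)) :
    testHolds τ bl x q d (t.map (liftB q)) ↔ testHolds τ bl x () d t := by
  simp only [testHolds, List.mem_map, forall_exists_index, and_imp, forall_apply_eq_imp_iff₂]
  refine forall₂_congr fun nt _ => ?_
  obtain ⟨n, bt⟩ := nt
  cases bt with
  | state p => cases n <;> simp [liftB, basicHolds]
  | _ => exact Iff.rfl

theorem testHolds_cons {A B Q D : Type} (τ : DataTree A D) (bl : Pos → B) (x : Pos)
    (q : Q) (d : D) (nt : Bool × BTest A B Q) (t : List (Bool × BTest A B Q)) :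
    testHolds τ bl x q d (nt :: t) ↔
      (basicHolds τ bl x q d nt.2 ↔ nt.1 = false) ∧ testHolds τ bl x q d t := by
  simp [testHolds]

theorem testHolds_nil {A B Q D : Type} (τ : DataTree A D) (bl : Pos → B) (x : Pos)
    (q : Q) (d : D) : testHolds τ bl x q d ([] : List (Bool × BTest A B Q)) := by
  simp [testHolds]

/-- Map states in actions. -/
def mapAct {Q Q' : Type} (f : Q → Q') : BAct Q → BAct Q'
  | .accept => .accept
  | .keep p => .keep (f p)
  | .store p => .store (f p)
  | .guess p => .guess (f p)
  | .univ p => .univ (f p)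

/-- Pull back a run along a map of states. -/
def pull {Q Q' D : Type} (f : Q → Q') (ρ : Pos → Set (Q' × D)) : Pos → Set (Q × D) :=
  fun x => {qd | (f qd.1, qd.2) ∈ ρ x}

theorem pull_finite {Q Q' D : Type} (f : Q → Q') (hf : Function.Injective f)
    (ρ : Pos → Set (Q' × D)) (x : Pos) (h : (ρ x).Finite) : (pull f ρ x).Finite := by
  have hinj : Function.Injective (Prod.map f (id : D → D)) :=
    Function.Injective.prodMap hf Function.injective_id
  exact Set.Finite.preimage (f := Prod.map f (id : D → D)) hinj.injOn h

theorem actOK_map {A Q Q' D : Type} (f : Q → Q') (τ : DataTree A D) (x y : Pos)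
    (ρ : Pos → Set (Q' × D)) (d : D) (a : BAct Q) :
    actOK τ x y ρ d (mapAct f a) ↔ actOK τ x y (pull f ρ) d a := by
  cases a <;> exact Iff.rfl

theorem actOK_mono {A Q D : Type} (τ : DataTree A D) (x y : Pos)
    (ρ ρ' : Pos → Set (Q × D)) (h : ρ y ⊆ ρ' y) (d : D) (a : BAct Q)
    (ha : actOK τ x y ρ d a) : actOK τ x y ρ' d a := by
  cases a with
  | accept => trivial
  | keep p => exact h ha
  | store p => exact h ha
  | guess p => obtain ⟨e, he⟩ := ha; exact ⟨e, h he⟩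
  | univ p => exact fun e he => h (ha e he)

/-- Normalized automata: the leaves have no register, all nondeterminism at the
leaves is in the internal labeling. -/
structure NA (A B : Type) : Type 1 where
  Q : Type
  Qfin : Finite Q
  leafOK : A → B → Prop
  leafAcc : A → B → Prop
  stores : B → List Q
  guesses : B → List Q
  step : Q → List (List (Bool × BTest A B Unit) × List (BAct Q))
  acc : Q → List (List (Bool × BTest A B Unit))

/-- `ρ` is an accepting run of the normalized automaton `N`. -/
structure NA.Run {A B D : Type} (N : NA A B) (τ : DataTree A D) (bl : Pos → B)
    (ρ : Pos → Set (N.Q × D)) : Prop where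
  fin : ∀ x ∈ τ.pos, (ρ x).Finite
  leaf : ∀ (y : Pos) (i : ℕ), y ++ [i] ∈ τ.pos → IsLeaf τ (y ++ [i]) →
    N.leafOK (τ.label (y ++ [i])) (bl (y ++ [i])) ∧
    (∀ p ∈ N.stores (bl (y ++ [i])), (p, τ.data (y ++ [i])) ∈ ρ y) ∧
    (∀ p ∈ N.guesses (bl (y ++ [i])), ∃ e, (p, e) ∈ ρ y)
  inner : ∀ (y : Pos) (i : ℕ), y ++ [i] ∈ τ.pos → ¬ IsLeaf τ (y ++ [i]) →
    ∀ q d, (q, d) ∈ ρ (y ++ [i]) → ∃ tr ∈ N.step q,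
      testHolds τ bl (y ++ [i]) () d tr.1 ∧ ∀ a ∈ tr.2, actOK τ (y ++ [i]) y ρ d a
  rootLeaf : IsLeaf τ [] → N.leafAcc (τ.label []) (bl [])
  rootAcc : ¬ IsLeaf τ [] → ∀ q d, (q, d) ∈ ρ [] → ∃ t ∈ N.acc q, testHolds τ bl [] () d t

/-- Acceptance of a tree with given internal labeling. -/
def NA.AccBy {A B D : Type} (N : NA A B) (τ : DataTree A D) (bl : Pos → B) : Prop :=
  ∃ ρ, N.Run τ bl ρ

/-- Relabeling. -/
noncomputable def NA.recolor {A B B' : Type} [Finite A] [Finite B'] (N : NA A B) (f : B' → B) :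
    NA A B' where
  Q := N.Q
  Qfin := N.Qfin
  leafOK a b := N.leafOK a (f b)
  leafAcc a b := N.leafAcc a (f b)
  stores b := N.stores (f b)
  guesses b := N.guesses (f b)
  step q := (N.step q).map fun tr => (recolorT f tr.1, tr.2)
  acc q := (N.acc q).map (recolorT f)

theorem NA.recolor_accBy {A B B' D : Type} [Finite A] [Finite B'] (N : NA A B) (f : B' → B)
    (τ : DataTree A D) (bl : Pos → B') :
    (N.recolor f).AccBy τ bl ↔ N.AccBy τ (f ∘ bl) := by
  constructor
  · rintro ⟨ρ, h⟩
    refine ⟨ρ, h.fin, h.leaf, ?_, h.rootLeaf, ?_⟩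
    · intro y i hx hl q d hq
      obtain ⟨tr, htr, h1, h2⟩ := h.inner y i hx hl q d hq
      obtain ⟨tr', htr', rfl⟩ := List.mem_map.1 htr
      exact ⟨tr', htr', (testHolds_recolorT ..).1 h1, h2⟩
    · intro hl q d hq
      obtain ⟨t, ht, h1⟩ := h.rootAcc hl q d hq
      obtain ⟨t', ht', rfl⟩ := List.mem_map.1 ht
      exact ⟨t', ht', (testHolds_recolorT ..).1 h1⟩
  · rintro ⟨ρ, h⟩
    refine ⟨ρ, h.fin, h.leaf, ?_, h.rootLeaf, ?_⟩
    · intro y i hx hl q d hq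
      obtain ⟨tr, htr, h1, h2⟩ := h.inner y i hx hl q d hq
      exact ⟨_, List.mem_map_of_mem htr, (testHolds_recolorT ..).2 h1, h2⟩
    · intro hl q d hq
      obtain ⟨t, ht, h1⟩ := h.rootAcc hl q d hq
      exact ⟨_, List.mem_map_of_mem ht, (testHolds_recolorT ..).2 h1⟩

/-- Conjunction of two normalized automata reading the same internal labeling. -/
def NA.inter {A B : Type} (N₁ N₂ : NA A B) : NA A B where
  Q := N₁.Q ⊕ N₂.Q
  Qfin := by
    have := N₁.Qfin
    have := N₂.Qfin
    infer_instance
  leafOK a b := N₁.leafOK a b ∧ N₂.leafOK a b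
  leafAcc a b := N₁.leafAcc a b ∧ N₂.leafAcc a b
  stores b := (N₁.stores b).map Sum.inl ++ (N₂.stores b).map Sum.inr
  guesses b := (N₁.guesses b).map Sum.inl ++ (N₂.guesses b).map Sum.inr
  step := Sum.elim (fun q => (N₁.step q).map fun tr => (tr.1, tr.2.map (mapAct Sum.inl)))
    (fun q => (N₂.step q).map fun tr => (tr.1, tr.2.map (mapAct Sum.inr)))
  acc := Sum.elim N₁.acc N₂.acc

/-- Combine two runs. -/
def glue {Q₁ Q₂ D : Type} (ρ₁ : Pos → Set (Q₁ × D)) (ρ₂ : Pos → Set (Q₂ × D)) :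
    Pos → Set ((Q₁ ⊕ Q₂) × D) :=
  fun x => {qd | Sum.elim (fun q => (q, qd.2) ∈ ρ₁ x) (fun q => (q, qd.2) ∈ ρ₂ x) qd.1}

theorem glue_finite {Q₁ Q₂ D : Type} (ρ₁ : Pos → Set (Q₁ × D)) (ρ₂ : Pos → Set (Q₂ × D))
    (x : Pos) (h₁ : (ρ₁ x).Finite) (h₂ : (ρ₂ x).Finite) : (glue ρ₁ ρ₂ x).Finite := by
  refine ((h₁.image (Prod.map Sum.inl id)).union (h₂.image (Prod.map Sum.inr id))).subset ?_
  rintro ⟨q | q, d⟩ h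
  · exact Or.inl ⟨(q, d), h, rfl⟩
  · exact Or.inr ⟨(q, d), h, rfl⟩

theorem NA.inter_accBy {A B D : Type} (N₁ N₂ : NA A B) (τ : DataTree A D) (bl : Pos → B) :
    (N₁.inter N₂).AccBy τ bl ↔ N₁.AccBy τ bl ∧ N₂.AccBy τ bl := by
  constructor
  · rintro ⟨ρ, h⟩
    constructor
    · refine ⟨pull Sum.inl ρ, fun x hx => pull_finite _ Sum.inl_injective _ _ (h.fin x hx),
        ?_, ?_, fun hl => (h.rootLeaf hl).1, fun hl q d hq => h.rootAcc hl (Sum.inl q) d hq⟩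
      · intro y i hx hl
        obtain ⟨h1, h2, h3⟩ := h.leaf y i hx hl
        exact ⟨h1.1, fun p hp => h2 _ (List.mem_append_left _ (List.mem_map_of_mem hp)),
          fun p hp => h3 _ (List.mem_append_left _ (List.mem_map_of_mem hp))⟩
      · intro y i hx hl q d hq
        obtain ⟨tr, htr, h1, h2⟩ := h.inner y i hx hl (Sum.inl q) d hq
        obtain ⟨tr', htr', rfl⟩ := List.mem_map.1 htr
        exact ⟨tr', htr', h1, fun a ha => (actOK_map ..).1 (h2 _ (List.mem_map_of_mem ha))⟩
    · refine ⟨pull Sum.inr ρ, fun x hx => pull_finite _ Sum.inr_injective _ _ (h.fin x hx),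
        ?_, ?_, fun hl => (h.rootLeaf hl).2, fun hl q d hq => h.rootAcc hl (Sum.inr q) d hq⟩
      · intro y i hx hl
        obtain ⟨h1, h2, h3⟩ := h.leaf y i hx hl
        exact ⟨h1.2, fun p hp => h2 _ (List.mem_append_right _ (List.mem_map_of_mem hp)),
          fun p hp => h3 _ (List.mem_append_right _ (List.mem_map_of_mem hp))⟩
      · intro y i hx hl q d hq
        obtain ⟨tr, htr, h1, h2⟩ := h.inner y i hx hl (Sum.inr q) d hq
        obtain ⟨tr', htr', rfl⟩ := List.mem_map.1 htr
        exact ⟨tr', htr', h1, fun a ha => (actOK_map ..).1 (h2 _ (List.mem_map_of_mem ha))⟩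
  · rintro ⟨⟨ρ₁, h₁⟩, ⟨ρ₂, h₂⟩⟩
    refine ⟨glue ρ₁ ρ₂, fun x hx => glue_finite _ _ _ (h₁.fin x hx) (h₂.fin x hx), ?_, ?_,
      fun hl => ⟨h₁.rootLeaf hl, h₂.rootLeaf hl⟩, ?_⟩
    · intro y i hx hl
      obtain ⟨a1, a2, a3⟩ := h₁.leaf y i hx hl
      obtain ⟨b1, b2, b3⟩ := h₂.leaf y i hx hl
      refine ⟨⟨a1, b1⟩, ?_, ?_⟩
      · intro p hp
        rcases List.mem_append.1 hp with hp | hp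
        · obtain ⟨p', hp', rfl⟩ := List.mem_map.1 hp
          exact a2 p' hp'
        · obtain ⟨p', hp', rfl⟩ := List.mem_map.1 hp
          exact b2 p' hp'
      · intro p hp
        rcases List.mem_append.1 hp with hp | hp
        · obtain ⟨p', hp', rfl⟩ := List.mem_map.1 hp
          exact a3 p' hp'
        · obtain ⟨p', hp', rfl⟩ := List.mem_map.1 hp
          exact b3 p' hp'
    · rintro y i hx hl (q | q) d hq
      · obtain ⟨tr, htr, t1, t2⟩ := h₁.inner y i hx hl q d hq
        refine ⟨_, List.mem_map_of_mem htr, t1, fun a ha => ?_⟩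
        obtain ⟨a', ha', rfl⟩ := List.mem_map.1 ha
        exact (actOK_map ..).2 (t2 a' ha')
      · obtain ⟨tr, htr, t1, t2⟩ := h₂.inner y i hx hl q d hq
        refine ⟨_, List.mem_map_of_mem htr, t1, fun a ha => ?_⟩
        obtain ⟨a', ha', rfl⟩ := List.mem_map.1 ha
        exact (actOK_map ..).2 (t2 a' ha')
    · rintro hl (q | q) d hq
      · exact h₁.rootAcc hl q d hq
      · exact h₂.rootAcc hl q d hq

/-- Switch the automaton off at leaves whose label satisfies `P`. -/
noncomputable def NA.orSide {A B : Type} (N : NA A B) (P : B → Prop) : NA A B where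
  Q := N.Q
  Qfin := N.Qfin
  leafOK a b := P b ∨ N.leafOK a b
  leafAcc a b := P b ∨ N.leafAcc a b
  stores b := if P b then [] else N.stores b
  guesses b := if P b then [] else N.guesses b
  step := N.step
  acc := N.acc

theorem NA.orSide_on {A B D : Type} (N : NA A B) (P : B → Prop) (τ : DataTree A D)
    (bl : Pos → B) (h : ∀ x ∈ τ.pos, P (bl x)) : (N.orSide P).AccBy τ bl := by
  refine ⟨fun _ => ∅, fun _ _ => Set.finite_empty, ?_, ?_, fun _ => Or.inl (h _ τ.root_mem), ?_⟩
  · intro y i hx hl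
    have e1 : (N.orSide P).stores (bl (y ++ [i])) = [] := if_pos (h _ hx)
    have e2 : (N.orSide P).guesses (bl (y ++ [i])) = [] := if_pos (h _ hx)
    rw [e1, e2]
    exact ⟨Or.inl (h _ hx), fun p hp => absurd hp List.not_mem_nil,
      fun p hp => absurd hp List.not_mem_nil⟩
  · intro y i hx hl q d hq
    exact hq.elim
  · intro hl q d hq
    exact hq.elim

theorem NA.orSide_off {A B D : Type} (N : NA A B) (P : B → Prop) (τ : DataTree A D)
    (bl : Pos → B) (h : ∀ x ∈ τ.pos, ¬ P (bl x)) :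
    (N.orSide P).AccBy τ bl ↔ N.AccBy τ bl := by
  constructor
  · rintro ⟨ρ, r⟩
    refine ⟨ρ, r.fin, ?_, r.inner, fun hl => (r.rootLeaf hl).resolve_left (h _ τ.root_mem),
      r.rootAcc⟩
    intro y i hx hl
    have e1 : (N.orSide P).stores (bl (y ++ [i])) = N.stores _ := if_neg (h _ hx)
    have e2 : (N.orSide P).guesses (bl (y ++ [i])) = N.guesses _ := if_neg (h _ hx)
    have := r.leaf y i hx hl
    rw [e1, e2] at this
    exact ⟨this.1.resolve_left (h _ hx), this.2⟩
  · rintro ⟨ρ, r⟩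
    refine ⟨ρ, r.fin, ?_, r.inner, fun hl => Or.inr (r.rootLeaf hl), r.rootAcc⟩
    intro y i hx hl
    have e1 : (N.orSide P).stores (bl (y ++ [i])) = N.stores _ := if_neg (h _ hx)
    have e2 : (N.orSide P).guesses (bl (y ++ [i])) = N.guesses _ := if_neg (h _ hx)
    have := r.leaf y i hx hl
    rw [e1, e2]
    exact ⟨Or.inr this.1, this.2⟩

/-- The automaton checking that `side` is constant on the tree. -/
noncomputable def constNA (A : Type) {B : Type} [Finite B] (side : B → Bool) : NA A B where
  Q := Bool
  Qfin := inferInstance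
  leafOK _ _ := True
  leafAcc _ _ := True
  stores b := [side b]
  guesses _ := []
  step s := ((elems B).filter fun b => side b = s).map fun b => ([(false, .ilab b)], [.keep s])
  acc s := ((elems B).filter fun b => side b = s).map fun b => [(false, .ilab b)]

theorem not_isLeaf {A D : Type} {τ : DataTree A D} {y : Pos} {i : ℕ} (h : y ++ [i] ∈ τ.pos) :
    ¬ IsLeaf τ y := fun hl => hl i h

theorem constNA_accBy {A B D : Type} [Finite B] (side : B → Bool) (τ : DataTree A D)
    (bl : Pos → B) :
    (constNA A side).AccBy τ bl ↔ ∃ s, ∀ x ∈ τ.pos, side (bl x) = s := by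
  constructor
  · rintro ⟨ρ, r⟩
    have up : ∀ y i, y ++ [i] ∈ τ.pos → ¬ IsLeaf τ (y ++ [i]) → ∀ s d, (s, d) ∈ ρ (y ++ [i]) →
        side (bl (y ++ [i])) = s ∧ (s, d) ∈ ρ y := by
      intro y i hx hl s d hs
      obtain ⟨tr, htr, h1, h2⟩ := r.inner y i hx hl s d hs
      obtain ⟨b, hb, rfl⟩ := List.mem_map.1 htr
      have hb' : side b = s := by simpa [mem_elems] using hb
      have h3 : bl (y ++ [i]) = b := by simpa [testHolds, basicHolds] using h1
      exact ⟨by rw [h3, hb'], h2 _ (List.mem_singleton.2 rfl)⟩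
    have lab : ∀ x ∈ τ.pos, ¬ IsLeaf τ x → ∀ s d, (s, d) ∈ ρ x → side (bl x) = s := by
      intro x hx hl s d hs
      rcases List.eq_nil_or_concat x with rfl | ⟨y, i, rfl⟩
      · obtain ⟨t, ht, h1⟩ := r.rootAcc hl s d hs
        obtain ⟨b, hb, rfl⟩ := List.mem_map.1 ht
        have hb' : side b = s := by simpa [mem_elems] using hb
        have h3 : bl [] = b := by simpa [testHolds, basicHolds] using h1
        rw [h3, hb']
      · simp only [List.concat_eq_append] at *
        exact (up y i hx hl s d hs).1
    have ne : ∀ n : ℕ, ∀ x ∈ τ.pos, τ.pos.sup List.length - x.length ≤ n → ¬ IsLeaf τ x →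
        ∃ s d, (s, d) ∈ ρ x := by
      intro n
      induction n with
      | zero =>
        intro x hx hn hl
        obtain ⟨i, hi⟩ : ∃ i, x ++ [i] ∈ τ.pos := by simpa [IsLeaf] using hl
        have := Finset.le_sup (f := List.length) hi
        have hlen : (x ++ [i]).length = x.length + 1 := by simp
        rw [hlen] at this
        omega
      | succ n ih =>
        intro x hx hn hl
        obtain ⟨i, hi⟩ : ∃ i, x ++ [i] ∈ τ.pos := by simpa [IsLeaf] using hl
        have hlen : (x ++ [i]).length = x.length + 1 := by simp
        by_cases hl' : IsLeaf τ (x ++ [i])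
        · exact ⟨_, _, (r.leaf x i hi hl').2.1 _ (List.mem_singleton.2 rfl)⟩
        · obtain ⟨s, d, hs⟩ := ih (x ++ [i]) hi (by rw [hlen]; omega) hl'
          exact ⟨s, d, (up x i hi hl' s d hs).2⟩
    have same : ∀ y i, y ++ [i] ∈ τ.pos → side (bl (y ++ [i])) = side (bl y) := by
      intro y i hx
      have hy := τ.parent_closed y i hx
      by_cases hl : IsLeaf τ (y ++ [i])
      · exact (lab y hy (not_isLeaf hx) _ _
          ((r.leaf y i hx hl).2.1 _ (List.mem_singleton.2 rfl))).symm
      · obtain ⟨s, d, hs⟩ := ne _ _ hx le_rfl hl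
        have h := up y i hx hl s d hs
        rw [h.1, lab y hy (not_isLeaf hx) _ _ h.2]
    refine ⟨side (bl []), fun x => ?_⟩
    induction x using List.reverseRecOn with
    | nil => intro _; rfl
    | append_singleton y i ih =>
      intro hx
      rw [same y i hx, ih (τ.parent_closed y i hx)]
  · rintro ⟨s, hs⟩
    refine ⟨fun _ => (fun z => (s, τ.data z)) '' (τ.pos : Set Pos),
      fun _ _ => (Finset.finite_toSet _).image _, ?_, ?_, fun _ => trivial, ?_⟩
    · intro y i hx hl
      refine ⟨trivial, ?_, ?_⟩
      · intro p hp
        have hp' : p = side (bl (y ++ [i])) := List.mem_singleton.1 hp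
        exact ⟨y ++ [i], hx, by rw [hp', hs _ hx]⟩
      · intro p hp
        exact absurd hp List.not_mem_nil
    · rintro y i hx hl q d ⟨z, hz, h⟩
      obtain ⟨rfl, rfl⟩ := Prod.mk.inj h
      refine ⟨_, List.mem_map_of_mem (a := bl (y ++ [i])) ?_, ?_, ?_⟩
      · simp [mem_elems, hs _ hx]
      · simp [testHolds, basicHolds]
      · intro a ha
        rw [List.mem_singleton.1 ha]
        exact ⟨z, hz, rfl⟩
    · rintro hl q d ⟨z, hz, h⟩
      obtain ⟨rfl, rfl⟩ := Prod.mk.inj h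
      refine ⟨_, List.mem_map_of_mem (a := bl []) ?_, ?_⟩
      · simp [mem_elems, hs _ τ.root_mem]
      · simp [testHolds, basicHolds]

/-- The transitions of the BUDTA of a normalized automaton. -/
noncomputable def NA.toδ {A B : Type} [Finite A] [Finite B] (N : NA A B) :
    List (Trans A B (Option N.Q)) :=
  ((@elems N.Q N.Qfin).flatMap fun q => (N.step q).map fun tr =>
    ((false, .state (some q)) :: tr.1.map (liftB (some q)),
      tr.2.map (mapAct some) ++ [.accept, .accept])) ++
  (((@elems N.Q N.Qfin).flatMap fun q => (N.acc q).map fun t =>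
    ((false, .state (some q)) :: (false, .root) :: t.map (liftB (some q)), [.accept])) ++
  (((elems (A × B)).filter fun c => N.leafOK c.1 c.2).map (fun c =>
    ([(false, .state none), (false, .lab c.1), (false, .ilab c.2)],
      ((N.stores c.2).map fun p => .store (some p)) ++
      (((N.guesses c.2).map fun p => .guess (some p)) ++ [.accept, .accept]))) ++
  ((elems (A × B)).filter fun c => N.leafAcc c.1 c.2).map (fun c =>
    ([(false, .state none), (false, .root), (false, .lab c.1), (false, .ilab c.2)],
      [.accept]))))

/-- From normalized automata to BUDTA. -/
noncomputable def NA.toBUDTA {A B : Type} [Finite A] [Finite B] (N : NA A B) : BUDTA A where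
  B := B
  Bfin := inferInstance
  Q := Option N.Q
  Qfin := by
    have := N.Qfin
    infer_instance
  q0 := none
  δ := N.toδ

theorem NA.mem_toBUDTA {A B : Type} [Finite A] [Finite B] (N : NA A B)
    (tr : Trans A B (Option N.Q)) :
    tr ∈ N.toδ ↔
      (∃ q, ∃ s ∈ N.step q, ((false, .state (some q)) :: s.1.map (liftB (some q)),
        s.2.map (mapAct some) ++ [.accept, .accept]) = tr) ∨
      (∃ q, ∃ t ∈ N.acc q,
        ((false, .state (some q)) :: (false, .root) :: t.map (liftB (some q)), [.accept]) = tr) ∨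
      (∃ a b, N.leafOK a b ∧
        ([(false, .state none), (false, .lab a), (false, .ilab b)],
        ((N.stores b).map fun p => .store (some p)) ++
        (((N.guesses b).map fun p => .guess (some p)) ++ [.accept, .accept])) = tr) ∨
      (∃ a b, N.leafAcc a b ∧
        ([(false, .state none), (false, .root), (false, .lab a), (false, .ilab b)],
        [.accept]) = tr) := by
  have := N.Qfin
  have e : ∀ P : A × B → Prop, (∃ c, P c) ↔ ∃ a b, P (a, b) := fun P => Prod.exists
  simp only [NA.toδ, List.mem_append, List.mem_flatMap, List.mem_map, List.mem_filter,
    mem_elems, true_and, decide_eq_true_eq, e]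

theorem NA.toδ_accepts {A B D : Type} [Finite A] [Finite B] [Nonempty D] (N : NA A B)
    (τ : DataTree A D) :
    (∃ bl : Pos → B, ∃ ρ : Pos → Set (Option N.Q × D), IsAcceptingRun none N.toδ τ bl ρ) ↔
      ∃ bl, N.AccBy τ bl := by
  constructor
  · rintro ⟨bl, ρ, ⟨hfin, hleaf, hrun⟩, hacc⟩
    refine ⟨bl, pull some ρ, fun x hx => pull_finite _ (Option.some_injective _) _ _ (hfin x hx),
      ?_, ?_, ?_, ?_⟩
    · intro y i hx hl
      obtain ⟨e, he⟩ := hleaf _ hx hl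
      obtain ⟨tr, htr, h1, h2⟩ := hrun y i hx (none, e) (by rw [he]; rfl)
      rcases (N.mem_toBUDTA tr).1 htr with ⟨q, s, hs, rfl⟩ | ⟨q, t, ht, rfl⟩ |
        ⟨a, b, hab, rfl⟩ | ⟨a, b, hab, rfl⟩
      · simp [testHolds, basicHolds] at h1
      · simp [testHolds, basicHolds] at h1
      · obtain ⟨rfl, rfl⟩ : τ.label (y ++ [i]) = a ∧ bl (y ++ [i]) = b := by
          simpa [testHolds, basicHolds] using h1
        refine ⟨hab, ?_, ?_⟩
        · intro p hp
          exact h2 (.store (some p)) (List.mem_append_left _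
            (List.mem_map_of_mem (f := fun p => BAct.store (some p)) hp))
        · intro p hp
          exact h2 (.guess (some p)) (List.mem_append_right _ (List.mem_append_left _
            (List.mem_map_of_mem (f := fun p => BAct.guess (some p)) hp)))
      · simp [testHolds, basicHolds] at h1
    · intro y i hx hl q d hq
      obtain ⟨tr, htr, h1, h2⟩ := hrun y i hx (some q, d) hq
      rcases (N.mem_toBUDTA tr).1 htr with ⟨q', s, hs, rfl⟩ | ⟨q', t, ht, rfl⟩ |
        ⟨a, b, hab, rfl⟩ | ⟨a, b, hab, rfl⟩
      · rw [testHolds_cons] at h1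
        obtain rfl : q = q' := by simpa [basicHolds] using h1.1
        refine ⟨s, hs, (testHolds_lift ..).1 h1.2, fun a ha => ?_⟩
        exact (actOK_map ..).1 (h2 _ (List.mem_append_left _ (List.mem_map_of_mem ha)))
      · rw [testHolds_cons, testHolds_cons] at h1
        have := h1.2.1
        simp [basicHolds] at this
      · simp [testHolds, basicHolds] at h1
      · simp [testHolds, basicHolds] at h1
    · intro hl
      obtain ⟨e, he⟩ := hleaf _ τ.root_mem hl
      obtain ⟨t, htr, h1⟩ := hacc (none, e) (by rw [he]; rfl)
      rcases (N.mem_toBUDTA _).1 htr with ⟨q', s, hs, h⟩ | ⟨q', t, ht, h⟩ |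
        ⟨a, b, hab, h⟩ | ⟨a, b, hab, h⟩
      · have := congrArg (fun z => z.2.length) h
        simp at this
      · obtain ⟨rfl, -⟩ := Prod.mk.inj h
        simp [testHolds, basicHolds] at h1
      · have := congrArg (fun z => z.2.length) h
        simp at this
        omega
      · obtain ⟨rfl, -⟩ := Prod.mk.inj h
        obtain ⟨rfl, rfl⟩ : τ.label [] = a ∧ bl [] = b := by
          simpa [testHolds, basicHolds] using h1
        exact hab
    · intro hl q d hq
      obtain ⟨t, htr, h1⟩ := hacc (some q, d) hq
      rcases (N.mem_toBUDTA _).1 htr with ⟨q', s, hs, h⟩ | ⟨q', t, ht, h⟩ |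
        ⟨a, b, hab, h⟩ | ⟨a, b, hab, h⟩
      · have := congrArg (fun z => z.2.length) h
        simp at this
      · obtain ⟨rfl, -⟩ := Prod.mk.inj h
        rw [testHolds_cons, testHolds_cons] at h1
        obtain rfl : q = q' := by simpa [basicHolds] using h1.1
        exact ⟨t, ht, (testHolds_lift ..).1 h1.2.2⟩
      · have := congrArg (fun z => z.2.length) h
        simp at this
        omega
      · obtain ⟨rfl, -⟩ := Prod.mk.inj h
        simp [testHolds, basicHolds] at h1
  · rintro ⟨bl, ρ, r⟩
    obtain ⟨e₀⟩ := ‹Nonempty D›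
    let ρ' : Pos → Set (Option N.Q × D) := fun x =>
      if IsLeaf τ x then {(none, e₀)} else Prod.map some id '' ρ x
    have hl1 : ∀ x, IsLeaf τ x → ρ' x = {(none, e₀)} := fun x hx => if_pos hx
    have hl2 : ∀ x, ¬ IsLeaf τ x → ρ' x = Prod.map some id '' ρ x := fun x hx => if_neg hx
    have hin : ∀ x, ¬ IsLeaf τ x → ∀ q d, (q, d) ∈ ρ x → (some q, d) ∈ ρ' x := by
      intro x hx q d h
      rw [hl2 x hx]
      exact ⟨(q, d), h, rfl⟩
    refine ⟨bl, ρ', ⟨?_, ?_, ?_⟩, ?_⟩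
    · intro x hx
      by_cases hl : IsLeaf τ x
      · rw [hl1 x hl]; exact Set.finite_singleton _
      · rw [hl2 x hl]; exact (r.fin x hx).image _
    · intro x hx hl
      exact ⟨e₀, hl1 x hl⟩
    · intro y i hx qd hqd
      have hy := not_isLeaf hx
      by_cases hl : IsLeaf τ (y ++ [i])
      · rw [hl1 _ hl] at hqd
        obtain rfl := Set.mem_singleton_iff.1 hqd
        obtain ⟨h1, h2, h3⟩ := r.leaf y i hx hl
        refine ⟨_, (N.mem_toBUDTA _).2 (Or.inr (Or.inr (Or.inl ⟨_, _, h1, rfl⟩))), ?_, ?_⟩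
        · simp [testHolds, basicHolds]
        · intro a ha
          rcases List.mem_append.1 ha with ha | ha
          · obtain ⟨p, hp, rfl⟩ := List.mem_map.1 ha
            exact hin y hy _ _ (h2 p hp)
          · rcases List.mem_append.1 ha with ha | ha
            · obtain ⟨p, hp, rfl⟩ := List.mem_map.1 ha
              obtain ⟨e, he⟩ := h3 p hp
              exact ⟨e, hin y hy _ _ he⟩
            · obtain rfl : a = .accept := by simpa using ha
              trivial
      · rw [hl2 _ hl] at hqd
        obtain ⟨⟨q, d⟩, hq, rfl⟩ := hqd
        obtain ⟨tr, htr, h1, h2⟩ := r.inner y i hx hl q d hq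
        refine ⟨_, (N.mem_toBUDTA _).2 (Or.inl ⟨_, _, htr, rfl⟩), ?_, ?_⟩
        · exact (testHolds_cons ..).2 ⟨by simp [basicHolds], (testHolds_lift ..).2 h1⟩
        · intro a ha
          rcases List.mem_append.1 ha with ha | ha
          · obtain ⟨a', ha', rfl⟩ := List.mem_map.1 ha
            refine (actOK_map ..).2 (actOK_mono τ _ _ ρ _ ?_ _ _ (h2 a' ha'))
            rintro ⟨q, d⟩ h
            exact hin y hy _ _ h
          · obtain rfl : a = .accept := by simpa using ha
            trivial
    · intro qd hqd
      by_cases hl : IsLeaf τ []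
      · rw [hl1 _ hl] at hqd
        obtain rfl := Set.mem_singleton_iff.1 hqd
        refine ⟨_, (N.mem_toBUDTA _).2 (Or.inr (Or.inr (Or.inr ⟨_, _, r.rootLeaf hl, rfl⟩))), ?_⟩
        simp [testHolds, basicHolds]
      · rw [hl2 _ hl] at hqd
        obtain ⟨⟨q, d⟩, hq, rfl⟩ := hqd
        obtain ⟨t, ht, h1⟩ := r.rootAcc hl q d hq
        refine ⟨_, (N.mem_toBUDTA _).2 (Or.inr (Or.inl ⟨_, _, ht, rfl⟩)), ?_⟩
        exact (testHolds_cons ..).2 ⟨by simp [basicHolds], (testHolds_cons ..).2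
          ⟨by simp [basicHolds], (testHolds_lift ..).2 h1⟩⟩

theorem NA.toBUDTA_accepts {A B D : Type} [Finite A] [Finite B] [Nonempty D] (N : NA A B)
    (τ : DataTree A D) : Accepts N.toBUDTA τ ↔ ∃ bl, N.AccBy τ bl :=
  N.toδ_accepts τ

/-- States of `keep` actions. -/
def keeps {Q : Type} (l : List (BAct Q)) : List Q :=
  l.filterMap fun a => match a with
    | .keep p => some p
    | _ => none

/-- States of `store` and `univ` actions (they agree at leaves). -/
def storesL {Q : Type} (l : List (BAct Q)) : List Q :=
  l.filterMap fun a => match a with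
    | .store p => some p
    | .univ p => some p
    | _ => none

/-- States of `guess` actions. -/
def guessesL {Q : Type} (l : List (BAct Q)) : List Q :=
  l.filterMap fun a => match a with
    | .guess p => some p
    | _ => none

theorem subtreeData_leaf {A D : Type} (τ : DataTree A D) (x : Pos) (hx : x ∈ τ.pos)
    (hl : IsLeaf τ x) : subtreeData τ x = {τ.data x} := by
  ext d
  constructor
  · rintro ⟨z, hz, ⟨w, rfl⟩, rfl⟩
    have : ∀ w : List ℕ, x ++ w ∈ τ.pos → w = [] := by
      intro w
      induction w using List.reverseRecOn with
      | nil => intro _; rfl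
      | append_singleton w i ih =>
        intro h
        rw [← List.append_assoc] at h
        obtain rfl := ih (τ.parent_closed _ _ h)
        rw [List.append_nil] at h
        exact absurd h (hl i)
    rw [this w hz, List.append_nil]
    rfl
  · rintro rfl
    exact ⟨x, hx, List.prefix_rfl, rfl⟩

theorem leaf_acts {A Q D : Type} (τ : DataTree A D) (x y : Pos) (hx : x ∈ τ.pos)
    (hl : IsLeaf τ x) (ρ : Pos → Set (Q × D)) (d : D) (l : List (BAct Q)) :
    (∀ a ∈ l, actOK τ x y ρ d a) ↔
      (∀ p ∈ keeps l, (p, d) ∈ ρ y) ∧ (∀ p ∈ storesL l, (p, τ.data x) ∈ ρ y) ∧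
      (∀ p ∈ guessesL l, ∃ e, (p, e) ∈ ρ y) := by
  induction l with
  | nil => simp [keeps, storesL, guessesL]
  | cons a l ih =>
    rw [List.forall_mem_cons, ih]
    cases a with
    | accept => simp [keeps, storesL, guessesL, actOK]
    | keep p => simp [keeps, storesL, guessesL, actOK, and_assoc]
    | store p => simp [keeps, storesL, guessesL, actOK]; tauto
    | guess p => simp [keeps, storesL, guessesL, actOK]; tauto
    | univ p =>
      simp [keeps, storesL, guessesL, actOK, subtreeData_leaf τ x hx hl]; tauto

/-- Truth value of a basic test at a leaf. -/
def leafSat {A B Q : Type} (a : A) (b : B) (q : Q) (β r : Prop) : BTest A B Q → Prop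
  | .state p => q = p
  | .eq => β
  | .deq e => [(a, b)] ∈ e.matches' ∧ β
  | .dneq e => [(a, b)] ∈ e.matches' ∧ ¬ β
  | .root => r
  | .leaf => True
  | .lab a' => a = a'
  | .ilab b' => b = b'

/-- Truth value of a conjunction of tests at a leaf. -/
def leafTest {A B Q : Type} (a : A) (b : B) (q : Q) (β r : Prop)
    (t : List (Bool × BTest A B Q)) : Prop :=
  ∀ nt ∈ t, (leafSat a b q β r nt.2 ↔ nt.1 = false)

theorem isDownPath_leaf {A D : Type} (τ : DataTree A D) (x : Pos) (hx : x ∈ τ.pos)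
    (hl : IsLeaf τ x) (p : List Pos) : IsDownPath τ x p ↔ p = [x] := by
  constructor
  · rintro ⟨h1, h2, h3, h4⟩
    match p, h1, h2, h3, h4 with
    | [z], _, h2, _, _ => simpa using h2
    | z :: w :: p, _, h2, h3, h4 =>
      obtain rfl : z = x := by simpa using h2
      obtain ⟨i, rfl⟩ := (List.isChain_cons_cons.1 h4).1
      exact absurd (h3 _ (by simp)) (hl i)
  · rintro rfl
    exact ⟨by simp, by simp, by simpa using hx, List.isChain_singleton _⟩

theorem testHolds_leaf {A B Q D : Type} (τ : DataTree A D) (bl : Pos → B) (x : Pos)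
    (hx : x ∈ τ.pos) (hl : IsLeaf τ x) (q : Q) (d : D) (t : List (Bool × BTest A B Q)) :
    testHolds τ bl x q d t ↔ leafTest (τ.label x) (bl x) q (τ.data x = d) (x = []) t := by
  refine forall₂_congr fun nt _ => iff_congr ?_ Iff.rfl
  obtain ⟨n, bt⟩ := nt
  cases bt with
  | deq e => simp [basicHolds, leafSat, isDownPath_leaf τ x hx hl]
  | dneq e => simp [basicHolds, leafSat, isDownPath_leaf τ x hx hl]
  | leaf => simp [basicHolds, leafSat, hl]
  | _ => exact Iff.rfl

/-- Conjunctions of one element from each list. -/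
def combos {α β : Type} : List (List (List α × List β)) → List (List α × List β)
  | [] => [([], [])]
  | L :: Ls => L.flatMap fun s => (combos Ls).map fun t => (s.1 ++ t.1, s.2 ++ t.2)

theorem combos_iff {α β : Type} (P : α → Prop) (R : β → Prop)
    (Ls : List (List (List α × List β))) :
    (∃ tr ∈ combos Ls, (∀ t ∈ tr.1, P t) ∧ ∀ a ∈ tr.2, R a) ↔
      ∀ L ∈ Ls, ∃ tr ∈ L, (∀ t ∈ tr.1, P t) ∧ ∀ a ∈ tr.2, R a := by
  induction Ls with
  | nil => simp [combos]
  | cons L Ls ih =>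
    rw [List.forall_mem_cons, ← ih]
    constructor
    · rintro ⟨tr, htr, h1, h2⟩
      obtain ⟨s, hs, h⟩ := List.mem_flatMap.1 htr
      obtain ⟨t, ht, rfl⟩ := List.mem_map.1 h
      rw [List.forall_mem_append] at h1 h2
      exact ⟨⟨s, hs, h1.1, h2.1⟩, ⟨t, ht, h1.2, h2.2⟩⟩
    · rintro ⟨⟨s, hs, h1, h2⟩, ⟨t, ht, h3, h4⟩⟩
      exact ⟨_, List.mem_flatMap.2 ⟨s, hs, List.mem_map_of_mem ht⟩,
        List.forall_mem_append.2 ⟨h1, h3⟩, List.forall_mem_append.2 ⟨h2, h4⟩⟩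

/-- Two values and a colouring of the data suffice to choose values distinct
from the given ones. -/
theorem exists_colour {D : Type} [Nonempty D] (V : D → Prop) :
    ∃ (col : D → Bool) (v : Bool → D), ∀ d e, e ≠ d → V e →
      v (col d) ≠ d ∧ V (v (col d)) := by
  by_cases h : ∃ v₀ v₁, v₀ ≠ v₁ ∧ V v₀ ∧ V v₁
  · obtain ⟨v₀, v₁, hne, h0, h1⟩ := h
    refine ⟨fun d => decide (d = v₀), fun c => if c then v₁ else v₀, fun d e _ _ => ?_⟩
    by_cases hd : d = v₀
    · subst hd
      simpa using ⟨hne.symm, h1⟩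
    · simpa [hd] using ⟨Ne.symm hd, h0⟩
  · by_cases h' : ∃ v₀, V v₀
    · obtain ⟨v₀, h0⟩ := h'
      refine ⟨fun _ => true, fun _ => v₀, fun d e hne he => ?_⟩
      have : e = v₀ := by
        by_contra hc
        exact h ⟨e, v₀, hc, he, h0⟩
      subst this
      exact ⟨hne, he⟩
    · obtain ⟨d₀⟩ := ‹Nonempty D›
      exact ⟨fun _ => true, fun _ => d₀, fun d e _ he => absurd ⟨e, he⟩ h'⟩

section Normalize

/-- Marks: a transition and a colour. -/
abbrev Mark {A B Q : Type} (δ : List (Trans A B Q)) : Type := {tr // tr ∈ δ} × Bool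

/-- Choices at a leaf: a transition, and either `none` (register equal to the
datum of the leaf) or a colour. -/
abbrev Choice {A B Q : Type} (δ : List (Trans A B Q)) : Type :=
  Option ({tr // tr ∈ δ} × Option Bool)

instance mem_finite {A B Q : Type} (δ : List (Trans A B Q)) : Finite {tr // tr ∈ δ} :=
  (List.finite_toSet δ).to_subtype

/-- The expression for a path to a child with mark `m`. -/
noncomputable def markExp {A B Q : Type} [Finite A] [Finite B] (δ : List (Trans A B Q))
    (m : Mark δ) : RegularExpression (A × (B × Choice δ)) :=
  sumChars (elems _) * sumChars ((elems _).filter fun c => c.2.2 = some (m.1, some m.2))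

theorem markExp_iff {A B Q D : Type} [Finite A] [Finite B] (δ : List (Trans A B Q))
    (m : Mark δ) (τ : DataTree A D) (bl : Pos → B × Choice δ) (y : Pos) (d : D) :
    basicHolds τ bl y () d (.deq (markExp δ m)) ↔
      ∃ i, y ++ [i] ∈ τ.pos ∧ (bl (y ++ [i])).2 = some (m.1, some m.2) ∧
        τ.data (y ++ [i]) = d := by
  simp only [basicHolds, markExp, RegularExpression.matches'_mul, Language.mem_mul, mem_sumChars,
    List.mem_filter, mem_elems, true_and, decide_eq_true_eq]
  constructor
  · rintro ⟨p, z, ⟨h1, h2, h3, h4⟩, h5, ⟨_, ⟨a, rfl⟩, _, ⟨b, hb, rfl⟩, h6⟩, h7⟩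
    match p, h1, h2, h3, h4, h5, h6 with
    | [y', w], _, h2, h3, h4, h5, h6 =>
      obtain rfl : y' = y := by simpa using h2
      obtain rfl : w = z := by simpa using h5
      obtain ⟨i, rfl⟩ := (List.isChain_cons_cons.1 h4).1
      refine ⟨i, h3 _ (by simp), ?_, h7⟩
      simp at h6
      rw [← hb, h6.2]
    | [y'], _, _, _, _, _, h6 => simp at h6
    | _ :: _ :: _ :: _, _, _, _, _, _, h6 => simp at h6
  · rintro ⟨i, hi, hm, hd⟩
    refine ⟨[y, y ++ [i]], y ++ [i], ⟨by simp, by simp, ?_, ?_⟩, by simp,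
      ⟨_, ⟨(τ.label y, bl y), rfl⟩, _, ⟨(τ.label (y ++ [i]), bl (y ++ [i])), hm, rfl⟩, ?_⟩, hd⟩
    · intro z hz
      rcases List.mem_cons.1 hz with rfl | hz
      · exact τ.parent_closed _ _ hi
      · rw [List.mem_singleton.1 hz]; exact hi
    · exact List.isChain_cons_cons.2 ⟨⟨i, rfl⟩, List.isChain_singleton _⟩
    · rfl

/-- Translation of a conjunction of tests at state `q`. -/
noncomputable def baseT {A B Q : Type} [Finite A] [Finite B] (δ : List (Trans A B Q)) (q : Q)
    (t : List (Bool × BTest A B Q)) : List (Bool × BTest A (B × Choice δ) Unit) :=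
  (recolorT Prod.fst t).map (specB q)

theorem baseT_iff {A B Q D : Type} [Finite A] [Finite B] (δ : List (Trans A B Q)) (q : Q)
    (t : List (Bool × BTest A B Q)) (τ : DataTree A D) (bl : Pos → B × Choice δ) (x : Pos)
    (d : D) :
    testHolds τ bl x () d (baseT δ q t) ↔ testHolds τ (Prod.fst ∘ bl) x q d t := by
  rw [baseT, testHolds_spec, testHolds_recolorT]

/-- Translated transitions from state `q`. -/
noncomputable def baseStep {A B Q : Type} [Finite A] [Finite B] (δ : List (Trans A B Q)) (q : Q) :
    List (List (Bool × BTest A (B × Choice δ) Unit) × List (BAct (Q ⊕ Mark δ))) :=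
  δ.map fun tr => (baseT δ q tr.1, tr.2.map (mapAct Sum.inl))

/-- Translated accepting transitions from state `q`. -/
noncomputable def baseAcc {A B Q : Type} [Finite A] [Finite B] (δ : List (Trans A B Q)) (q : Q) :
    List (List (Bool × BTest A (B × Choice δ) Unit) × List Unit) :=
  (δ.filter fun tr => tr.2 = [.accept]).map fun tr => (baseT δ q tr.1, [])

theorem baseStep_iff {A B Q D : Type} [Finite A] [Finite B] (δ : List (Trans A B Q)) (q : Q)
    (τ : DataTree A D) (bl : Pos → B × Choice δ) (x y : Pos) (d : D)
    (ρ : Pos → Set ((Q ⊕ Mark δ) × D)) :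
    (∃ tr ∈ baseStep δ q, testHolds τ bl x () d tr.1 ∧ ∀ a ∈ tr.2, actOK τ x y ρ d a) ↔
      ∃ tr ∈ δ, testHolds τ (Prod.fst ∘ bl) x q d tr.1 ∧
        ∀ a ∈ tr.2, actOK τ x y (pull Sum.inl ρ) d a := by
  constructor
  · rintro ⟨tr, htr, h1, h2⟩
    obtain ⟨s, hs, rfl⟩ := List.mem_map.1 htr
    exact ⟨s, hs, (baseT_iff ..).1 h1,
      fun a ha => (actOK_map ..).1 (h2 _ (List.mem_map_of_mem ha))⟩
  · rintro ⟨s, hs, h1, h2⟩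
    refine ⟨_, List.mem_map_of_mem hs, (baseT_iff ..).2 h1, fun a ha => ?_⟩
    obtain ⟨a', ha', rfl⟩ := List.mem_map.1 ha
    exact (actOK_map ..).2 (h2 a' ha')

theorem baseAcc_iff {A B Q D : Type} [Finite A] [Finite B] (δ : List (Trans A B Q)) (q : Q)
    (τ : DataTree A D) (bl : Pos → B × Choice δ) (x : Pos) (d : D) :
    (∃ tr ∈ baseAcc δ q, testHolds τ bl x () d tr.1 ∧ ∀ a ∈ tr.2, (fun _ => True) a) ↔
      ∃ t, (t, [BAct.accept]) ∈ δ ∧ testHolds τ (Prod.fst ∘ bl) x q d t := by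
  constructor
  · rintro ⟨tr, htr, h1, -⟩
    obtain ⟨⟨s1, s2⟩, hs, rfl⟩ := List.mem_map.1 htr
    obtain ⟨hs, h⟩ := List.mem_filter.1 hs
    obtain rfl : s2 = [.accept] := by simpa using h
    exact ⟨s1, hs, (baseT_iff ..).1 h1⟩
  · rintro ⟨s, hs, h1⟩
    refine ⟨_, List.mem_map_of_mem (List.mem_filter.2 ⟨hs, by simp⟩), (baseT_iff ..).2 h1,
      fun _ _ => trivial⟩

/-- The normalized automaton of a BUDTA. -/
noncomputable def normalize {A B Q : Type} [Finite A] [Finite B] [Finite Q] (q0 : Q)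
    (δ : List (Trans A B Q)) : NA A (B × Choice δ) where
  Q := Q ⊕ Mark δ
  Qfin := inferInstance
  leafOK a b := ∃ tr o, b.2 = some (tr, o) ∧ leafTest a b.1 q0 (o = none) False tr.1.1
  leafAcc a b := ∃ β : Prop, ∃ t, (t, [BAct.accept]) ∈ δ ∧ leafTest a b.1 q0 β True t
  stores b := match b.2 with
    | none => []
    | some (tr, none) => (keeps tr.1.2 ++ storesL tr.1.2).map Sum.inl
    | some (tr, some _) => (storesL tr.1.2).map Sum.inl
  guesses b := match b.2 with
    | none => []
    | some (tr, none) => (guessesL tr.1.2).map Sum.inl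
    | some (tr, some c) => Sum.inr (tr, c) :: (guessesL tr.1.2).map Sum.inl
  step := Sum.elim (baseStep δ) fun m =>
    (combos ((keeps m.1.1.2).map (baseStep δ))).map fun tr =>
      ((true, .deq (markExp δ m)) :: tr.1, tr.2)
  acc := Sum.elim (fun q => (baseAcc δ q).map Prod.fst) fun m =>
    (combos ((keeps m.1.1.2).map (baseAcc δ))).map fun tr => (true, .deq (markExp δ m)) :: tr.1

theorem step_mark_iff {A B Q D : Type} [Finite A] [Finite B] [Finite Q] (q0 : Q)
    (δ : List (Trans A B Q)) (m : Mark δ)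
    (τ : DataTree A D) (bl : Pos → B × Choice δ) (x y : Pos) (d : D)
    (ρ : Pos → Set ((Q ⊕ Mark δ) × D)) :
    (∃ tr ∈ (normalize q0 δ).step (Sum.inr m),
        testHolds τ bl x () d tr.1 ∧ ∀ a ∈ tr.2, actOK τ x y ρ d a) ↔
      (¬ ∃ i, x ++ [i] ∈ τ.pos ∧ (bl (x ++ [i])).2 = some (m.1, some m.2) ∧
        τ.data (x ++ [i]) = d) ∧
      ∀ p ∈ keeps m.1.1.2, ∃ tr ∈ δ, testHolds τ (Prod.fst ∘ bl) x p d tr.1 ∧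
        ∀ a ∈ tr.2, actOK τ x y (pull Sum.inl ρ) d a := by
  have key := combos_iff
    (fun nt : Bool × BTest A (B × Choice δ) Unit => (basicHolds τ bl x () d nt.2 ↔ nt.1 = false))
    (fun a => actOK τ x y ρ d a) ((keeps m.1.1.2).map (baseStep δ))
  rw [List.forall_mem_map] at key
  have k2 : ∀ p, (∃ tr ∈ baseStep δ p,
      (∀ nt ∈ tr.1, (basicHolds τ bl x () d nt.2 ↔ nt.1 = false)) ∧
        ∀ a ∈ tr.2, actOK τ x y ρ d a) ↔ _ := fun p => baseStep_iff δ p τ bl x y d ρ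
  simp only [k2] at key
  rw [← key, ← markExp_iff]
  constructor
  · rintro ⟨tr, htr, h1, h2⟩
    obtain ⟨s, hs, rfl⟩ := List.mem_map.1 htr
    rw [testHolds_cons] at h1
    exact ⟨by simpa using h1.1, s, hs, h1.2, h2⟩
  · rintro ⟨h0, s, hs, h1, h2⟩
    exact ⟨_, List.mem_map_of_mem hs, (testHolds_cons ..).2 ⟨by simpa using h0, h1⟩, h2⟩

theorem acc_mark_iff {A B Q D : Type} [Finite A] [Finite B] [Finite Q] (q0 : Q)
    (δ : List (Trans A B Q)) (m : Mark δ)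
    (τ : DataTree A D) (bl : Pos → B × Choice δ) (x : Pos) (d : D) :
    (∃ t ∈ (normalize q0 δ).acc (Sum.inr m), testHolds τ bl x () d t) ↔
      (¬ ∃ i, x ++ [i] ∈ τ.pos ∧ (bl (x ++ [i])).2 = some (m.1, some m.2) ∧
        τ.data (x ++ [i]) = d) ∧
      ∀ p ∈ keeps m.1.1.2, ∃ t, (t, [BAct.accept]) ∈ δ ∧
        testHolds τ (Prod.fst ∘ bl) x p d t := by
  have key := combos_iff
    (fun nt : Bool × BTest A (B × Choice δ) Unit => (basicHolds τ bl x () d nt.2 ↔ nt.1 = false))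
    (fun _ : Unit => True) ((keeps m.1.1.2).map (baseAcc δ))
  rw [List.forall_mem_map] at key
  have k2 : ∀ p, (∃ tr ∈ baseAcc δ p,
      (∀ nt ∈ tr.1, (basicHolds τ bl x () d nt.2 ↔ nt.1 = false)) ∧
        ∀ a ∈ tr.2, (fun _ : Unit => True) a) ↔ _ := fun p => baseAcc_iff δ p τ bl x d
  have k3 : (∀ p ∈ keeps m.1.1.2, ∃ t, (t, [BAct.accept]) ∈ δ ∧
        testHolds τ (Prod.fst ∘ bl) x p d t) ↔ _ :=
    (forall₂_congr fun p _ => (k2 p).symm).trans key.symm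
  rw [k3, ← markExp_iff]
  constructor
  · rintro ⟨t, ht, h1⟩
    obtain ⟨s, hs, rfl⟩ := List.mem_map.1 ht
    rw [testHolds_cons] at h1
    exact ⟨by simpa using h1.1, s, hs, h1.2, fun _ _ => trivial⟩
  · rintro ⟨h0, s, hs, h1, -⟩
    exact ⟨_, List.mem_map_of_mem hs, (testHolds_cons ..).2 ⟨by simpa using h0, h1⟩⟩

theorem acc_inl_iff {A B Q D : Type} [Finite A] [Finite B] [Finite Q] (q0 : Q)
    (δ : List (Trans A B Q)) (q : Q)
    (τ : DataTree A D) (bl : Pos → B × Choice δ) (x : Pos) (d : D) :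
    (∃ t ∈ (normalize q0 δ).acc (Sum.inl q), testHolds τ bl x () d t) ↔
      ∃ t, (t, [BAct.accept]) ∈ δ ∧ testHolds τ (Prod.fst ∘ bl) x q d t := by
  rw [← baseAcc_iff]
  constructor
  · rintro ⟨t, ht, h⟩
    obtain ⟨s, hs, rfl⟩ := List.mem_map.1 ht
    exact ⟨s, hs, h, fun _ _ => trivial⟩
  · rintro ⟨s, hs, h, -⟩
    exact ⟨_, List.mem_map_of_mem hs, h⟩

theorem normalize_forward {A B Q D : Type} [Finite A] [Finite B] [Finite Q] [Infinite D] (q0 : Q)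
    (δ : List (Trans A B Q)) (τ : DataTree A D) (bl : Pos → B) (ρ : Pos → Set (Q × D))
    (hacc : IsAcceptingRun q0 δ τ bl ρ) : ∃ bl', (normalize q0 δ).AccBy τ bl' := by
  obtain ⟨⟨hfin, hleaf, hrun⟩, hroot⟩ := hacc
  choose col v hcv using fun V : D → Prop => exists_colour V
  let V : Pos → {tr // tr ∈ δ} → D → Prop := fun y tr e => ∀ p ∈ keeps tr.1.2, (p, e) ∈ ρ y
  have hch : ∀ x : Pos, ∃ c : Choice δ,
      (IsLeaf τ x → x ∈ τ.pos → ∀ y i, x = y ++ [i] → ∃ tr o, c = some (tr, o) ∧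
        leafTest (τ.label x) (bl x) q0 (o = none) False tr.1.1 ∧
        (o = none → V y tr (τ.data x)) ∧
        (∀ b, o = some b → v (V y tr) b ≠ τ.data x ∧ V y tr (v (V y tr) b)) ∧
        (∀ p ∈ storesL tr.1.2, (p, τ.data x) ∈ ρ y) ∧
        (∀ p ∈ guessesL tr.1.2, ∃ e, (p, e) ∈ ρ y)) ∧
      (¬ (IsLeaf τ x ∧ x ∈ τ.pos) → c = none) := by
    intro x
    by_cases h : (IsLeaf τ x ∧ x ∈ τ.pos)
    · obtain ⟨hl, hx⟩ := h
      rcases List.eq_nil_or_concat x with rfl | ⟨y, i, rfl⟩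
      · refine ⟨none, fun _ _ y i h => ?_, fun _ => rfl⟩
        simp at h
      · simp only [List.concat_eq_append] at *
        obtain ⟨e, he⟩ := hleaf _ hx hl
        obtain ⟨tr, htr, h1, h2⟩ := hrun y i hx (q0, e) (by rw [he]; rfl)
        rw [leaf_acts τ _ _ hx hl] at h2
        rw [testHolds_leaf τ _ _ hx hl] at h1
        have hr : (y ++ [i] = ([] : Pos)) = False := by simp
        rw [hr] at h1
        refine ⟨some (⟨tr, htr⟩, if τ.data (y ++ [i]) = e then none else
          some (col (V y ⟨tr, htr⟩) (τ.data (y ++ [i])))), ?_, fun h => absurd ⟨hl, hx⟩ h⟩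
        intro _ _ y' i' h'
        obtain ⟨rfl, -⟩ := List.append_inj' h' rfl
        refine ⟨_, _, rfl, ?_, ?_, ?_, h2.2⟩
        · have e1 : ((if τ.data (y ++ [i]) = e then none else
            some (col (V y ⟨tr, htr⟩) (τ.data (y ++ [i])))) = none) =
              (τ.data (y ++ [i]) = e) := by
            by_cases hd : τ.data (y ++ [i]) = e <;> simp [hd]
          rw [e1]
          exact h1
        · intro ho
          by_cases hd : τ.data (y ++ [i]) = e
          · rw [hd]; exact h2.1
          · simp [hd] at ho
        · intro b hb
          by_cases hd : τ.data (y ++ [i]) = e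
          · simp [hd] at hb
          · rw [if_neg hd] at hb
            obtain rfl := Option.some.inj hb
            exact hcv (V y ⟨tr, htr⟩) _ e (Ne.symm hd) h2.1
    · exact ⟨none, fun h1 h2 => absurd ⟨h1, h2⟩ h, fun _ => rfl⟩
  choose ch hch1 hch2 using hch
  let bl' : Pos → B × Choice δ := fun x => (bl x, ch x)
  let ρm : Pos → Set (Mark δ × D) := fun y =>
    {md | md.2 = v (V y md.1.1) md.1.2 ∧ V y md.1.1 md.2}
  have hmark : ∀ (x : Pos) (m : Mark δ) d, (m, d) ∈ ρm x →
      ¬ ∃ i, x ++ [i] ∈ τ.pos ∧ (bl' (x ++ [i])).2 = some (m.1, some m.2) ∧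
        τ.data (x ++ [i]) = d := by
    rintro x m d ⟨hd, hV⟩ ⟨i, hi, hm, hd'⟩
    have hm' : ch (x ++ [i]) = some (m.1, some m.2) := hm
    by_cases hl : IsLeaf τ (x ++ [i])
    · obtain ⟨tr, o, h1, -, -, h2, -⟩ := hch1 _ hl hi x i rfl
      rw [hm'] at h1
      obtain ⟨rfl, rfl⟩ := Prod.mk.inj (Option.some.inj h1)
      exact (h2 _ rfl).1 (hd.symm.trans hd'.symm)
    · rw [hch2 _ (fun h => hl h.1)] at hm'
      exact absurd hm' (by simp)
  refine ⟨bl', glue ρ ρm, ?_, ?_, ?_, ?_, ?_⟩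
  · intro x hx
    refine glue_finite _ _ _ (hfin x hx) ?_
    refine (Set.finite_range fun m : Mark δ => (m, v (V x m.1) m.2)).subset ?_
    rintro ⟨m, d⟩ ⟨h, -⟩
    exact ⟨m, Prod.ext rfl h.symm⟩
  · intro y i hx hl
    obtain ⟨tr, o, h1, h2, h3, h4, h5, h6⟩ := hch1 _ hl hx y i rfl
    have e0 : (bl' (y ++ [i])).2 = some (tr, o) := h1
    refine ⟨⟨tr, o, h1, h2⟩, ?_, ?_⟩
    · intro p hp
      simp only [normalize, e0] at hp
      cases o with
      | none =>
        obtain ⟨p', hp', rfl⟩ := List.mem_map.1 hp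
        rcases List.mem_append.1 hp' with hp' | hp'
        · exact h3 rfl p' hp'
        · exact h5 p' hp'
      | some b =>
        obtain ⟨p', hp', rfl⟩ := List.mem_map.1 hp
        exact h5 p' hp'
    · intro p hp
      simp only [normalize, e0] at hp
      cases o with
      | none =>
        obtain ⟨p', hp', rfl⟩ := List.mem_map.1 hp
        exact h6 p' hp'
      | some b =>
        rcases List.mem_cons.1 hp with rfl | hp
        · exact ⟨v (V y tr) b, rfl, (h4 b rfl).2⟩
        · obtain ⟨p', hp', rfl⟩ := List.mem_map.1 hp
          exact h6 p' hp'
  · rintro y i hx hl (q | m) d hq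
    · exact (baseStep_iff ..).2 (hrun y i hx (q, d) hq)
    · exact (step_mark_iff ..).2 ⟨hmark _ m d hq, fun p hp => hrun y i hx (p, d) (hq.2 p hp)⟩
  · intro hl
    obtain ⟨e, he⟩ := hleaf _ τ.root_mem hl
    obtain ⟨t, ht, h1⟩ := hroot (q0, e) (by rw [he]; rfl)
    rw [testHolds_leaf τ _ _ τ.root_mem hl, eq_self_iff_true] at h1
    exact ⟨_, t, ht, h1⟩
  · rintro hl (q | m) d hq
    · exact (acc_inl_iff ..).2 (hroot (q, d) hq)
    · exact (acc_mark_iff ..).2 ⟨hmark _ m d hq, fun p hp => hroot (p, d) (hq.2 p hp)⟩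

theorem normalize_backward {A B Q D : Type} [Finite A] [Finite B] [Finite Q] [Infinite D] (q0 : Q)
    (δ : List (Trans A B Q)) (τ : DataTree A D) (bl' : Pos → B × Choice δ)
    (ρ' : Pos → Set ((Q ⊕ Mark δ) × D)) (r : (normalize q0 δ).Run τ bl' ρ') :
    ∃ ρ, IsAcceptingRun q0 δ τ (Prod.fst ∘ bl') ρ := by
  let ρ₀ : Pos → Set (Q × D) := fun x =>
    {qd | (Sum.inl qd.1, qd.2) ∈ ρ' x ∨
      ∃ m : Mark δ, (Sum.inr m, qd.2) ∈ ρ' x ∧ qd.1 ∈ keeps m.1.1.2}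
  have hmark : ∀ x ∈ τ.pos, ¬ IsLeaf τ x → ∀ (m : Mark δ) d, (Sum.inr m, d) ∈ ρ' x →
      ¬ ∃ i, x ++ [i] ∈ τ.pos ∧ (bl' (x ++ [i])).2 = some (m.1, some m.2) ∧
        τ.data (x ++ [i]) = d := by
    intro x hx hl m d hm
    rcases List.eq_nil_or_concat x with rfl | ⟨y, i, rfl⟩
    · exact ((acc_mark_iff ..).1 (r.rootAcc hl (Sum.inr m) d hm)).1
    · simp only [List.concat_eq_append] at hx hl hm ⊢
      exact ((step_mark_iff ..).1 (r.inner y i hx hl (Sum.inr m) d hm)).1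
  have hex : ∀ x : Pos, ∃ e : D, x ∈ τ.pos → IsLeaf τ x →
      (x = [] → ∃ t, (t, [BAct.accept]) ∈ δ ∧ testHolds τ (Prod.fst ∘ bl') x q0 e t) ∧
      ∀ y i, x = y ++ [i] → ∃ tr ∈ δ, testHolds τ (Prod.fst ∘ bl') x q0 e tr.1 ∧
        ∀ a ∈ tr.2, actOK τ x y ρ₀ e a := by
    intro x
    by_cases h : (x ∈ τ.pos ∧ IsLeaf τ x)
    · obtain ⟨hx, hl⟩ := h
      rcases List.eq_nil_or_concat x with rfl | ⟨y, i, rfl⟩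
      · obtain ⟨β, t, ht, h1⟩ := r.rootLeaf hl
        obtain ⟨e, he⟩ : ∃ e, (τ.data [] = e) = β := by
          by_cases hβ : β
          · exact ⟨τ.data [], by simp [hβ]⟩
          · obtain ⟨e, he⟩ := exists_ne (τ.data [])
            exact ⟨e, by simp [hβ, he.symm]⟩
        refine ⟨e, fun _ _ => ⟨fun _ => ⟨t, ht, ?_⟩, fun y i h => by simp at h⟩⟩
        rw [testHolds_leaf τ _ _ hx hl, eq_self_iff_true, he]
        exact h1
      · simp only [List.concat_eq_append] at *
        have hy := not_isLeaf hx
        have hyp := τ.parent_closed y i hx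
        obtain ⟨⟨tr, o, h0, h1⟩, h2, h3⟩ := r.leaf y i hx hl
        simp only [normalize, h0] at h2 h3
        suffices hs : ∃ e, (τ.data (y ++ [i]) = e) = (o = none) ∧
            ∀ a ∈ tr.1.2, actOK τ (y ++ [i]) y ρ₀ e a by
          obtain ⟨e, he1, he2⟩ := hs
          refine ⟨e, fun _ _ => ⟨fun h => by simp at h, fun y' i' h' => ?_⟩⟩
          obtain ⟨rfl, -⟩ := List.append_inj' h' rfl
          refine ⟨tr.1, tr.2, ?_, he2⟩
          have hr : (y ++ [i] = ([] : Pos)) = False := by simp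
          rw [testHolds_leaf τ _ _ hx hl, hr, he1]
          exact h1
        cases o with
        | none =>
          refine ⟨τ.data (y ++ [i]), by simp, (leaf_acts τ _ _ hx hl ..).2 ⟨?_, ?_, ?_⟩⟩
          · intro p hp
            exact Or.inl (h2 _ (List.mem_map_of_mem (List.mem_append_left _ hp)))
          · intro p hp
            exact Or.inl (h2 _ (List.mem_map_of_mem (List.mem_append_right _ hp)))
          · intro p hp
            obtain ⟨e, he⟩ := h3 _ (List.mem_map_of_mem hp)
            exact ⟨e, Or.inl he⟩
        | some b =>
          obtain ⟨e, he⟩ := h3 _ List.mem_cons_self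
          have hne : τ.data (y ++ [i]) ≠ e := fun h =>
            hmark y hyp hy (tr, b) e he ⟨i, hx, h0, h⟩
          refine ⟨e, by simp [hne], (leaf_acts τ _ _ hx hl ..).2 ⟨?_, ?_, ?_⟩⟩
          · intro p hp
            exact Or.inr ⟨_, he, hp⟩
          · intro p hp
            exact Or.inl (h2 _ (List.mem_map_of_mem hp))
          · intro p hp
            obtain ⟨e, he⟩ := h3 _ (List.mem_cons_of_mem _ (List.mem_map_of_mem hp))
            exact ⟨e, Or.inl he⟩
    · exact ⟨τ.data [], fun h1 h2 => absurd ⟨h1, h2⟩ h⟩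
  choose ex hex using hex
  let ρ : Pos → Set (Q × D) := fun x => if IsLeaf τ x then {(q0, ex x)} else ρ₀ x
  have hl1 : ∀ x, IsLeaf τ x → ρ x = {(q0, ex x)} := fun x hx => if_pos hx
  have hl2 : ∀ x, ¬ IsLeaf τ x → ρ x = ρ₀ x := fun x hx => if_neg hx
  refine ⟨ρ, ⟨?_, fun x _ hl => ⟨_, hl1 x hl⟩, ?_⟩, ?_⟩
  · intro x hx
    by_cases hl : IsLeaf τ x
    · rw [hl1 x hl]; exact Set.finite_singleton _
    · rw [hl2 x hl]
      refine ((Set.finite_univ (α := Q)).prod ((r.fin x hx).image Prod.snd)).subset ?_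
      rintro ⟨q, d⟩ (h | ⟨m, h, -⟩)
      · exact ⟨trivial, _, h, rfl⟩
      · exact ⟨trivial, _, h, rfl⟩
  · rintro y i hx ⟨q, d⟩ hq
    have hy := hl2 y (not_isLeaf hx)
    by_cases hl : IsLeaf τ (y ++ [i])
    · rw [hl1 _ hl] at hq
      obtain ⟨rfl, rfl⟩ := Prod.mk.inj (Set.mem_singleton_iff.1 hq)
      obtain ⟨tr, htr, h1, h2⟩ := (hex _ hx hl).2 y i rfl
      exact ⟨tr, htr, h1, fun a ha => actOK_mono τ _ _ ρ₀ ρ hy.ge _ _ (h2 a ha)⟩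
    · rw [hl2 _ hl] at hq
      have hsub : pull Sum.inl ρ' y ⊆ ρ y := by
        rw [hy]
        exact fun qd h => Or.inl h
      have : ∃ tr ∈ δ, testHolds τ (Prod.fst ∘ bl') (y ++ [i]) q d tr.1 ∧
          ∀ a ∈ tr.2, actOK τ (y ++ [i]) y (pull Sum.inl ρ') d a := by
        rcases hq with hq | ⟨m, hm, hq⟩
        · exact (baseStep_iff ..).1 (r.inner y i hx hl (Sum.inl q) d hq)
        · exact ((step_mark_iff ..).1 (r.inner y i hx hl (Sum.inr m) d hm)).2 q hq
      obtain ⟨tr, htr, h1, h2⟩ := this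
      exact ⟨tr, htr, h1, fun a ha => actOK_mono τ _ _ _ ρ hsub _ _ (h2 a ha)⟩
  · rintro ⟨q, d⟩ hq
    by_cases hl : IsLeaf τ []
    · rw [hl1 _ hl] at hq
      obtain ⟨rfl, rfl⟩ := Prod.mk.inj (Set.mem_singleton_iff.1 hq)
      exact (hex _ τ.root_mem hl).1 rfl
    · rw [hl2 _ hl] at hq
      rcases hq with hq | ⟨m, hm, hq⟩
      · exact (acc_inl_iff ..).1 (r.rootAcc hl (Sum.inl q) d hq)
      · exact ((acc_mark_iff ..).1 (r.rootAcc hl (Sum.inr m) d hm)).2 q hq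

end Normalize

/-- Internal labels of the normalized automaton of `M`. -/
abbrev NB {A : Type} (M : BUDTA A) : Type := M.B × Choice M.δ

instance NB_finite {A : Type} (M : BUDTA A) : Finite (NB M) := by
  have := M.Bfin
  infer_instance

/-- The normalized automaton of `M`. -/
noncomputable def norm {A : Type} [Finite A] (M : BUDTA A) : NA A (NB M) :=
  haveI := M.Bfin
  haveI := M.Qfin
  normalize M.q0 M.δ

theorem norm_accepts {A D : Type} [Finite A] [Infinite D] (M : BUDTA A) (τ : DataTree A D) :
    Accepts M τ ↔ ∃ bl, (norm M).AccBy τ bl := by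
  have := M.Bfin
  have := M.Qfin
  constructor
  · rintro ⟨bl, ρ, h⟩
    exact normalize_forward M.q0 M.δ τ bl ρ h
  · rintro ⟨bl, ρ, h⟩
    obtain ⟨ρ', h'⟩ := normalize_backward M.q0 M.δ τ bl ρ h
    exact ⟨_, ρ', h'⟩

/-- Intersection. -/
noncomputable def interM {A : Type} [Finite A] (M₁ M₂ : BUDTA A) : BUDTA A :=
  (((norm M₁).recolor (Prod.fst : NB M₁ × NB M₂ → NB M₁)).inter
    ((norm M₂).recolor (Prod.snd : NB M₁ × NB M₂ → NB M₂))).toBUDTA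

theorem interM_accepts {A D : Type} [Finite A] [Infinite D] (M₁ M₂ : BUDTA A)
    (τ : DataTree A D) : Accepts (interM M₁ M₂) τ ↔ Accepts M₁ τ ∧ Accepts M₂ τ := by
  rw [interM, NA.toBUDTA_accepts, norm_accepts M₁, norm_accepts M₂]
  simp only [NA.inter_accBy, NA.recolor_accBy]
  constructor
  · rintro ⟨bl, h1, h2⟩
    exact ⟨⟨_, h1⟩, ⟨_, h2⟩⟩
  · rintro ⟨⟨b1, h1⟩, ⟨b2, h2⟩⟩
    exact ⟨fun x => (b1 x, b2 x), h1, h2⟩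

/-- Union, for automata with nonempty internal alphabets. -/
noncomputable def uniM {A : Type} [Finite A] (M₁ M₂ : BUDTA A) : BUDTA A :=
  ((constNA A (fun b : (NB M₁ × NB M₂) × Bool => b.2)).inter
    ((((norm M₁).recolor (fun b : (NB M₁ × NB M₂) × Bool => b.1.1)).orSide
        fun b => b.2 = true).inter
      (((norm M₂).recolor (fun b : (NB M₁ × NB M₂) × Bool => b.1.2)).orSide
        fun b => b.2 = false))).toBUDTA

theorem uniM_accepts {A D : Type} [Finite A] [Infinite D] (M₁ M₂ : BUDTA A)
    (hB₁ : Nonempty M₁.B) (hB₂ : Nonempty M₂.B)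
    (τ : DataTree A D) : Accepts (uniM M₁ M₂) τ ↔ Accepts M₁ τ ∨ Accepts M₂ τ := by
  rw [uniM, NA.toBUDTA_accepts, norm_accepts M₁, norm_accepts M₂]
  simp only [NA.inter_accBy, constNA_accBy]
  constructor
  · rintro ⟨bl, ⟨s, hs⟩, h1, h2⟩
    cases s with
    | false =>
      rw [NA.orSide_off _ _ _ _ (fun x hx => by simp [hs x hx]), NA.recolor_accBy] at h1
      exact Or.inl ⟨_, h1⟩
    | true =>
      rw [NA.orSide_off _ _ _ _ (fun x hx => by simp [hs x hx]), NA.recolor_accBy] at h2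
      exact Or.inr ⟨_, h2⟩
  · obtain ⟨c1⟩ := hB₁
    obtain ⟨c2⟩ := hB₂
    rintro (⟨b, h⟩ | ⟨b, h⟩)
    · refine ⟨fun x => ((b x, (c2, none)), false), ⟨false, fun _ _ => rfl⟩, ?_,
        NA.orSide_on _ _ _ _ (fun _ _ => rfl)⟩
      rw [NA.orSide_off _ _ _ _ (fun x hx => by simp), NA.recolor_accBy]
      exact h
    · refine ⟨fun x => (((c1, none), b x), true), ⟨true, fun _ _ => rfl⟩,
        NA.orSide_on _ _ _ _ (fun _ _ => rfl), ?_⟩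
      rw [NA.orSide_off _ _ _ _ (fun x hx => by simp), NA.recolor_accBy]
      exact h

theorem not_accepts_of_empty {A D : Type} (M : BUDTA A) (h : ¬ Nonempty M.B)
    (τ : DataTree A D) : ¬ Accepts M τ := fun ⟨bl, _⟩ => h ⟨bl []⟩

/-- Union. -/
noncomputable def unionM {A : Type} [Finite A] (M₁ M₂ : BUDTA A) : BUDTA A :=
  if Nonempty M₁.B then (if Nonempty M₂.B then uniM M₁ M₂ else M₁) else M₂

theorem unionM_accepts {A D : Type} [Finite A] [Infinite D] (M₁ M₂ : BUDTA A)
    (τ : DataTree A D) : Accepts (unionM M₁ M₂) τ ↔ Accepts M₁ τ ∨ Accepts M₂ τ := by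
  unfold unionM
  split_ifs with h1 h2
  · exact uniM_accepts M₁ M₂ h1 h2 τ
  · simp [not_accepts_of_empty M₂ h2 τ]
  · simp [not_accepts_of_empty M₁ h1 τ]

end Helpers

/-- **BUDTA are effectively closed under intersection and union**: for every
finite alphabet `A` (and infinite data domain `D`) there are functions that,
given two BUDTA over `A`, compute a BUDTA for the intersection, respectively
the union, of their languages of data trees over `A` and `D`. -/
theorem budta_closed_under_intersection_and_union (A D : Type) [Fintype A] [Infinite D] :
    ∃ inter : BUDTA A → BUDTA A → BUDTA A,
      ∃ uni : BUDTA A → BUDTA A → BUDTA A,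
        ∀ (M₁ M₂ : BUDTA A) (τ : DataTree A D),
          (Accepts (inter M₁ M₂) τ ↔ Accepts M₁ τ ∧ Accepts M₂ τ) ∧
          (Accepts (uni M₁ M₂) τ ↔ Accepts M₁ τ ∨ Accepts M₂ τ) :=
  ⟨interM, unionM, fun M₁ M₂ τ => ⟨interM_accepts M₁ M₂ τ, unionM_accepts M₁ M₂ τ⟩⟩

end BUDA
end

section
/- The containment problem for BUDTA is undecidable: there is no algorithm that, given two BUDTA A₁ and A₂ over the same finite alphabet 𝔸, decides whether every data tree over 𝔸 and 𝔻 accepted by A₁ is also accepted by A₂ (equivalently, whether the intersection of the language of A₁ with the complement of the language of A₂ is empty). -/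
namespace CodedBUDA

/-- Positions in an unranked tree: finite sequences of natural numbers. -/
abbrev Pos : Type := List ℕ

/-- A data tree over a label alphabet `A` and data domain `D`. -/
structure DataTree (A D : Type) where
  pos : Finset Pos
  label : Pos → A
  data : Pos → D
  root_mem : ([] : Pos) ∈ pos
  parent_closed : ∀ (x : Pos) (i : ℕ), x ++ [i] ∈ pos → x ∈ pos
  sibling_closed : ∀ (x : Pos) (i : ℕ), x ++ [i + 1] ∈ pos → x ++ [i] ∈ pos

def IsLeaf {A D : Type} (τ : DataTree A D) (x : Pos) : Prop :=
  ∀ i : ℕ, x ++ [i] ∉ τ.pos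

def IsDownPath {A D : Type} (τ : DataTree A D) (x : Pos) (p : List Pos) : Prop :=
  p ≠ [] ∧ p.head? = some x ∧ (∀ y ∈ p, y ∈ τ.pos) ∧
    List.Chain' (fun y z => ∃ i : ℕ, z = y ++ [i]) p

def subtreeData {A D : Type} (τ : DataTree A D) (x : Pos) : Set D :=
  {d | ∃ y ∈ τ.pos, x <+: y ∧ τ.data y = d}

/-- Decoding of natural numbers into regular expressions over `ℕ × ℕ`
(pairs of a letter of the alphabet and a letter of the internal alphabet),
with an explicit fuel argument.  Every regular expression is the decoding of
some number, so numbers faithfully represent regular expressions. -/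
def decodeREAux : ℕ → ℕ → RegularExpression (ℕ × ℕ)
  | 0, _ => 0
  | fuel + 1, n =>
    match n % 6, n / 6 with
    | 0, _ => 0
    | 1, _ => 1
    | 2, r => RegularExpression.char r.unpair
    | 3, r => RegularExpression.plus (decodeREAux fuel r.unpair.1) (decodeREAux fuel r.unpair.2)
    | 4, r => RegularExpression.comp (decodeREAux fuel r.unpair.1) (decodeREAux fuel r.unpair.2)
    | _, r => RegularExpression.star (decodeREAux fuel r)

def decodeRE (n : ℕ) : RegularExpression (ℕ × ℕ) :=
  decodeREAux n.unpair.1 n.unpair.2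

/-- A coded basic test: a tag together with a payload.
Tags: 0 = state test, 1 = `eq`, 2 = `⟨e⟩^=` (payload codes the regular
expression `e`), 3 = `⟨e⟩^≠`, 4 = `root`, 5 = `leaf`, 6 = label test `a`,
7 = internal-label test `b`. -/
abbrev CTest : Type := ℕ × ℕ

/-- A coded basic action: a tag together with a state.
Tags: 0 = `accept`, 1 = `keep`, 2 = `store`, 3 = `guess`, 4 = `univ`. -/
abbrev CAct : Type := ℕ × ℕ

/-- A coded transition: a conjunction of possibly negated basic tests (`true`
marks negation) together with a conjunction of basic actions. -/
abbrev CTrans : Type := List (Bool × CTest) × List CAct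

/-- A coded BUDTA `(alphSize, bSize, qSize, q₀, δ)`: the alphabet is
`{0, …, alphSize−1}`, the internal alphabet `{0, …, bSize−1}`, the states
`{0, …, qSize−1}`, with initial state `q₀` and transitions `δ`. -/
abbrev CBUDTA : Type := ℕ × ℕ × ℕ × ℕ × List CTrans

def alphSize (M : CBUDTA) : ℕ := M.1
def bSize (M : CBUDTA) : ℕ := M.2.1
def qSize (M : CBUDTA) : ℕ := M.2.2.1
def initState (M : CBUDTA) : ℕ := M.2.2.2.1
def trans (M : CBUDTA) : List CTrans := M.2.2.2.2

/-- Well-formedness of a coded BUDTA: the initial state and all states, labels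
and internal labels mentioned in the transitions lie within the declared
bounds, and all tags are meaningful. -/
def WF (M : CBUDTA) : Prop :=
  initState M < qSize M ∧
  ∀ tr ∈ trans M,
    (∀ nt ∈ tr.1, nt.2.1 ≤ 7 ∧
      (nt.2.1 = 0 → nt.2.2 < qSize M) ∧
      (nt.2.1 = 6 → nt.2.2 < alphSize M) ∧
      (nt.2.1 = 7 → nt.2.2 < bSize M)) ∧
    (∀ a ∈ tr.2, a.1 ≤ 4 ∧ (a.1 = 0 → a.2 = 0) ∧ (1 ≤ a.1 → a.2 < qSize M))

/-- A data tree over the coded alphabet `{0, …, n−1}`. -/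
def TreeWF {D : Type} (n : ℕ) (τ : DataTree ℕ D) : Prop :=
  ∀ x ∈ τ.pos, τ.label x < n

/-- Satisfaction of a coded basic test by the thread `(q, d)` at position `x`. -/
def cBasicHolds {D : Type} (τ : DataTree ℕ D) (bl : Pos → ℕ) (x : Pos)
    (q : ℕ) (d : D) (t : CTest) : Prop :=
  match t.1 with
  | 0 => q = t.2
  | 1 => τ.data x = d
  | 2 => ∃ p y, IsDownPath τ x p ∧ p.getLast? = some y ∧
      (p.map fun z => (τ.label z, bl z)) ∈ (decodeRE t.2).matches' ∧ τ.data y = d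
  | 3 => ∃ p y, IsDownPath τ x p ∧ p.getLast? = some y ∧
      (p.map fun z => (τ.label z, bl z)) ∈ (decodeRE t.2).matches' ∧ τ.data y ≠ d
  | 4 => x = ([] : Pos)
  | 5 => IsLeaf τ x
  | 6 => τ.label x = t.2
  | _ => bl x = t.2

def cTestHolds {D : Type} (τ : DataTree ℕ D) (bl : Pos → ℕ) (x : Pos)
    (q : ℕ) (d : D) (t : List (Bool × CTest)) : Prop :=
  ∀ nt ∈ t, (cBasicHolds τ bl x q d nt.2 ↔ nt.1 = false)

/-- The constraint imposed on the parent configuration by a coded basic action. -/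
def cActOK {D : Type} (τ : DataTree ℕ D) (x y : Pos)
    (ρ : Pos → Set (ℕ × D)) (d : D) (a : CAct) : Prop :=
  match a.1 with
  | 0 => True
  | 1 => (a.2, d) ∈ ρ y
  | 2 => (a.2, τ.data x) ∈ ρ y
  | 3 => ∃ e : D, (a.2, e) ∈ ρ y
  | _ => ∀ e ∈ subtreeData τ x, (a.2, e) ∈ ρ y

def cIsRun {D : Type} (M : CBUDTA) (τ : DataTree ℕ D) (bl : Pos → ℕ)
    (ρ : Pos → Set (ℕ × D)) : Prop :=
  (∀ x ∈ τ.pos, (ρ x).Finite) ∧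
  (∀ x ∈ τ.pos, ∀ qd ∈ ρ x, qd.1 < qSize M) ∧
  (∀ x ∈ τ.pos, IsLeaf τ x → ∃ e : D, ρ x = {(initState M, e)}) ∧
  (∀ (y : Pos) (i : ℕ), y ++ [i] ∈ τ.pos → ∀ qd ∈ ρ (y ++ [i]),
    ∃ tr ∈ trans M, cTestHolds τ bl (y ++ [i]) qd.1 qd.2 tr.1 ∧
      ∀ a ∈ tr.2, cActOK τ (y ++ [i]) y ρ qd.2 a)

def cIsAcceptingRun {D : Type} (M : CBUDTA) (τ : DataTree ℕ D) (bl : Pos → ℕ)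
    (ρ : Pos → Set (ℕ × D)) : Prop :=
  cIsRun M τ bl ρ ∧
  ∀ qd ∈ ρ ([] : Pos), ∃ t, (t, [((0 : ℕ), (0 : ℕ))]) ∈ trans M ∧
    cTestHolds τ bl [] qd.1 qd.2 t

/-- The coded BUDTA `M` accepts `τ`: for some internal labeling within the
internal alphabet there is an accepting run. -/
def CAccepts {D : Type} (M : CBUDTA) (τ : DataTree ℕ D) : Prop :=
  ∃ bl : Pos → ℕ, (∀ x ∈ τ.pos, bl x < bSize M) ∧
    ∃ ρ : Pos → Set (ℕ × D), cIsAcceptingRun M τ bl ρ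

/-! ### Regular expressions denote regular languages -/

/-- A set of words seen as a language. -/
def langOf {α : Type} (s : Set (List α)) : Language α := s

theorem lq_mul_finite {α : Type} {L M : Language α}
    (hL : (Set.range L.leftQuotient).Finite) (hM : (Set.range M.leftQuotient).Finite) :
    (Set.range (L * M).leftQuotient).Finite := by
  have hfin : ((Set.range L.leftQuotient) ×ˢ (𝒫 (Set.range M.leftQuotient))).Finite :=
    hL.prod hM.finite_subsets
  refine (hfin.image (fun p : Language α × Set (Language α) =>
    p.1 * M + langOf {y | ∃ K ∈ p.2, y ∈ K})).subset ?_
  rintro _ ⟨x, rfl⟩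
  refine ⟨(L.leftQuotient x, {K | ∃ u v, u ∈ L ∧ x = u ++ v ∧ K = M.leftQuotient v}),
    ⟨⟨x, rfl⟩, ?_⟩, ?_⟩
  · rintro _ ⟨u, v, _, _, rfl⟩
    exact ⟨v, rfl⟩
  · ext y
    rw [Language.mem_add, Language.mem_leftQuotient, Language.mem_mul, Language.mem_mul]
    constructor
    · rintro (⟨a, ha, b, hb, rfl⟩ | ⟨K, ⟨u, v, hu, rfl, rfl⟩, hy⟩)
      · exact ⟨x ++ a, ha, b, hb, by simp⟩
      · exact ⟨u, hu, v ++ y, hy, by simp⟩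
    · rintro ⟨a, ha, b, hb, hab⟩
      rcases List.append_eq_append_iff.1 hab with ⟨c, rfl, rfl⟩ | ⟨c, rfl, rfl⟩
      · exact Or.inr ⟨_, ⟨a, c, ha, rfl, rfl⟩, hb⟩
      · exact Or.inl ⟨c, ha, b, hb, rfl⟩

theorem mem_kstar_append {α : Type} {L : Language α} (x y : List α) (hx : x ≠ []) :
    x ++ y ∈ KStar.kstar L ↔ ∃ u v a b, x = u ++ v ∧ u ∈ KStar.kstar L ∧ v ++ a ∈ L ∧
      b ∈ KStar.kstar L ∧ y = a ++ b := by
  constructor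
  · rintro ⟨S, hS, h⟩
    induction S generalizing x with
    | nil => simp at hS; exact absurd hS.1 hx
    | cons s S ih =>
      rw [List.flatten_cons] at hS
      rcases List.append_eq_append_iff.1 hS with ⟨c, rfl, rfl⟩ | ⟨c, rfl, hc⟩
      · exact ⟨[], x, c, S.flatten, rfl, Language.nil_mem_kstar _, h _ (by simp),
          ⟨S, rfl, fun z hz => h z (by simp [hz])⟩, rfl⟩
      · by_cases hc0 : c = []
        · subst hc0
          exact ⟨[], s, [], S.flatten, by simp, Language.nil_mem_kstar _,
            by simpa using h s (by simp),
            ⟨S, rfl, fun z hz => h z (by simp [hz])⟩, by simpa using hc.symm⟩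
        · obtain ⟨u, v, a, b, rfl, hu, hv, hb, rfl⟩ :=
            ih c hc0 hc.symm (fun z hz => h z (by simp [hz]))
          obtain ⟨T, rfl, hT⟩ := hu
          refine ⟨s ++ T.flatten, v, a, b, by simp, ⟨s :: T, by simp, ?_⟩, hv, hb, rfl⟩
          intro z hz
          rcases List.mem_cons.1 hz with rfl | hz
          · exact h _ (by simp)
          · exact hT z hz
  · rintro ⟨u, v, a, b, rfl, ⟨S, rfl, hS⟩, hv, ⟨T, rfl, hT⟩, rfl⟩
    refine ⟨S ++ (v ++ a) :: T, by simp, ?_⟩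
    intro z hz
    simp only [List.mem_append, List.mem_cons] at hz
    rcases hz with hz | rfl | hz
    · exact hS z hz
    · exact hv
    · exact hT z hz

theorem lq_star_finite {α : Type} {L : Language α}
    (hL : (Set.range L.leftQuotient).Finite) :
    (Set.range (KStar.kstar L : Language α).leftQuotient).Finite := by
  refine ((hL.finite_subsets.image (fun p : Set (Language α) =>
    langOf {y | ∃ K ∈ p, y ∈ K} * KStar.kstar L)).insert
      (KStar.kstar L)).subset ?_
  rintro _ ⟨x, rfl⟩
  by_cases hx : x = []
  · subst hx; exact Or.inl rfl
  refine Or.inr ⟨{K | ∃ u v, u ∈ KStar.kstar L ∧ x = u ++ v ∧ K = L.leftQuotient v}, ?_, ?_⟩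
  · rintro _ ⟨u, v, _, _, rfl⟩
    exact ⟨v, rfl⟩
  · ext y
    rw [Language.mem_leftQuotient, mem_kstar_append x y hx, Language.mem_mul]
    constructor
    · rintro ⟨a, ⟨K, ⟨u, v, hu, rfl, rfl⟩, ha⟩, b, hb, rfl⟩
      exact ⟨u, v, a, b, rfl, hu, ha, hb, rfl⟩
    · rintro ⟨u, v, a, b, rfl, hu, hv, hb, rfl⟩
      exact ⟨a, ⟨_, ⟨u, v, hu, rfl, rfl⟩, hv⟩, b, hb, rfl⟩

theorem re_lq_finite {α : Type} (P : RegularExpression α) :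
    (Set.range P.matches'.leftQuotient).Finite := by
  induction P with
  | zero =>
    refine (Set.finite_singleton (0 : Language α)).subset ?_
    rintro _ ⟨x, rfl⟩
    ext y
    exact Iff.rfl
  | epsilon =>
    refine (Set.toFinite {(0 : Language α), 1}).subset ?_
    rintro _ ⟨x, rfl⟩
    by_cases hx : x = []
    · subst hx; exact Or.inr rfl
    · left
      ext y
      change x ++ y ∈ (1 : Language α) ↔ y ∈ (0 : Language α)
      simp [Language.mem_one, hx, Language.notMem_zero]
  | char a =>
    refine (Set.toFinite {(0 : Language α), 1, langOf {[a]}}).subset ?_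
    rintro _ ⟨x, rfl⟩
    change _ = _ ∨ _ = _ ∨ _ = _
    rcases x with _ | ⟨b, _ | ⟨c, t⟩⟩
    · exact Or.inr (Or.inr rfl)
    · by_cases hb : b = a
      · subst hb
        right; left
        ext y
        change [b] ++ y = [b] ↔ y ∈ (1 : Language α)
        simp [Language.mem_one]
      · left
        ext y
        change [b] ++ y = [a] ↔ y ∈ (0 : Language α)
        simp [hb, Language.notMem_zero]
    · left
      ext y
      change (b :: c :: t) ++ y = [a] ↔ y ∈ (0 : Language α)
      simp [Language.notMem_zero]
  | plus P Q ihP ihQ =>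
    exact (Language.IsRegular.add (.of_finite_range_leftQuotient ihP)
      (.of_finite_range_leftQuotient ihQ)).finite_range_leftQuotient
  | comp P Q ihP ihQ => exact lq_mul_finite ihP ihQ
  | star P ih => exact lq_star_finite ih

/-! ### Counter programs as regular expressions -/

/-- Elementary instructions of multi-counter programs. -/
inductive Letter : Type
  | inc (c : ℕ)
  | dec (c : ℕ)
  | zer (c : ℕ)
  | mov (c d : ℕ)
  | clr (c : ℕ)

/-- All counters mentioned by a letter are below `B`. -/
def Letter.Below (B : ℕ) : Letter → Prop
  | .inc c => c < B
  | .dec c => c < B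
  | .zer c => c < B
  | .mov c d => c < B ∧ d < B
  | .clr c => c < B

abbrev Val : Type := ℕ → ℕ

/-- One-step semantics of letters. -/
def Step : Letter → Val → Val → Prop
  | .inc c, v, v' => v' = Function.update v c (v c + 1)
  | .dec c, v, v' => 0 < v c ∧ v' = Function.update v c (v c - 1)
  | .zer c, v, v' => v c = 0 ∧ v' = v
  | .mov c d, v, v' => v' = Function.update v d (v c)
  | .clr c, v, v' => v' = Function.update v c 0

def Exec : List Letter → Val → Val → Prop
  | [], v, v' => v' = v
  | a :: w, v, v' => ∃ u, Step a v u ∧ Exec w u v'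

theorem exec_append (w₁ w₂ : List Letter) (v v' : Val) :
    Exec (w₁ ++ w₂) v v' ↔ ∃ u, Exec w₁ v u ∧ Exec w₂ u v' := by
  induction w₁ generalizing v with
  | nil => simp [Exec]
  | cons a w ih =>
    simp only [List.cons_append, Exec, ih]
    constructor
    · rintro ⟨u, h1, t, h2, h3⟩
      exact ⟨t, ⟨u, h1, h2⟩, h3⟩
    · rintro ⟨t, ⟨u, h1, h2⟩, h3⟩
      exact ⟨u, h1, t, h2, h3⟩

abbrev Prg : Type := RegularExpression Letter

def Run (P : Prg) (v v' : Val) : Prop := ∃ w ∈ P.matches', Exec w v v'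

theorem run_char (a : Letter) (v v' : Val) : Run (.char a) v v' ↔ Step a v v' := by
  constructor
  · rintro ⟨w, hw, h⟩
    have : w = [a] := hw
    subst this
    obtain ⟨u, h1, h2⟩ := h
    have : v' = u := h2
    subst this
    exact h1
  · intro h
    exact ⟨[a], rfl, v', h, rfl⟩

theorem run_mul (P Q : Prg) (v v' : Val) :
    Run (P * Q) v v' ↔ ∃ u, Run P v u ∧ Run Q u v' := by
  constructor
  · rintro ⟨w, hw, h⟩
    rw [RegularExpression.matches'_mul, Language.mem_mul] at hw
    obtain ⟨a, ha, b, hb, rfl⟩ := hw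
    obtain ⟨u, h1, h2⟩ := (exec_append _ _ _ _).1 h
    exact ⟨u, ⟨a, ha, h1⟩, ⟨b, hb, h2⟩⟩
  · rintro ⟨u, ⟨a, ha, h1⟩, ⟨b, hb, h2⟩⟩
    exact ⟨a ++ b, Language.append_mem_mul ha hb, (exec_append _ _ _ _).2 ⟨u, h1, h2⟩⟩

theorem run_star (P : Prg) (v v' : Val) :
    Run (.star P) v v' ↔ Relation.ReflTransGen (Run P) v v' := by
  constructor
  · rintro ⟨w, ⟨S, rfl, hS⟩, h⟩
    induction S generalizing v with
    | nil =>
      have : v' = v := h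
      subst this
      exact .refl
    | cons s S ih =>
      rw [List.flatten_cons] at h
      obtain ⟨u, h1, h2⟩ := (exec_append _ _ _ _).1 h
      exact .head ⟨s, hS s (by simp), h1⟩ (ih u (fun y hy => hS y (by simp [hy])) h2)
  · intro h
    induction h with
    | refl => exact ⟨[], Language.nil_mem_kstar _, rfl⟩
    | tail _ h2 ih =>
      obtain ⟨w, ⟨S, rfl, hS⟩, h⟩ := ih
      obtain ⟨x, hx, hx'⟩ := h2
      refine ⟨S.flatten ++ x, ⟨S ++ [x], by simp, ?_⟩, (exec_append _ _ _ _).2 ⟨_, h, hx'⟩⟩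
      intro y hy
      rcases List.mem_append.1 hy with hy | hy
      · exact hS y hy
      · rw [List.mem_singleton.1 hy]; exact hx

/-- `f` is implementable by counter programs. -/
def Impl {n : ℕ} (f : List.Vector ℕ n →. ℕ) : Prop :=
  ∀ (args : List.Vector ℕ n) (out base : ℕ), (∀ i, args.get i < base) → out < base →
    ∃ P : Prg,
      (∀ v v', Run P v v' → v' out ∈ f (args.map v) ∧ ∀ r, r < base → r ≠ out → v' r = v r) ∧
      (∀ v, (f (args.map v)).Dom → ∃ v', Run P v v')

theorem map_congr_below {n : ℕ} (args : List.Vector ℕ n) (base : ℕ) (h : ∀ i, args.get i < base)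
    (v v' : Val) (hv : ∀ r, r < base → v' r = v r) : args.map v' = args.map v := by
  ext i
  rw [List.Vector.get_map, List.Vector.get_map, hv _ (h i)]

theorem mem_mOfFn {n : ℕ} (h : Fin n → Part ℕ) (w : List.Vector ℕ n) :
    w ∈ List.Vector.mOfFn h ↔ ∀ i, w.get i ∈ h i := by
  induction n with
  | zero =>
    constructor
    · intro _ i
      exact i.elim0
    · intro _
      have : w = List.Vector.nil := Subsingleton.elim _ _
      subst this
      exact Part.mem_some _
  | succ n ih =>
    simp only [List.Vector.mOfFn, Part.bind_eq_bind, Part.mem_bind_iff, Part.pure_eq_some,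
      Part.mem_some_iff, ih]
    constructor
    · rintro ⟨a, ha, b, hb, rfl⟩ i
      refine Fin.cases ?_ (fun j => ?_) i
      · simpa using ha
      · simpa using hb j
    · intro hw
      refine ⟨w.head, by simpa using hw 0, w.tail, fun i => ?_, by simp⟩
      simpa using hw i.succ

theorem impl_zero : Impl (n := 0) (fun _ => Part.some 0) := by
  intro args out base _ _
  refine ⟨.char (.clr out), ?_, ?_⟩
  · intro v v' h
    rw [run_char] at h
    have h : v' = _ := h
    subst h
    exact ⟨by simp, fun r _ hr => by simp [hr]⟩
  · intro v _
    exact ⟨_, (run_char _ _ _).2 rfl⟩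

theorem impl_get {n : ℕ} (i : Fin n) : Impl (n := n) (fun v => Part.some (v.get i)) := by
  intro args out base _ _
  refine ⟨.char (.mov (args.get i) out), ?_, ?_⟩
  · intro v v' h
    rw [run_char] at h
    have h : v' = _ := h
    subst h
    exact ⟨by simp, fun r _ hr => by simp [hr]⟩
  · intro v _
    exact ⟨_, (run_char _ _ _).2 rfl⟩

theorem impl_succ : Impl (n := 1) (fun v => Part.some (Nat.succ v.head)) := by
  intro args out base _ _
  refine ⟨.char (.mov (args.get 0) out) * .char (.inc out), ?_, ?_⟩
  · intro v v' h
    simp only [run_mul, run_char] at h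
    obtain ⟨u, h1, h2⟩ := h
    have h1 : u = _ := h1
    have h2 : v' = _ := h2
    subst h1
    subst h2
    refine ⟨?_, fun r _ hr => by simp [hr]⟩
    simp [← List.Vector.get_zero]
  · intro v _
    simp only [run_mul, run_char]
    exact ⟨_, _, rfl, rfl⟩

theorem impl_list {m n : ℕ} (g : Fin n → List.Vector ℕ m →. ℕ) (hg : ∀ i, Impl (g i))
    (args : List.Vector ℕ m) (base : ℕ) (hargs : ∀ i, args.get i < base) :
    ∃ P : Prg,
      (∀ v v', Run P v v' → (∀ i : Fin n, v' (base + i) ∈ g i (args.map v)) ∧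
        ∀ r, r < base → v' r = v r) ∧
      (∀ v, (∀ i, (g i (args.map v)).Dom) → ∃ v', Run P v v') := by
  induction n with
  | zero =>
    refine ⟨1, ?_, ?_⟩
    · rintro v v' ⟨w, hw, h⟩
      have : w = [] := hw
      subst this
      have h : v' = v := h
      subst h
      exact ⟨fun i => i.elim0, fun _ _ => rfl⟩
    · intro v _
      exact ⟨v, [], rfl, rfl⟩
  | succ k ih =>
    obtain ⟨P, hP1, hP2⟩ := ih (fun i => g i.castSucc) (fun i => hg _)
    obtain ⟨Q, hQ1, hQ2⟩ := hg (Fin.last k) args (base + k) (base + k + 1)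
      (fun i => by have := hargs i; omega) (by omega)
    refine ⟨P * Q, ?_, ?_⟩
    · intro v v' h
      obtain ⟨u, h1, h2⟩ := (run_mul _ _ _ _).1 h
      obtain ⟨a1, a2⟩ := hP1 _ _ h1
      obtain ⟨b1, b2⟩ := hQ1 _ _ h2
      rw [map_congr_below args base hargs v u a2] at b1
      refine ⟨fun i => ?_, fun r hr => ?_⟩
      · refine Fin.lastCases ?_ (fun j => ?_) i
        · simpa using b1
        · have := a1 j
          rw [← b2 _ (by omega) (by omega)] at this
          simpa using this
      · rw [b2 r (by omega) (by omega), a2 r hr]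
    · intro v hd
      obtain ⟨u, hu⟩ := hP2 v (fun i => hd _)
      have := hP1 _ _ hu
      obtain ⟨v', hv'⟩ := hQ2 u (by
        rw [map_congr_below args base hargs v u this.2]; exact hd _)
      exact ⟨v', (run_mul _ _ _ _).2 ⟨u, hu, hv'⟩⟩

theorem impl_comp {m n : ℕ} {f : List.Vector ℕ n →. ℕ} (g : Fin n → List.Vector ℕ m →. ℕ)
    (hf : Impl f) (hg : ∀ i, Impl (g i)) :
    Impl (fun v => (List.Vector.mOfFn fun i => g i v) >>= f) := by
  intro args out base hargs hout
  obtain ⟨P, hP1, hP2⟩ := impl_list g hg args base hargs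
  obtain ⟨Q, hQ1, hQ2⟩ := hf (List.Vector.ofFn fun i => base + i) out (base + n)
    (fun i => by simp) (by omega)
  have key : ∀ v u, Run P v u → (List.Vector.ofFn fun i : Fin n => base + (i : ℕ)).map u ∈
      List.Vector.mOfFn fun i => g i (args.map v) := by
    intro v u h
    rw [mem_mOfFn]
    intro i
    simpa using (hP1 v u h).1 i
  refine ⟨P * Q, ?_, ?_⟩
  · intro v v' h
    obtain ⟨u, h1, h2⟩ := (run_mul _ _ _ _).1 h
    obtain ⟨b1, b2⟩ := hQ1 _ _ h2
    refine ⟨?_, fun r hr hr' => ?_⟩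
    · exact Part.mem_bind_iff.2 ⟨_, key v u h1, b1⟩
    · rw [b2 r (by omega) hr', (hP1 v u h1).2 r hr]
  · intro v hd
    obtain ⟨y, hy⟩ := Part.dom_iff_mem.1 hd
    obtain ⟨w, hw, hyw⟩ := Part.mem_bind_iff.1 hy
    obtain ⟨u, hu⟩ := hP2 v (fun i => Part.dom_iff_mem.2 ⟨_, (mem_mOfFn _ _).1 hw i⟩)
    have := Part.mem_unique (key v u hu) hw
    obtain ⟨v', hv'⟩ := hQ2 u (by rw [this]; exact Part.dom_iff_mem.2 ⟨_, hyw⟩)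
    exact ⟨v', (run_mul _ _ _ _).2 ⟨u, hu, hv'⟩⟩

theorem inv_star {R : Val → Val → Prop} {I : Val → Prop} (hI : ∀ a b, I a → R a b → I b)
    {u t : Val} (hu : I u) (h : Relation.ReflTransGen R u t) : I t := by
  induction h with
  | refl => exact hu
  | tail _ hs ih => exact hI _ _ ih hs

theorem impl_rfind {n : ℕ} {f : List.Vector ℕ (n + 1) → ℕ}
    (hf : Impl (fun v => Part.some (f v))) :
    Impl (fun v : List.Vector ℕ n => Nat.rfind fun k => Part.some (decide (f (k ::ᵥ v) = 0))) := by
  intro args out base hargs hout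
  have hargs' : ∀ i, (base ::ᵥ args).get i < base + 2 := by
    intro i
    refine Fin.cases ?_ (fun j => ?_) i
    · simp
    · have := hargs j
      simp only [List.Vector.get_cons_succ]; omega
  obtain ⟨Q, hQ1, hQ2⟩ := hf (base ::ᵥ args) (base + 1) (base + 2) hargs' (by omega)
  simp only [List.Vector.map_cons, Part.mem_some_iff] at hQ1
  set body : Prg := .char (.dec (base + 1)) * .char (.inc base) * Q with hbody
  -- invariant of the loop
  let Inv : Val → Val → Prop := fun v u => (∀ r, r < base → u r = v r) ∧
    u (base + 1) = f (u base ::ᵥ args.map v) ∧ ∀ j, j < u base → f (j ::ᵥ args.map v) ≠ 0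
  have hinit : ∀ v u t, Run (.char (.clr base)) v u → Run Q u t → Inv v t ∧ t base = 0 := by
    intro v u t h1 h2
    rw [run_char] at h1
    have h1 : u = _ := h1
    obtain ⟨b1, b2⟩ := hQ1 _ _ h2
    have e0 : u base = 0 := by simp [h1]
    have e1 : ∀ r, r < base → u r = v r := fun r hr => by
      simp [h1, Nat.ne_of_lt hr]
    have e2 : t base = 0 := by rw [b2 base (by omega) (by omega), e0]
    refine ⟨⟨fun r hr => ?_, ?_, ?_⟩, e2⟩
    · rw [b2 r (by omega) (by omega), e1 r hr]
    · rw [b1, e2, e0, map_congr_below args base hargs v u e1]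
    · intro j hj; omega
  have hstep : ∀ v u t, Inv v u → Run body u t → Inv v t ∧ t base = u base + 1 := by
    rintro v u t ⟨i1, i2, i3⟩ h
    simp only [hbody, run_mul, run_char] at h
    obtain ⟨p, ⟨q, ⟨hq1, hq2⟩, hp⟩, ht⟩ := h
    have hp : p = _ := hp
    obtain ⟨b1, b2⟩ := hQ1 _ _ ht
    have e0 : p base = u base + 1 := by simp [hp, hq2]
    have e1 : ∀ r, r < base → p r = v r := fun r hr => by
      have h1 : r ≠ base + 1 := by omega
      simp [hp, hq2, Nat.ne_of_lt hr, h1, i1 r hr]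
    have e2 : t base = u base + 1 := by rw [b2 base (by omega) (by omega), e0]
    refine ⟨⟨fun r hr => ?_, ?_, ?_⟩, e2⟩
    · rw [b2 r (by omega) (by omega), e1 r hr]
    · rw [b1, e2, e0, map_congr_below args base hargs v p e1]
    · intro j hj
      rcases Nat.lt_succ_iff_lt_or_eq.1 (e2 ▸ hj) with hj | rfl
      · exact i3 j hj
      · rw [← i2]; omega
  refine ⟨.char (.clr base) * Q * .star body * .char (.zer (base + 1)) * .char (.mov base out),
    ?_, ?_⟩
  · intro v v' h
    rw [run_mul] at h
    obtain ⟨u4, h, h5⟩ := h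
    rw [run_mul] at h
    obtain ⟨u3, h, h4⟩ := h
    rw [run_mul] at h
    obtain ⟨u2, h, h3⟩ := h
    rw [run_mul] at h
    obtain ⟨u1, h1, h2⟩ := h
    rw [run_star] at h3
    have inv : Inv v u3 := inv_star (fun a b ha hab => (hstep v a b ha hab).1)
      (hinit _ _ _ h1 h2).1 h3
    rw [run_char] at h4 h5
    obtain ⟨h4, rfl⟩ := h4
    have h5 : v' = _ := h5
    subst h5
    obtain ⟨i1, i2, i3⟩ := inv
    refine ⟨?_, fun r hr hr' => ?_⟩
    · simp only [Function.update_self]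
      refine Nat.mem_rfind.2 ⟨?_, fun {m} hm => ?_⟩
      · simp [← i2, h4]
      · simp [i3 m hm]
    · simp [hr', i1 r hr]
  · intro v hd
    obtain ⟨N, hN⟩ := Part.dom_iff_mem.1 hd
    obtain ⟨hN1, hN2⟩ := Nat.mem_rfind.1 hN
    have hN1 : f (N ::ᵥ args.map v) = 0 := by simpa using hN1
    have loop : ∀ d u, Inv v u → u base + d = N →
        ∃ t, Relation.ReflTransGen (Run body) u t ∧ t (base + 1) = 0 := by
      intro d
      induction d with
      | zero =>
        rintro u ⟨i1, i2, i3⟩ hu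
        have hu : u base = N := by omega
        exact ⟨u, .refl, by rw [i2, hu, hN1]⟩
      | succ d ih =>
        intro u inv hu
        have hne : f (u base ::ᵥ args.map v) ≠ 0 := by
          have := hN2 (m := u base) (by omega)
          simpa using this
        rw [← inv.2.1] at hne
        obtain ⟨t, ht⟩ := hQ2 (Function.update (Function.update u (base + 1) (u (base + 1) - 1))
          base ((Function.update u (base + 1) (u (base + 1) - 1)) base + 1)) trivial
        have hb : Run body u t := by
          simp only [hbody, run_mul, run_char]
          exact ⟨_, ⟨_, ⟨by omega, rfl⟩, rfl⟩, ht⟩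
        obtain ⟨j1, j2⟩ := hstep _ _ _ inv hb
        obtain ⟨t', h1, h2⟩ := ih t j1 (by omega)
        exact ⟨t', .head hb h1, h2⟩
    obtain ⟨t, ht⟩ := hQ2 (Function.update v base 0) trivial
    have hc : Run (.char (.clr base)) v (Function.update v base 0) := (run_char _ _ _).2 rfl
    obtain ⟨j1, j2⟩ := hinit _ _ _ hc ht
    obtain ⟨t', h1, h2⟩ := loop N t j1 (by omega)
    refine ⟨Function.update t' out (t' base), ?_⟩
    rw [run_mul]
    refine ⟨t', ?_, (run_char _ _ _).2 rfl⟩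
    rw [run_mul]
    refine ⟨t', ?_, (run_char _ _ _).2 ⟨h2, rfl⟩⟩
    rw [run_mul]
    refine ⟨t, ?_, (run_star _ _ _).2 h1⟩
    rw [run_mul]
    exact ⟨_, hc, ht⟩

theorem impl_prec {n : ℕ} {f : List.Vector ℕ n → ℕ} {g : List.Vector ℕ (n + 2) → ℕ}
    (hf : Impl (fun v => Part.some (f v))) (hg : Impl (fun v => Part.some (g v))) :
    Impl (fun v : List.Vector ℕ (n + 1) => Part.some
      (v.head.rec (f v.tail) fun y IH => g (y ::ᵥ IH ::ᵥ v.tail) : ℕ)) := by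
  intro args out base hargs hout
  have htail : ∀ i, args.tail.get i < base := by
    intro i
    rw [List.Vector.get_tail_succ]
    exact hargs _
  have hhead : args.head < base := by
    rw [← List.Vector.get_zero]
    exact hargs _
  have hargs' : ∀ i, ((base + 1) ::ᵥ (base + 2) ::ᵥ args.tail).get i < base + 4 := by
    intro i
    refine Fin.cases ?_ (fun j => ?_) i
    · simp
    · refine Fin.cases ?_ (fun k => ?_) j
      · simp only [List.Vector.get_cons_succ, List.Vector.get_cons_zero]; omega
      · have := htail k
        simp only [List.Vector.get_cons_succ]; omega
  obtain ⟨F, hF1, hF2⟩ := hf args.tail (base + 2) (base + 4)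
    (fun i => by have := htail i; omega) (by omega)
  obtain ⟨G, hG1, hG2⟩ := hg _ (base + 3) (base + 4) hargs' (by omega)
  simp only [List.Vector.map_cons, Part.mem_some_iff] at hF1 hG1
  set body : Prg := .char (.dec base) * G * .char (.mov (base + 3) (base + 2)) *
    .char (.inc (base + 1)) with hbody
  let rc : Val → ℕ → ℕ := fun v k =>
    Nat.rec (f (args.tail.map v)) (fun y IH => g (y ::ᵥ IH ::ᵥ args.tail.map v)) k
  -- invariant of the loop
  let Inv : Val → Val → Prop := fun v u => (∀ r, r < base → u r = v r) ∧
    u (base + 1) + u base = v args.head ∧ u (base + 2) = rc v (u (base + 1))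
  set init : Prg := F * .char (.mov args.head base) * .char (.clr (base + 1)) with hinit'
  have hinit : ∀ v t, Run init v t → Inv v t := by
    intro v t h
    simp only [hinit', run_mul, run_char] at h
    obtain ⟨p, ⟨q, hq, hp⟩, ht⟩ := h
    have hp : p = _ := hp
    have ht : t = _ := ht
    obtain ⟨b1, b2⟩ := hF1 _ _ hq
    have e1 : t (base + 1) = 0 := by simp [ht]
    have e2 : t (base + 2) = f (args.tail.map v) := by simp [ht, hp, b1]
    have e3 : t base = v args.head := by
      simp [ht, hp, b2 args.head (by omega) (by omega)]
    refine ⟨fun r hr => ?_, by omega, by rw [e2, e1]; rfl⟩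
    have h1 : r ≠ base + 1 := by omega
    simp [ht, hp, h1, Nat.ne_of_lt hr, b2 r (by omega) (by omega)]
  have hstep : ∀ v u t, Inv v u → Run body u t → Inv v t ∧ t base + 1 = u base := by
    rintro v u t ⟨i1, i2, i3⟩ h
    simp only [hbody, run_mul, run_char] at h
    obtain ⟨p, ⟨q, ⟨o, ⟨ho1, ho2⟩, hq⟩, hp⟩, ht⟩ := h
    have hp : p = _ := hp
    have ht : t = _ := ht
    obtain ⟨b1, b2⟩ := hG1 _ _ hq
    have o0 : o base = u base - 1 := by simp [ho2]
    have o1 : ∀ r, r ≠ base → o r = u r := fun r hr => by simp [ho2, hr]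
    have om : args.tail.map o = args.tail.map v := map_congr_below _ base htail _ _
      (fun r hr => by rw [o1 r (by omega), i1 r hr])
    have e0 : t base = u base - 1 := by
      simp [ht, hp, b2 base (by omega) (by omega), o0]
    have e1 : t (base + 1) = u (base + 1) + 1 := by
      simp [ht, hp, b2 (base + 1) (by omega) (by omega), o1 (base + 1) (by omega)]
    have e2 : t (base + 2) = q (base + 3) := by
      simp [ht, hp]
    refine ⟨⟨fun r hr => ?_, by omega, ?_⟩, by omega⟩
    · have h1 : r ≠ base + 1 := by omega
      have h2 : r ≠ base + 2 := by omega
      simp [ht, hp, h1, h2, b2 r (by omega) (by omega), o1 r (by omega), i1 r hr]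
    · rw [e2, b1, e1, om, o1 _ (by omega), o1 _ (by omega), i3]
  have hmap : ∀ v : Val, (args.map v).head = v args.head ∧
      (args.map v).tail = args.tail.map v := by
    intro v
    rw [← List.Vector.cons_head_tail args]
    simp
  refine ⟨init * .star body * .char (.zer base) * .char (.mov (base + 2) out), ?_, ?_⟩
  · intro v v' h
    rw [run_mul] at h
    obtain ⟨u4, h, h5⟩ := h
    rw [run_mul] at h
    obtain ⟨u3, h, h4⟩ := h
    rw [run_mul] at h
    obtain ⟨u2, h, h3⟩ := h
    rw [run_star] at h3
    have inv : Inv v u3 := inv_star (fun a b ha hab => (hstep v a b ha hab).1) (hinit _ _ h) h3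
    rw [run_char] at h4 h5
    obtain ⟨h4, rfl⟩ := h4
    have h5 : v' = _ := h5
    subst h5
    obtain ⟨i1, i2, i3⟩ := inv
    refine ⟨?_, fun r hr hr' => ?_⟩
    · simp only [Function.update_self, Part.mem_some_iff, (hmap v).1, (hmap v).2]
      have : u4 (base + 1) = v args.head := by omega
      rw [i3, this]
    · simp [hr', i1 r hr]
  · intro v _
    have loop : ∀ d u, Inv v u → u base = d →
        ∃ t, Relation.ReflTransGen (Run body) u t ∧ t base = 0 := by
      intro d
      induction d with
      | zero =>
        intro u _ hu
        exact ⟨u, .refl, hu⟩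
      | succ d ih =>
        intro u inv hu
        obtain ⟨t, ht⟩ := hG2 (Function.update u base (u base - 1)) trivial
        have hb : ∃ t, Run body u t := by
          simp only [hbody, run_mul, run_char]
          exact ⟨_, _, ⟨_, ⟨_, ⟨by omega, rfl⟩, ht⟩, rfl⟩, rfl⟩
        obtain ⟨t, hb⟩ := hb
        obtain ⟨j1, j2⟩ := hstep _ _ _ inv hb
        obtain ⟨t', h1, h2⟩ := ih t j1 (by omega)
        exact ⟨t', .head hb h1, h2⟩
    obtain ⟨t, ht⟩ := hF2 v trivial
    have hc : ∃ t, Run init v t := by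
      simp only [hinit', run_mul, run_char]
      exact ⟨_, _, ⟨_, ht, rfl⟩, rfl⟩
    obtain ⟨t, hc⟩ := hc
    obtain ⟨t', h1, h2⟩ := loop _ t (hinit _ _ hc) rfl
    refine ⟨Function.update t' out (t' (base + 2)), ?_⟩
    rw [run_mul]
    refine ⟨t', ?_, (run_char _ _ _).2 rfl⟩
    rw [run_mul]
    refine ⟨t', ?_, (run_char _ _ _).2 ⟨h2, rfl⟩⟩
    rw [run_mul]
    exact ⟨t, hc, (run_star _ _ _).2 h1⟩

theorem impl_prim {n : ℕ} {f : List.Vector ℕ n → ℕ} (hf : Nat.Primrec' f) :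
    Impl (fun v => Part.some (f v)) := by
  induction hf with
  | zero => exact impl_zero
  | succ => exact impl_succ
  | get i => exact impl_get i
  | @comp m n f g _ _ ihf ihg =>
    have := impl_comp (fun i v => Part.some (g i v)) ihf ihg
    intro args out base h1 h2
    obtain ⟨P, hP⟩ := this args out base h1 h2
    refine ⟨P, ?_⟩
    simpa [Vector.mOfFn_part_some] using hP
  | prec _ _ ihf ihg => exact impl_prec ihf ihg

theorem impl_part {n : ℕ} {f : List.Vector ℕ n →. ℕ} (hf : Nat.Partrec' f) : Impl f := by
  induction hf with
  | prim h => exact impl_prim h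
  | comp g _ _ ihf ihg => exact impl_comp g ihf ihg
  | rfind _ ih => exact impl_rfind ih

theorem below_mono {B B' : ℕ} (h : B ≤ B') {a : Letter} (ha : a.Below B) : a.Below B' := by
  cases a <;> simp only [Letter.Below] at * <;> omega

/-- The letters used by a program are bounded. -/
theorem prg_bounded (P : Prg) : ∃ s : Finset Letter, ∀ w ∈ P.matches', ∀ a ∈ w, a ∈ s := by
  classical
  induction P with
  | zero => exact ⟨∅, fun w hw => (Language.notMem_zero w hw).elim⟩
  | epsilon =>
    refine ⟨∅, fun w hw a ha => ?_⟩
    have : w = [] := hw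
    subst this
    simp at ha
  | char b =>
    refine ⟨{b}, fun w hw a ha => ?_⟩
    have : w = [b] := hw
    subst this
    simpa using ha
  | plus P Q ihP ihQ =>
    obtain ⟨s, hs⟩ := ihP
    obtain ⟨t, ht⟩ := ihQ
    refine ⟨s ∪ t, fun w hw a ha => ?_⟩
    rcases hw with hw | hw
    · exact Finset.mem_union_left _ (hs w hw a ha)
    · exact Finset.mem_union_right _ (ht w hw a ha)
  | comp P Q ihP ihQ =>
    obtain ⟨s, hs⟩ := ihP
    obtain ⟨t, ht⟩ := ihQ
    refine ⟨s ∪ t, fun w hw a ha => ?_⟩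
    obtain ⟨x, hx, y, hy, rfl⟩ := Language.mem_mul.1 hw
    rcases List.mem_append.1 ha with ha | ha
    · exact Finset.mem_union_left _ (hs x hx a ha)
    · exact Finset.mem_union_right _ (ht y hy a ha)
  | star P ih =>
    obtain ⟨s, hs⟩ := ih
    refine ⟨s, fun w hw a ha => ?_⟩
    obtain ⟨S, rfl, hS⟩ := hw
    obtain ⟨x, hx, hax⟩ := List.mem_flatten.1 ha
    exact hs x (hS x hx) a hax

/-! ### Encoding runs of counter programs by data words -/

/-- The set of counters containing a fixed data value, for counters below `B`. -/
abbrev Mem (B : ℕ) : Type := Fin B → Bool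

def Mem.has {B : ℕ} (S : Mem B) (c : ℕ) : Bool := if h : c < B then S ⟨c, h⟩ else false

def Mem.put {B : ℕ} (S : Mem B) (c : ℕ) (b : Bool) : Mem B := fun i => if i.1 = c then b else S i

theorem Mem.has_put {B : ℕ} (S : Mem B) (c c' : ℕ) (b : Bool) (hc : c < B) :
    (S.put c b).has c' = if c' = c then b else S.has c' := by
  unfold Mem.has Mem.put
  by_cases h : c' = c
  · subst h; simp [hc]
  · by_cases hlt : c' < B <;> simp [h, hlt]

/-- How reading a letter affects the counters containing a data value `e`; the Boolean tells whether
the letter carries `e`. -/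
def estep {B : ℕ} (S : Mem B) : Letter → Bool → Option (Mem B)
  | .inc c, true => if S.has c then none else some (S.put c true)
  | .inc _, false => some S
  | .dec c, true => if S.has c then some (S.put c false) else none
  | .dec _, false => some S
  | .zer c, _ => if S.has c then none else some S
  | .mov c d, _ => some (S.put d (S.has c))
  | .clr c, _ => some (S.put c false)

section
open Classical

noncomputable def erun {B : ℕ} {D : Type} (e : D) : Mem B → List (Letter × D) → Option (Mem B)
  | S, [] => some S
  | S, p :: w => (estep S p.1 (decide (p.2 = e))).bind fun S' => erun e S' w

def Agree {B : ℕ} {D : Type} (St : D → Mem B) (v : Val) : Prop :=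
  ∀ c, c < B → {e | (St e).has c = true}.Finite ∧ {e | (St e).has c = true}.ncard = v c

theorem agree_step {B : ℕ} {D : Type} {St St' : D → Mem B} {v : Val} (h : Agree St v)
    {a : Letter} (ha : a.Below B) {d : D}
    (hs : ∀ e, estep (St e) a (decide (d = e)) = some (St' e)) :
    ∃ v', Step a v v' ∧ Agree St' v' := by
  cases a with
  | inc c =>
    have ha : c < B := ha
    refine ⟨_, rfl, ?_⟩
    have hd : (St d).has c = false := by
      have := hs d
      by_contra hh
      simp [estep, hh] at this
    have hS : ∀ e, St' e = if d = e then (St e).put c true else St e := by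
      intro e
      have := hs e
      by_cases hde : d = e
      · subst hde
        simp [estep, hd] at this
        simp [this]
      · simp [estep, hde] at this
        simp [this, hde]
    intro c' hc'
    by_cases hcc : c' = c
    · subst hcc
      have : {e | (St' e).has c' = true} = insert d {e | (St e).has c' = true} := by
        ext e
        by_cases hde : d = e
        · simp [hS, hde, Mem.has_put _ _ _ _ ha]
        · simp [hS, hde, Ne.symm hde]
      rw [this]
      refine ⟨(h c' hc').1.insert d, ?_⟩
      rw [Set.ncard_insert_of_notMem (by simp [hd]) (h c' hc').1, (h c' hc').2]
      simp
    · have : {e | (St' e).has c' = true} = {e | (St e).has c' = true} := by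
        ext e
        by_cases hde : d = e
        · simp [hS, hde, Mem.has_put _ _ _ _ ha, hcc]
        · simp [hS, hde]
      rw [this]
      simpa [hcc] using h c' hc'
  | dec c =>
    have ha : c < B := ha
    have hd : (St d).has c = true := by
      have := hs d
      by_contra hh
      simp [estep, hh] at this
    have hpos : 0 < v c := by
      rw [← (h c ha).2, Set.ncard_pos (h c ha).1]
      exact ⟨d, hd⟩
    refine ⟨_, ⟨hpos, rfl⟩, ?_⟩
    have hS : ∀ e, St' e = if d = e then (St e).put c false else St e := by
      intro e
      have := hs e
      by_cases hde : d = e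
      · subst hde
        simp [estep, hd] at this
        simp [this]
      · simp [estep, hde] at this
        simp [this, hde]
    intro c' hc'
    by_cases hcc : c' = c
    · subst hcc
      have : {e | (St' e).has c' = true} = {e | (St e).has c' = true} \ {d} := by
        ext e
        by_cases hde : d = e
        · simp [hS, hde, Mem.has_put _ _ _ _ ha]
        · simp [hS, hde, Ne.symm hde]
      rw [this]
      refine ⟨(h c' hc').1.subset Set.sdiff_subset, ?_⟩
      rw [Set.ncard_sdiff_singleton_of_mem (show d ∈ {e | (St e).has c' = true} from hd), (h c' hc').2]
      simp
    · have : {e | (St' e).has c' = true} = {e | (St e).has c' = true} := by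
        ext e
        by_cases hde : d = e
        · simp [hS, hde, Mem.has_put _ _ _ _ ha, hcc]
        · simp [hS, hde]
      rw [this]
      simpa [hcc] using h c' hc'
  | zer c =>
    have ha : c < B := ha
    have hn : ∀ e, (St e).has c = false := by
      intro e
      have := hs e
      by_contra hh
      simp [estep, hh] at this
    have hS : St' = St := by
      funext e
      have := hs e
      simp [estep, hn] at this
      exact this.symm
    refine ⟨v, ⟨?_, rfl⟩, hS ▸ h⟩
    rw [← (h c ha).2]
    simp [hn]
  | mov c c₂ =>
    obtain ⟨ha, ha2⟩ : c < B ∧ c₂ < B := ha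
    refine ⟨_, rfl, ?_⟩
    have hS : ∀ e, St' e = (St e).put c₂ ((St e).has c) := by
      intro e
      have := hs e
      simp [estep] at this
      exact this.symm
    intro c' hc'
    by_cases hcc : c' = c₂
    · subst hcc
      simpa [hS, Mem.has_put _ _ _ _ ha2] using h c ha
    · simpa [hS, Mem.has_put _ _ _ _ ha2, hcc] using h c' hc'
  | clr c =>
    have ha : c < B := ha
    refine ⟨_, rfl, ?_⟩
    have hS : ∀ e, St' e = (St e).put c false := by
      intro e
      have := hs e
      simp [estep] at this
      exact this.symm
    intro c' hc'
    by_cases hcc : c' = c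
    · subst hcc
      simp [hS, Mem.has_put _ _ _ _ ha]
    · simpa [hS, Mem.has_put _ _ _ _ ha, hcc] using h c' hc'

theorem step_unique {a : Letter} {v u u' : Val} (h : Step a v u) (hh : Step a v u') : u = u' := by
  cases a with
  | inc c => exact Eq.trans h (Eq.symm hh)
  | dec c => exact Eq.trans h.2 (Eq.symm hh.2)
  | zer c => exact Eq.trans h.2 (Eq.symm hh.2)
  | mov c d => exact Eq.trans h (Eq.symm hh)
  | clr c => exact Eq.trans h (Eq.symm hh)

/-- A feasible step can be realised by some data value. -/
theorem exists_data {B : ℕ} {D : Type} [Infinite D] {St : D → Mem B} {v u : Val} (h : Agree St v)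
    {a : Letter} (ha : a.Below B) (hu : Step a v u) :
    ∃ d : D, ∀ e, (estep (St e) a (decide (d = e))).isSome := by
  cases a with
  | inc c =>
    obtain ⟨d, hd⟩ := (h c ha).1.exists_notMem
    refine ⟨d, fun e => ?_⟩
    by_cases hde : d = e
    · subst hde
      simp at hd
      simp [estep, hd]
    · simp [estep, hde]
  | dec c =>
    have hpos : 0 < v c := hu.1
    rw [← (h c ha).2, Set.ncard_pos (h c ha).1] at hpos
    obtain ⟨d, hd⟩ := hpos
    refine ⟨d, fun e => ?_⟩
    by_cases hde : d = e
    · subst hde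
      simp at hd
      simp [estep, hd]
    · simp [estep, hde]
  | zer c =>
    have h0 : v c = 0 := hu.1
    rw [← (h c ha).2, Set.ncard_eq_zero (h c ha).1] at h0
    obtain ⟨d⟩ : Nonempty D := inferInstance
    refine ⟨d, fun e => ?_⟩
    have : (St e).has c = false := by
      by_contra hh
      have : e ∈ {e | (St e).has c = true} := by simpa using hh
      rw [h0] at this
      exact this
    simp [estep, this]
  | mov c d =>
    obtain ⟨d⟩ : Nonempty D := inferInstance
    exact ⟨d, fun e => by simp [estep]⟩
  | clr c =>
    obtain ⟨d⟩ : Nonempty D := inferInstance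
    exact ⟨d, fun e => by simp [estep]⟩

theorem erun_sound {B : ℕ} {D : Type} (w : List (Letter × D)) (St : D → Mem B) (v : Val)
    (h : Agree St v) (hb : ∀ p ∈ w, p.1.Below B) (hr : ∀ e, (erun e (St e) w).isSome) :
    ∃ v', Exec (w.map Prod.fst) v v' := by
  induction w generalizing St v with
  | nil => exact ⟨v, rfl⟩
  | cons p w ih =>
    have h1 : ∀ e, ∃ S', estep (St e) p.1 (decide (p.2 = e)) = some S' ∧
        (erun e S' w).isSome := by
      intro e
      have := hr e
      simp only [erun] at this
      rcases hE : estep (St e) p.1 (decide (p.2 = e)) with _ | S'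
      · simp [hE] at this
      · exact ⟨S', rfl, by simpa [hE] using this⟩
    choose St' hs hr' using h1
    obtain ⟨u, hu, hag⟩ := agree_step h (hb p (by simp)) hs
    obtain ⟨v', hv'⟩ := ih St' u hag (fun q hq => hb q (by simp [hq])) hr'
    exact ⟨v', u, hu, hv'⟩

theorem erun_complete {B : ℕ} {D : Type} [Infinite D] (w : List Letter) (St : D → Mem B) (v v' : Val)
    (h : Agree St v) (hb : ∀ a ∈ w, a.Below B) (hx : Exec w v v') :
    ∃ w' : List (Letter × D), w'.map Prod.fst = w ∧ ∀ e, (erun e (St e) w').isSome := by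
  induction w generalizing St v with
  | nil => exact ⟨[], rfl, fun e => rfl⟩
  | cons a w ih =>
    obtain ⟨u, hu, hx⟩ := hx
    obtain ⟨d, hd⟩ := exists_data h (hb a (by simp)) hu
    have h1 : ∀ e, ∃ S', estep (St e) a (decide (d = e)) = some S' :=
      fun e => Option.isSome_iff_exists.1 (hd e)
    choose St' hs using h1
    obtain ⟨u', hu', hag⟩ := agree_step h (hb a (by simp)) hs
    obtain rfl := step_unique hu hu'
    obtain ⟨w', rfl, hr⟩ := ih St' u hag (fun q hq => hb q (by simp [hq])) hx
    exact ⟨(a, d) :: w', rfl, fun e => by simpa [erun, hs] using hr e⟩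

end

theorem agree_init {B : ℕ} {D : Type} : Agree (fun _ : D => fun _ : Fin B => false) (fun _ => 0) := by
  intro c hc
  simp [Mem.has]

/-! ### Words read along branches, bottom-up -/

/-- The word read from the leaf `x ++ s` (included) up to `x` (excluded). -/
def wordAt {D : Type} (τ : DataTree ℕ D) : Pos → List ℕ → List (ℕ × D)
  | _, [] => []
  | x, i :: s => wordAt τ (x ++ [i]) s ++ [(τ.label (x ++ [i]), τ.data (x ++ [i]))]

/-- The word read from the leaf `l` up to the root, both included. -/
def fullWord {D : Type} (τ : DataTree ℕ D) (l : Pos) : List (ℕ × D) :=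
  wordAt τ [] l ++ [(τ.label [], τ.data [])]

theorem fullWord_split {D : Type} (τ : DataTree ℕ D) (x s : List ℕ) :
    ∃ more, fullWord τ (x ++ s) = wordAt τ x s ++ (τ.label x, τ.data x) :: more := by
  induction x using List.reverseRecOn generalizing s with
  | nil => exact ⟨[], rfl⟩
  | append_singleton y i ih =>
    obtain ⟨more, h⟩ := ih (i :: s)
    refine ⟨(τ.label y, τ.data y) :: more, ?_⟩
    simpa [wordAt] using h

theorem length_wordAt {D : Type} (τ : DataTree ℕ D) (x : Pos) (s : List ℕ) :
    (wordAt τ x s).length = s.length := by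
  induction s generalizing x with
  | nil => rfl
  | cons i s ih => simp [wordAt, ih]

theorem prefix_mem {A D : Type} (τ : DataTree A D) (x s : List ℕ) (h : x ++ s ∈ τ.pos) :
    x ∈ τ.pos := by
  induction s using List.reverseRecOn with
  | nil => simpa using h
  | append_singleton s i ih => exact ih (τ.parent_closed _ i (by simpa using h))

theorem leaf_ext {A D : Type} {τ : DataTree A D} {x s : List ℕ} (hx : IsLeaf τ x)
    (h : x ++ s ∈ τ.pos) : s = [] := by
  rcases s with _ | ⟨i, s⟩
  · rfl
  · exact absurd (prefix_mem τ (x ++ [i]) s (by simpa using h)) (hx i)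

theorem ext_finite {A D : Type} (τ : DataTree A D) (x : List ℕ) :
    {s | x ++ s ∈ τ.pos}.Finite := by
  refine Set.Finite.preimage (f := fun s => x ++ s) ?_ τ.pos.finite_toSet
  intro a _ b _ h
  exact List.append_cancel_left h

/-! ### BUDTA simulating a finite automaton that guesses a data value at each leaf -/

section Det

variable {T : Type} [Fintype T] (tstep : T → ℕ → Bool → T) (t0 : T) (bad : T → Prop) (alph : ℕ)

noncomputable def idx (t : T) : ℕ := (Fintype.equivFin T t : ℕ)

theorem idx_lt (t : T) : idx t < Fintype.card T := (Fintype.equivFin T t).2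

theorem idx_inj {s t : T} (h : idx s = idx t) : s = t :=
  (Fintype.equivFin T).injective (Fin.ext h)

noncomputable def dtests (p : T × Fin alph × Bool) : List (Bool × CTest) :=
  [(false, (0, idx p.1)), (false, (6, (p.2.1 : ℕ))), (!p.2.2, (1, 0))]

open Classical in
noncomputable def detM : CBUDTA :=
  (alph, 1, Fintype.card T, idx t0,
    (Finset.univ : Finset (T × Fin alph × Bool)).toList.map
      (fun p => (dtests alph p, [(1, idx (tstep p.1 p.2.1 p.2.2))])) ++
    ((Finset.univ : Finset (T × Fin alph × Bool)).toList.filter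
      (fun p => decide (bad (tstep p.1 p.2.1 p.2.2)))).map
      (fun p => ((false, (4, 0)) :: dtests alph p, [(0, 0)])))

theorem mem_detM (tr : CTrans) : tr ∈ trans (detM tstep t0 bad alph) ↔
    (∃ p : T × Fin alph × Bool, tr = (dtests alph p, [(1, idx (tstep p.1 p.2.1 p.2.2))])) ∨
    (∃ p : T × Fin alph × Bool, bad (tstep p.1 p.2.1 p.2.2) ∧
      tr = ((false, (4, 0)) :: dtests alph p, [(0, 0)])) := by
  unfold detM trans
  simp only [List.mem_append, List.mem_map, List.mem_filter, Finset.mem_toList, Finset.mem_univ,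
    true_and, decide_eq_true_eq]
  constructor
  · rintro (⟨p, rfl⟩ | ⟨p, h, rfl⟩)
    · exact Or.inl ⟨p, rfl⟩
    · exact Or.inr ⟨p, h, rfl⟩
  · rintro (⟨p, rfl⟩ | ⟨p, h, rfl⟩)
    · exact Or.inl ⟨p, rfl⟩
    · exact Or.inr ⟨p, h, rfl⟩

theorem wf_dtests (p : T × Fin alph × Bool) : ∀ nt ∈ dtests alph p, nt.2.1 ≤ 7 ∧
      (nt.2.1 = 0 → nt.2.2 < Fintype.card T) ∧
      (nt.2.1 = 6 → nt.2.2 < alph) ∧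
      (nt.2.1 = 7 → nt.2.2 < 1) := by
  intro nt h
  simp only [dtests, List.mem_cons, List.not_mem_nil, or_false] at h
  rcases h with rfl | rfl | rfl
  · simp [idx_lt]
  · simp
  · simp

theorem wf_detM : WF (detM tstep t0 bad alph) := by
  refine ⟨idx_lt t0, fun tr htr => ?_⟩
  rcases (mem_detM _ _ _ _ _).1 htr with ⟨p, rfl⟩ | ⟨p, _, rfl⟩
  · refine ⟨wf_dtests alph p, ?_⟩
    intro a ha
    simp only [List.mem_singleton] at ha
    subst ha
    exact ⟨by simp, by simp, fun _ => idx_lt _⟩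
  · refine ⟨?_, ?_⟩
    · intro nt hnt
      rcases List.mem_cons.1 hnt with rfl | hnt
      · simp
      · exact wf_dtests alph p nt hnt
    intro a ha
    simp only [List.mem_singleton] at ha
    subst ha
    simp

variable {D : Type}

theorem holds_dtests (τ : DataTree ℕ D) (bl : Pos → ℕ) (x : Pos) (q : ℕ) (d : D)
    (p : T × Fin alph × Bool) : cTestHolds τ bl x q d (dtests alph p) ↔
      q = idx p.1 ∧ τ.label x = p.2.1 ∧ (τ.data x = d ↔ p.2.2 = true) := by
  simp [cTestHolds, dtests, cBasicHolds]

open Classical in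
noncomputable def trun (e : D) (w : List (ℕ × D)) : T :=
  w.foldl (fun t p => tstep t p.1 (decide (p.2 = e))) t0

open Classical in
theorem det_accepts_iff (τ : DataTree ℕ D) (hτ : TreeWF alph τ) :
    CAccepts (detM tstep t0 bad alph) τ ↔
      ∀ l ∈ τ.pos, IsLeaf τ l → ∃ e, bad (trun tstep t0 e (fullWord τ l)) := by
  constructor
  · rintro ⟨bl, _, ρ, ⟨_, _, hleaf, hrun⟩, hroot⟩ l hl hll
    obtain ⟨e, he⟩ := hleaf l hl hll
    refine ⟨e, ?_⟩
    have key : ∀ s x, x ++ s = l → (idx (trun tstep t0 e (wordAt τ x s)), e) ∈ ρ x := by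
      intro s
      induction s with
      | nil =>
        intro x hx
        have hx : x = l := by simpa using hx
        subst hx
        rw [he]
        exact rfl
      | cons i s ih =>
        intro x hx
        have h1 := ih (x ++ [i]) (by simpa using hx)
        have hpos : x ++ [i] ∈ τ.pos := prefix_mem τ _ s (by simpa [hx] using hl)
        obtain ⟨tr, htr, ht, hact⟩ := hrun x i hpos _ h1
        rcases (mem_detM _ _ _ _ _).1 htr with ⟨p, rfl⟩ | ⟨p, _, rfl⟩
        · rw [holds_dtests] at ht
          obtain ⟨t1, t2, t3⟩ := ht
          have hh := hact _ (List.mem_singleton.2 rfl)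
          have hh : (idx (tstep p.1 p.2.1 p.2.2), e) ∈ ρ x := hh
          have t1 := idx_inj t1
          have t3 : decide (τ.data (x ++ [i]) = e) = p.2.2 := by
            rw [Bool.eq_iff_iff, decide_eq_true_eq]; exact t3
          simp only [trun, wordAt, List.foldl_append, List.foldl_cons, List.foldl_nil] at t1 ⊢
          rw [t1, t2, t3]
          exact hh
        · have := ht _ (List.mem_cons_self ..)
          simp [cBasicHolds] at this
    have h0 := key l [] rfl
    obtain ⟨t, htr, ht⟩ := hroot _ h0
    rcases (mem_detM _ _ _ _ _).1 htr with ⟨p, hp⟩ | ⟨p, hb, hp⟩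
    · simp at hp
    · have hp : t = (false, (4, 0)) :: dtests alph p := by simpa using hp
      subst hp
      have ht : cTestHolds τ bl [] _ _ (dtests alph p) :=
        fun nt hnt => ht nt (List.mem_cons_of_mem _ hnt)
      rw [holds_dtests] at ht
      obtain ⟨t1, t2, t3⟩ := ht
      have t1 := idx_inj t1
      have t3 : decide (τ.data [] = e) = p.2.2 := by
        rw [Bool.eq_iff_iff, decide_eq_true_eq]; exact t3
      simp only [fullWord, trun, List.foldl_append, List.foldl_cons, List.foldl_nil] at t1 ⊢
      rw [t1, t2, t3]
      exact hb
  · intro h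
    choose E hE using h
    refine ⟨fun _ => 0, fun _ _ => Nat.zero_lt_one, fun x => {qd | ∃ s, ∃ h : x ++ s ∈ τ.pos,
      ∃ h' : IsLeaf τ (x ++ s), qd = (idx (trun tstep t0 (E _ h h') (wordAt τ x s)), E _ h h')},
      ⟨?_, ?_, ?_, ?_⟩, ?_⟩
    · intro x _
      refine ((ext_finite τ x).image (fun s =>
        if h : x ++ s ∈ τ.pos then if h' : IsLeaf τ (x ++ s) then
          (idx (trun tstep t0 (E _ h h') (wordAt τ x s)), E _ h h') else (0, τ.data []) else
          (0, τ.data []))).subset ?_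
      rintro _ ⟨s, h, h', rfl⟩
      exact ⟨s, h, by simp [h, h']⟩
    · rintro x _ _ ⟨s, h, h', rfl⟩
      exact idx_lt _
    · intro x hx hl
      refine ⟨E x hx hl, ?_⟩
      ext qd
      constructor
      · rintro ⟨s, h, h', rfl⟩
        obtain rfl := leaf_ext hl h
        simp only [List.append_nil]
        rfl
      · intro hq
        have hq : qd = _ := hq
        subst hq
        refine ⟨[], by simpa using hx, by simpa using hl, ?_⟩
        simp only [List.append_nil]
        rfl
    · rintro y i hy _ ⟨s, h, h', rfl⟩
      have hassoc : y ++ [i] ++ s = y ++ (i :: s) := by simp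
      refine ⟨_, (mem_detM _ _ _ _ _).2 (Or.inl
        ⟨(trun tstep t0 (E _ h h') (wordAt τ (y ++ [i]) s), ⟨τ.label (y ++ [i]), hτ _ hy⟩,
          decide (τ.data (y ++ [i]) = E _ h h')), rfl⟩), ?_, ?_⟩
      · rw [holds_dtests]
        simp
      · intro a ha
        rw [List.mem_singleton.1 ha]
        refine ⟨i :: s, hassoc ▸ h, hassoc ▸ h', ?_⟩
        simp only [trun, wordAt, List.foldl_append, List.foldl_cons, List.foldl_nil, hassoc]
    · rintro _ ⟨s, h, h', rfl⟩
      have hb := hE _ h h'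
      refine ⟨_, (mem_detM _ _ _ _ _).2 (Or.inr
        ⟨(trun tstep t0 (E _ h h') (wordAt τ [] s), ⟨τ.label [], hτ _ τ.root_mem⟩,
          decide (τ.data [] = E _ h h')), ?_, rfl⟩), ?_⟩
      · simp only [fullWord, trun, List.foldl_append, List.foldl_cons, List.foldl_nil] at hb ⊢
        exact hb
      · intro nt hnt
        rcases List.mem_cons.1 hnt with rfl | hnt
        · simp [cBasicHolds]
        · exact (holds_dtests alph τ _ _ _ _ _).2 (by simp) nt hnt

end Det

/-! ### BUDTA checking that all branches start with `a0 ^ n a1` -/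

def inM (alph a0 a1 n : ℕ) : CBUDTA :=
  (alph, 1, n + 1, 0, ([(false, (0, n)), (false, (6, a1))], [(0, 0)]) ::
    (List.range n).map fun i => ([(false, (0, i)), (false, (6, a0))], [(1, i + 1)]))

theorem mem_inM (alph a0 a1 n : ℕ) (tr : CTrans) : tr ∈ trans (inM alph a0 a1 n) ↔
    tr = ([(false, (0, n)), (false, (6, a1))], [(0, 0)]) ∨
    ∃ i, i < n ∧ tr = ([(false, (0, i)), (false, (6, a0))], [(1, i + 1)]) := by
  simp [trans, inM, eq_comm]

theorem wf_inM (alph a0 a1 n : ℕ) (h0 : a0 < alph) (h1 : a1 < alph) : WF (inM alph a0 a1 n) := by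
  refine ⟨Nat.succ_pos n, fun tr htr => ?_⟩
  rcases (mem_inM _ _ _ _ _).1 htr with rfl | ⟨i, hi, rfl⟩
  · simp [alphSize, qSize, inM, h1]
  · simp [alphSize, qSize, inM, h0]; omega

theorem holds_in {D : Type} (τ : DataTree ℕ D) (bl : Pos → ℕ) (x : Pos) (q : ℕ) (d : D) (i a : ℕ) :
    cTestHolds τ bl x q d [(false, (0, i)), (false, (6, a))] ↔ q = i ∧ τ.label x = a := by
  simp [cTestHolds, cBasicHolds]

theorem inM_accepts_iff {D : Type} (alph a0 a1 n : ℕ) (τ : DataTree ℕ D) :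
    CAccepts (inM alph a0 a1 n) τ ↔ ∀ l ∈ τ.pos, IsLeaf τ l →
      ∃ more, (fullWord τ l).map Prod.fst = List.replicate n a0 ++ a1 :: more := by
  constructor
  · rintro ⟨bl, _, ρ, ⟨_, _, hleaf, hrun⟩, hroot⟩ l hl hll
    obtain ⟨e, he⟩ := hleaf l hl hll
    have key : ∀ s x, x ++ s = l → s.length ≤ n → (s.length, e) ∈ ρ x ∧
        (wordAt τ x s).map Prod.fst = List.replicate s.length a0 := by
      intro s
      induction s with
      | nil =>
        intro x hx _
        have hx : x = l := by simpa using hx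
        subst hx
        rw [he]
        exact ⟨rfl, rfl⟩
      | cons i s ih =>
        intro x hx hs
        simp only [List.length_cons] at hs
        obtain ⟨h1, h2⟩ := ih (x ++ [i]) (by simpa using hx) (by omega)
        have hpos : x ++ [i] ∈ τ.pos := prefix_mem τ _ s (by simpa [hx] using hl)
        obtain ⟨tr, htr, ht, hact⟩ := hrun x i hpos _ h1
        rcases (mem_inM _ _ _ _ _).1 htr with rfl | ⟨j, hj, rfl⟩
        · rw [holds_in] at ht
          have := ht.1
          simp only at this
          omega
        · rw [holds_in] at ht
          obtain ⟨t1, t2⟩ := ht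
          simp only at t1
          have hh : (j + 1, e) ∈ ρ x := hact _ (List.mem_singleton.2 rfl)
          refine ⟨by rw [List.length_cons, t1]; exact hh, ?_⟩
          simp [wordAt, h2, t2, List.replicate_succ']
    have hlen : n ≤ l.length := by
      by_contra hlt
      obtain ⟨h1, _⟩ := key l [] rfl (by omega)
      obtain ⟨t, htr, ht⟩ := hroot _ h1
      rcases (mem_inM _ _ _ _ _).1 htr with hp | ⟨j, hj, hp⟩
      · have hp := (Prod.mk.inj hp).1
        subst hp
        rw [holds_in] at ht
        have := ht.1
        simp only at this
        omega
      · simp at hp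
    have hsplit : l.take (l.length - n) ++ l.drop (l.length - n) = l := List.take_append_drop _ _
    have hsl : (l.drop (l.length - n)).length = n := by simp; omega
    obtain ⟨h1, h2⟩ := key _ _ hsplit hsl.le
    rw [hsl] at h1 h2
    obtain ⟨more, hm⟩ := fullWord_split τ (l.take (l.length - n)) (l.drop (l.length - n))
    rw [hsplit] at hm
    refine ⟨more.map Prod.fst, ?_⟩
    rw [hm]
    suffices hlab : τ.label (l.take (l.length - n)) = a1 by simp [h2, hlab]
    have hxpos : l.take (l.length - n) ∈ τ.pos := prefix_mem τ _ _ (by rw [hsplit]; exact hl)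
    generalize l.take (l.length - n) = x at h1 hxpos
    rcases List.eq_nil_or_concat' x with rfl | ⟨y, i, rfl⟩
    · obtain ⟨t, htr, ht⟩ := hroot _ h1
      rcases (mem_inM _ _ _ _ _).1 htr with hp | ⟨j, hj, hp⟩
      · have hp := (Prod.mk.inj hp).1
        subst hp
        rw [holds_in] at ht
        exact ht.2
      · simp at hp
    · obtain ⟨tr, htr, ht, hact⟩ := hrun y i hxpos _ h1
      rcases (mem_inM _ _ _ _ _).1 htr with rfl | ⟨j, hj, rfl⟩
      · rw [holds_in] at ht
        exact ht.2
      · rw [holds_in] at ht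
        have := ht.1
        simp only at this
        omega
  · intro h
    have key : ∀ x s, x ++ s ∈ τ.pos → IsLeaf τ (x ++ s) →
        (s.length < n → τ.label x = a0) ∧ (s.length = n → τ.label x = a1) := by
      intro x s hp hl
      obtain ⟨more, hm⟩ := h _ hp hl
      obtain ⟨more', hm'⟩ := fullWord_split τ x s
      have hlab : ((fullWord τ (x ++ s)).map Prod.fst)[s.length]? = some (τ.label x) := by
        rw [hm', List.map_append, List.getElem?_append_right (by simp [length_wordAt])]
        simp [length_wordAt]
      rw [hm] at hlab
      constructor
      · intro hs
        rw [List.getElem?_append_left (by simpa using hs)] at hlab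
        simp [hs] at hlab
        exact hlab.symm
      · intro hs
        rw [List.getElem?_append_right (by simp [hs])] at hlab
        simp [hs] at hlab
        exact hlab.symm
    refine ⟨fun _ => 0, fun _ _ => Nat.zero_lt_one, fun x => {qd | ∃ s, x ++ s ∈ τ.pos ∧
      IsLeaf τ (x ++ s) ∧ s.length ≤ n ∧ qd = (s.length, τ.data [])},
      ⟨?_, ?_, ?_, ?_⟩, ?_⟩
    · intro x _
      refine ((ext_finite τ x).image (fun s => (s.length, τ.data []))).subset ?_
      rintro _ ⟨s, h, _, _, rfl⟩
      exact ⟨s, h, rfl⟩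
    · rintro x _ _ ⟨s, _, _, hs, rfl⟩
      exact Nat.lt_succ_of_le hs
    · intro x hx hl
      refine ⟨τ.data [], ?_⟩
      ext qd
      constructor
      · rintro ⟨s, h, _, _, rfl⟩
        obtain rfl := leaf_ext hl h
        rfl
      · intro hq
        have hq : qd = _ := hq
        subst hq
        exact ⟨[], by simpa using hx, by simpa using hl, Nat.zero_le _, rfl⟩
    · rintro y i hy _ ⟨s, h, h', hs, rfl⟩
      have hassoc : y ++ [i] ++ s = y ++ (i :: s) := by simp
      obtain ⟨k1, k2⟩ := key _ _ h h'
      rcases Nat.lt_or_eq_of_le hs with hlt | heq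
      · refine ⟨_, (mem_inM _ _ _ _ _).2 (Or.inr ⟨s.length, hlt, rfl⟩), ?_, ?_⟩
        · rw [holds_in]
          exact ⟨rfl, k1 hlt⟩
        · intro a ha
          rw [List.mem_singleton.1 ha]
          exact ⟨i :: s, hassoc ▸ h, hassoc ▸ h', by simpa using hlt, rfl⟩
      · refine ⟨_, (mem_inM _ _ _ _ _).2 (Or.inl rfl), ?_, ?_⟩
        · rw [holds_in]
          exact ⟨heq, k2 heq⟩
        · intro a ha
          rw [List.mem_singleton.1 ha]
          trivial
    · rintro _ ⟨s, hp, hl, hs, rfl⟩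
      obtain ⟨k1, k2⟩ := key _ _ hp hl
      have heq : s.length = n := by
        obtain ⟨more, hm⟩ := h _ hp hl
        have := congrArg List.length hm
        simp [fullWord, length_wordAt] at this
        omega
      refine ⟨_, (mem_inM _ _ _ _ _).2 (Or.inl rfl), ?_⟩
      rw [holds_in]
      exact ⟨heq, k2 heq⟩

/-! ### Unary trees -/

def lineTree {D : Type} (u : List (ℕ × D)) (hu : u ≠ []) : DataTree ℕ D where
  pos := (Finset.range u.length).image (fun k => List.replicate k 0)
  label x := (u.getD (u.length - 1 - x.length) (u.head hu)).1
  data x := (u.getD (u.length - 1 - x.length) (u.head hu)).2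
  root_mem := by
    simp only [Finset.mem_image, Finset.mem_range]
    exact ⟨0, List.length_pos_iff.2 hu, rfl⟩
  parent_closed := by
    intro x i h
    simp only [Finset.mem_image, Finset.mem_range] at h ⊢
    obtain ⟨k, hk, hx⟩ := h
    rcases k with _ | k
    · simp at hx
    · rw [List.replicate_succ'] at hx
      exact ⟨k, by omega, (List.append_inj' hx rfl).1⟩
  sibling_closed := by
    intro x i h
    simp only [Finset.mem_image, Finset.mem_range] at h ⊢
    obtain ⟨k, hk, hx⟩ := h
    rcases k with _ | k
    · simp at hx
    · rw [List.replicate_succ'] at hx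
      have := (List.append_inj' hx rfl).2
      simp at this

theorem mem_lineTree {D : Type} (u : List (ℕ × D)) (hu : u ≠ []) (x : Pos) :
    x ∈ (lineTree u hu).pos ↔ ∃ k, k < u.length ∧ List.replicate k 0 = x := by
  simp [lineTree]

theorem leaf_lineTree {D : Type} (u : List (ℕ × D)) (hu : u ≠ []) (x : Pos)
    (hx : x ∈ (lineTree u hu).pos) :
    IsLeaf (lineTree u hu) x ↔ x = List.replicate (u.length - 1) 0 := by
  have hlen : 0 < u.length := List.length_pos_iff.2 hu
  constructor
  · intro hl
    obtain ⟨k, hk, rfl⟩ := (mem_lineTree _ _ _).1 hx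
    have := hl 0
    rw [mem_lineTree] at this
    have h2 : ¬ k + 1 < u.length := fun h => this ⟨k + 1, h, List.replicate_succ'⟩
    congr 1
    omega
  · rintro rfl i h
    obtain ⟨k, hk, h⟩ := (mem_lineTree _ _ _).1 h
    have := congrArg List.length h
    simp at this
    omega

theorem wordAt_lineTree {D : Type} (u : List (ℕ × D)) (hu : u ≠ []) (k : ℕ) (x : Pos)
    (h : x.length + k + 1 = u.length) :
    wordAt (lineTree u hu) x (List.replicate k 0) = u.take k := by
  induction k generalizing x with
  | zero => simp [wordAt]
  | succ k ih =>
    rw [List.replicate_succ, wordAt, ih (x ++ [0]) (by simp; omega)]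
    have hk : k < u.length := by omega
    have e : u.length - 1 - (x ++ [0]).length = k := by simp; omega
    simp only [lineTree, e]
    rw [List.take_succ_eq_append_getElem hk, List.getD_eq_getElem _ _ hk]

theorem fullWord_lineTree {D : Type} (u : List (ℕ × D)) (hu : u ≠ []) :
    fullWord (lineTree u hu) (List.replicate (u.length - 1) 0) = u := by
  have hlen : 0 < u.length := List.length_pos_iff.2 hu
  have hk : u.length - 1 < u.length := by omega
  rw [fullWord, wordAt_lineTree u hu _ _ (by simp; omega)]
  simp only [lineTree, List.length_nil, Nat.sub_zero]
  rw [List.getD_eq_getElem _ _ hk, Prod.mk.eta, ← List.take_succ_eq_append_getElem hk]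
  simp [Nat.sub_add_cancel hlen]

/-! ### Final assembly -/

def Letter.enc : Letter → ℕ
  | .inc c => Nat.pair 0 (Nat.pair c 0)
  | .dec c => Nat.pair 1 (Nat.pair c 0)
  | .zer c => Nat.pair 2 (Nat.pair c 0)
  | .mov c d => Nat.pair 3 (Nat.pair c d)
  | .clr c => Nat.pair 4 (Nat.pair c 0)

theorem enc_injective : Function.Injective Letter.enc := by
  intro a b h
  cases a <;> cases b <;> simp [Letter.enc, Nat.pair_eq_pair] at h ⊢ <;> exact h

instance : Nonempty Letter := ⟨.inc 0⟩

noncomputable def letterOf : ℕ → Letter := Function.invFun Letter.enc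

theorem letterOf_enc (a : Letter) : letterOf a.enc = a :=
  Function.leftInverse_invFun enc_injective a

theorem replicate_parse {α : Type} {a b : α} (hab : a ≠ b) (m n : ℕ) (y z : List α)
    (h : List.replicate m a ++ b :: y = List.replicate n a ++ b :: z) : m = n ∧ y = z := by
  induction m generalizing n with
  | zero =>
    cases n with
    | zero => simpa using h
    | succ n => simp [List.replicate_succ] at h; exact absurd h.1.symm hab
  | succ m ih =>
    cases n with
    | zero => simp [List.replicate_succ] at h; exact absurd h.1 hab
    | succ n =>
      simp only [List.replicate_succ, List.cons_append, List.cons.injEq, true_and] at h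
      obtain ⟨h1, h2⟩ := ih n h
      exact ⟨by rw [h1], h2⟩

theorem exec_incs (n : ℕ) (v v' : Val) :
    Exec (List.replicate n (.inc 0)) v v' ↔ v' = Function.update v 0 (v 0 + n) := by
  induction n generalizing v with
  | zero => simp [Exec]
  | succ n ih =>
    simp only [List.replicate_succ, Exec, Step, exists_eq_left, ih]
    simp [Nat.add_assoc, Nat.add_comm 1 n]

/-- The program `P` preceded by an arbitrary input phase. -/
def inputPrg (P : Prg) : Prg := .comp (.star (.char (.inc 0))) (.comp (.char (.clr 1)) P)

theorem mem_inputPrg (P : Prg) (w : List Letter) : w ∈ (inputPrg P).matches' ↔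
    ∃ n, ∃ y ∈ P.matches', w = List.replicate n (.inc 0) ++ .clr 1 :: y := by
  have hst : ∀ x : List Letter, x ∈ (RegularExpression.star (.char (.inc 0)) : Prg).matches' ↔
      ∃ n, x = List.replicate n (.inc 0) := by
    intro x
    change x ∈ KStar.kstar ({[Letter.inc 0]} : Language Letter) ↔ _
    rw [Language.mem_kstar]
    constructor
    · rintro ⟨L, rfl, hL⟩
      refine ⟨L.length, ?_⟩
      induction L with
      | nil => rfl
      | cons a L ih =>
        have ha : a = [Letter.inc 0] := hL a (List.mem_cons_self ..)
        rw [List.flatten_cons, ih fun y hy => hL y (List.mem_cons_of_mem _ hy), ha]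
        rfl
    · rintro ⟨n, rfl⟩
      refine ⟨List.replicate n [.inc 0], ?_, ?_⟩
      · simp
      · intro y hy
        exact List.eq_of_mem_replicate hy
  constructor
  · rintro ⟨x, hx, z, ⟨c, hc, y, hy, rfl⟩, rfl⟩
    obtain ⟨n, rfl⟩ := (hst x).1 hx
    have hc : c = [Letter.clr 1] := hc
    subst hc
    exact ⟨n, y, hy, rfl⟩
  · rintro ⟨n, y, hy, rfl⟩
    exact ⟨_, (hst _).2 ⟨n, rfl⟩, _, ⟨[.clr 1], rfl, y, hy, rfl⟩, rfl⟩

section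
variable {B : ℕ} {σ : Type} (M : DFA Letter σ)

noncomputable def tstep' : Option (σ × Mem B) → ℕ → Bool → Option (σ × Mem B)
  | none, _, _ => none
  | some q, a, b => (estep q.2 (letterOf a) b).map fun S' => (M.step q.1 (letterOf a), S')

def bad' (t : Option (σ × Mem B)) : Prop := ∀ s S, t = some (s, S) → s ∉ M.accept

theorem trun_none {D : Type} (e : D) (w : List (ℕ × D)) :
    trun (tstep' (B := B) M) none e w = none := by
  induction w with
  | nil => rfl
  | cons p w ih => simpa [trun, tstep'] using ih

theorem trun_some {D : Type} (e : D) (w : List (ℕ × D)) (s : σ) (S : Mem B) :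
    trun (tstep' M) (some (s, S)) e w =
      (erun e S (w.map fun p => (letterOf p.1, p.2))).map
        fun S' => (M.evalFrom s (w.map fun p => letterOf p.1), S') := by
  induction w generalizing s S with
  | nil => rfl
  | cons p w ih =>
    have h1 : ∀ t : Option (σ × Mem B), trun (tstep' M) t e (p :: w) =
      trun (tstep' M) (tstep' M t p.1 (by classical exact decide (p.2 = e))) e w := fun _ => rfl
    rw [h1]
    simp only [tstep', List.map_cons, erun, DFA.evalFrom_cons]
    cases hS : estep S (letterOf p.1) (by classical exact decide (p.2 = e)) with
    | none => simp [trun_none]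
    | some S' => simp [ih]

theorem not_bad_iff {D : Type} (e : D) (w : List (ℕ × D)) :
    ¬ bad' M (trun (tstep' M) (some (M.start, fun _ : Fin B => false)) e w) ↔
      (erun e (fun _ : Fin B => false) (w.map fun p => (letterOf p.1, p.2))).isSome ∧
      (w.map fun p => letterOf p.1) ∈ M.accepts := by
  rw [trun_some]
  change _ ↔ _ ∧ M.eval _ ∈ M.accept
  cases h : erun e (fun _ : Fin B => false) (w.map fun p => (letterOf p.1, p.2)) with
  | none => simp [bad']
  | some S => simp [bad', DFA.eval]

end

/-- The simulating automata for a partial recursive function. -/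
theorem reduction (D : Type) [Infinite D] (F : ℕ →. ℕ) (hF : Partrec F) :
    ∃ (alph a0 a1 : ℕ) (A : CBUDTA), a0 < alph ∧ a1 < alph ∧ WF A ∧ alphSize A = alph ∧
      ∀ n, (F n).Dom ↔ ¬ ∀ τ : DataTree ℕ D, TreeWF alph τ →
        CAccepts (inM alph a0 a1 n) τ → CAccepts A τ := by
  obtain ⟨P, hP1, hP2⟩ := impl_part (Nat.Partrec'.part_iff₁.2 hF) (0 ::ᵥ List.Vector.nil) 1 2
    (by intro i; fin_cases i; simp) (by norm_num)
  have hargs : ∀ v : Val, (List.Vector.map v (0 ::ᵥ List.Vector.nil)).head = v 0 := fun v => rfl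
  simp only [hargs] at hP1 hP2
  obtain ⟨s, hs⟩ := prg_bounded (inputPrg P)
  classical
  obtain ⟨B, hB⟩ : ∃ B, ∀ a ∈ s, a.Below B := by
    clear hs
    induction s using Finset.induction_on with
    | empty => exact ⟨0, by simp⟩
    | insert a s _ ih =>
      obtain ⟨B, hB⟩ := ih
      obtain ⟨B', hB'⟩ : ∃ B', a.Below B' := by
        cases a with
        | mov c d => exact ⟨c + d + 1, show _ < _ ∧ _ < _ by omega⟩
        | inc c => exact ⟨c + 1, Nat.lt_succ_self c⟩
        | dec c => exact ⟨c + 1, Nat.lt_succ_self c⟩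
        | zer c => exact ⟨c + 1, Nat.lt_succ_self c⟩
        | clr c => exact ⟨c + 1, Nat.lt_succ_self c⟩
      refine ⟨max B B', fun x hx => ?_⟩
      rcases Finset.mem_insert.1 hx with rfl | hx
      · exact below_mono (le_max_right _ _) hB'
      · exact below_mono (le_max_left _ _) (hB x hx)
  obtain ⟨alph, halph⟩ : ∃ alph, ∀ a ∈ insert (Letter.inc 0) (insert (Letter.clr 1) s),
      a.enc < alph :=
    ⟨_, fun a ha => Nat.lt_succ_of_le (Finset.le_sup (f := Letter.enc) ha)⟩
  have hreg : (inputPrg P).matches'.IsRegular :=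
    Language.IsRegular.of_finite_range_leftQuotient (re_lq_finite _)
  obtain ⟨σ, hσ, M, hM⟩ := Language.isRegular_iff.1 hreg
  refine ⟨alph, Letter.enc (.inc 0), Letter.enc (.clr 1),
    detM (tstep' (B := B) M) (some (M.start, fun _ => false)) (bad' M) alph,
    halph _ (by simp), halph _ (by simp), wf_detM _ _ _ _, rfl, fun n => ?_⟩
  constructor
  · intro hdom hall
    obtain ⟨v', w, hw, hx⟩ := hP2 (Function.update (fun _ => 0) 0 n) (by simpa using hdom)
    have hmem : List.replicate n (.inc 0) ++ .clr 1 :: w ∈ (inputPrg P).matches' :=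
      (mem_inputPrg P _).2 ⟨n, w, hw, rfl⟩
    have hexec : Exec (List.replicate n (.inc 0) ++ .clr 1 :: w) (fun _ => 0) v' := by
      rw [exec_append]
      refine ⟨_, (exec_incs n _ _).2 rfl, _, rfl, ?_⟩
      convert hx using 1
      funext c
      by_cases hc : c = 1
      · subst hc; simp
      · by_cases hc0 : c = 0 <;> simp [hc, hc0]
    obtain ⟨u, hu, hue⟩ := erun_complete (D := D) _ (fun _ => fun _ : Fin B => false) _ _ agree_init
      (fun a ha => hB a (hs _ hmem a ha)) hexec
    have hne : (u.map fun p => (p.1.enc, p.2)) ≠ [] := by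
      intro h
      have : u = [] := by simpa using h
      simp [this] at hu
    have hwf : TreeWF alph (lineTree _ hne) := by
      intro x hx
      obtain ⟨k, hk, rfl⟩ := (mem_lineTree _ _ _).1 hx
      have key : ∀ j, (((u.map fun p => (p.1.enc, p.2)).getD j
          ((u.map fun p => (p.1.enc, p.2)).head hne)).1) < alph := by
        intro j
        have hall' : ∀ q ∈ u.map (fun p => (p.1.enc, p.2)), q.1 < alph := by
          intro q hq
          obtain ⟨p, hp, rfl⟩ := List.mem_map.1 hq
          refine halph _ (Finset.mem_insert_of_mem (Finset.mem_insert_of_mem (hs _ hmem _ ?_)))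
          rw [← hu]
          exact List.mem_map_of_mem hp
        by_cases hj : j < (u.map fun p => (p.1.enc, p.2)).length
        · rw [List.getD_eq_getElem _ _ hj]
          exact hall' _ (List.getElem_mem hj)
        · rw [List.getD_eq_default _ _ (by omega)]
          exact hall' _ (List.head_mem hne)
      exact key _
    have h1 : CAccepts (inM alph (Letter.enc (.inc 0)) (Letter.enc (.clr 1)) n) (lineTree _ hne) := by
      rw [inM_accepts_iff]
      intro l hl hll
      rw [leaf_lineTree _ _ _ hl] at hll
      subst hll
      rw [fullWord_lineTree]
      refine ⟨w.map Letter.enc, ?_⟩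
      have := congrArg (List.map Letter.enc) hu
      simpa [Function.comp_def] using this
    have h2 := hall _ hwf h1
    rw [det_accepts_iff _ _ _ _ _ hwf] at h2
    have hleafmem : List.replicate ((u.map fun p => (p.1.enc, p.2)).length - 1) 0 ∈
        (lineTree _ hne).pos :=
      (mem_lineTree _ _ _).2 ⟨_, Nat.sub_lt (List.length_pos_iff.2 hne) Nat.one_pos, rfl⟩
    obtain ⟨e, he⟩ := h2 _ hleafmem ((leaf_lineTree _ _ _ hleafmem).2 rfl)
    rw [fullWord_lineTree] at he
    refine (not_bad_iff M e _).2 ⟨?_, ?_⟩ he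
    · simpa [List.map_map, Function.comp_def, letterOf_enc] using hue e
    · rw [hM]
      have : (List.map (fun p => letterOf p.1) (List.map (fun p : Letter × D => (p.1.enc, p.2)) u))
          = u.map Prod.fst := by
        simp [List.map_map, Function.comp_def, letterOf_enc]
      rw [this, hu]
      exact hmem
  · intro hnot
    push Not at hnot
    obtain ⟨τ, hwf, h1, h2⟩ := hnot
    rw [inM_accepts_iff] at h1
    rw [det_accepts_iff _ _ _ _ _ hwf] at h2
    push Not at h2
    obtain ⟨l, hl, hll, hbad⟩ := h2
    obtain ⟨more, hmore⟩ := h1 l hl hll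
    have hb := fun e => (not_bad_iff M e _).1 (hbad e)
    obtain ⟨-, hmem⟩ := hb (τ.data [])
    rw [hM] at hmem
    have hfst : ((fullWord τ l).map fun p => (letterOf p.1, p.2)).map Prod.fst =
        (fullWord τ l).map fun p => letterOf p.1 := by
      simp [List.map_map, Function.comp_def]
    obtain ⟨v', hx⟩ := erun_sound ((fullWord τ l).map fun p => (letterOf p.1, p.2))
      (fun _ => fun _ : Fin B => false) _ agree_init
      (by
        intro p hp
        refine hB _ (hs _ hmem _ ?_)
        rw [← hfst]
        exact List.mem_map_of_mem hp) (fun e => (hb e).1)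
    rw [hfst] at hx
    have hlet : ((fullWord τ l).map fun p => letterOf p.1) =
        List.replicate n (.inc 0) ++ .clr 1 :: more.map letterOf := by
      have := congrArg (List.map letterOf) hmore
      simpa [List.map_map, Function.comp_def, letterOf_enc] using this
    obtain ⟨m, y, hy, hmy⟩ := (mem_inputPrg P _).1 hmem
    obtain ⟨rfl, rfl⟩ := replicate_parse (by simp) _ _ _ _ (hmy.symm.trans hlet)
    rw [hmy, exec_append] at hx
    obtain ⟨v1, hx1, v2, hx2, hx3⟩ := hx
    rw [exec_incs] at hx1
    have hx2 : v2 = Function.update v1 1 0 := hx2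
    have := (hP1 v2 v' ⟨_, hy, hx3⟩).1
    have hv : v2 0 = m := by simp [hx2, hx1]
    rw [hv] at this
    exact Part.dom_iff_mem.2 ⟨_, this⟩

theorem primrec_inM (alph a0 a1 : ℕ) : Primrec (inM alph a0 a1) := by
  have h1 : Primrec fun n : ℕ => (([(false, ((0 : ℕ), n)), (false, (6, a1))], [(0, 0)]) : CTrans) := by
    refine Primrec.pair ?_ (Primrec.const _)
    exact Primrec.list_cons.comp
      ((Primrec.const false).pair ((Primrec.const 0).pair Primrec.id)) (Primrec.const _)
  have h2 : Primrec fun i : ℕ =>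
      (([(false, ((0 : ℕ), i)), (false, (6, a0))], [(1, i + 1)]) : CTrans) := by
    refine Primrec.pair ?_ ?_
    · exact Primrec.list_cons.comp
        ((Primrec.const false).pair ((Primrec.const 0).pair Primrec.id)) (Primrec.const _)
    · exact Primrec.list_cons.comp ((Primrec.const 1).pair Primrec.succ) (Primrec.const _)
  have h3 : Primrec fun n : ℕ => (List.range n).map fun i =>
      (([(false, ((0 : ℕ), i)), (false, (6, a0))], [(1, i + 1)]) : CTrans) :=
    Primrec.list_map Primrec.list_range (h2.comp Primrec.snd).to₂
  exact (Primrec.const _).pair ((Primrec.const _).pair (Primrec.succ.pair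
    ((Primrec.const _).pair (Primrec.list_cons.comp h1 h3))))

/-- **The containment problem for BUDTA is undecidable**: there is no
computable function that, given two (well-formed, coded) BUDTA over the same
finite alphabet, decides whether every data tree over that alphabet accepted
by the first is also accepted by the second. -/
theorem budta_containment_undecidable (D : Type) [Infinite D] :
    ¬ ∃ f : CBUDTA × CBUDTA → Bool, Computable f ∧
      ∀ M₁ M₂ : CBUDTA, WF M₁ → WF M₂ → alphSize M₁ = alphSize M₂ →
        (f (M₁, M₂) = true ↔
          ∀ τ : DataTree ℕ D, TreeWF (alphSize M₁) τ →
            CAccepts M₁ τ → CAccepts M₂ τ) := by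
  rintro ⟨f, hf, hspec⟩
  have hF : Partrec fun m : ℕ => Nat.Partrec.Code.eval (Denumerable.ofNat Nat.Partrec.Code m) 0 :=
    Nat.Partrec.Code.eval_part.comp (Computable.ofNat _) (Computable.const 0)
  obtain ⟨alph, a0, a1, A, h0, h1, hA, hal, hred⟩ := reduction D _ hF
  refine ComputablePred.halting_problem 0 ?_
  have hc : Computable fun c : Nat.Partrec.Code => f (inM alph a0 a1 (Encodable.encode c), A) :=
    hf.comp (((primrec_inM alph a0 a1).to_comp.comp Computable.encode).pair (Computable.const A))
  refine ComputablePred.computable_iff.2 ⟨fun c => !f (inM alph a0 a1 (Encodable.encode c), A),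
    Primrec.not.to_comp.comp hc, ?_⟩
  funext c
  have h2 := hspec (inM alph a0 a1 (Encodable.encode c)) A (wf_inM _ _ _ _ h0 h1) hA hal.symm
  have h3 := hred (Encodable.encode c)
  simp only [Denumerable.ofNat_encode] at h3
  have h4 : alphSize (inM alph a0 a1 (Encodable.encode c)) = alph := rfl
  rw [h4] at h2
  rw [h3, ← h2]
  simp

end CodedBUDA
end

section
/- BUDTA are not closed under effective complementation: there is no algorithm that, given a BUDTA A over a finite alphabet 𝔸, computes a BUDTA accepting exactly those data trees over 𝔸 and 𝔻 that are not accepted by A. -/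
namespace CodedBUDA

/-- A tree of depth one with `n + 1` children, all labels `0` and all data `d`. -/
def star {D : Type} (d : D) (n : ℕ) : DataTree ℕ D where
  pos := insert [] ((Finset.range (n + 1)).image fun i => [i])
  label := fun _ => 0
  data := fun _ => d
  root_mem := by simp
  parent_closed := by
    intro x i h
    simp only [Finset.mem_insert, Finset.mem_image, Finset.mem_range] at h ⊢
    rcases h with h | ⟨j, hj, h⟩
    · simp at h
    · left
      have := congrArg List.length h
      simp at this
      exact this
  sibling_closed := by
    intro x i h
    simp only [Finset.mem_insert, Finset.mem_image, Finset.mem_range] at h ⊢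
    rcases h with h | ⟨j, hj, h⟩
    · simp at h
    · have h1 := congrArg List.length h
      simp at h1
      subst h1
      simp at h
      right
      exact ⟨i, by omega, rfl⟩

lemma mem_star {D : Type} (d : D) (n : ℕ) (x : Pos) :
    x ∈ (star d n).pos ↔ x = [] ∨ ∃ i ≤ n, x = [i] := by
  simp only [star, Finset.mem_insert, Finset.mem_image, Finset.mem_range, Nat.lt_succ_iff]
  constructor
  · rintro (h | ⟨i, hi, rfl⟩)
    · exact Or.inl h
    · exact Or.inr ⟨i, hi, rfl⟩
  · rintro (h | ⟨i, hi, rfl⟩)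
    · exact Or.inl h
    · exact Or.inr ⟨i, hi, rfl⟩

lemma star_append {D : Type} (d : D) (n : ℕ) (x : Pos) (i : ℕ) :
    x ++ [i] ∈ (star d n).pos ↔ x = [] ∧ i ≤ n := by
  rw [mem_star]
  constructor
  · rintro (h | ⟨j, hj, h⟩)
    · simp at h
    · have h1 := congrArg List.length h
      simp at h1
      subst h1
      simp at h
      exact ⟨rfl, by omega⟩
  · rintro ⟨rfl, hi⟩
    exact Or.inr ⟨i, hi, rfl⟩

lemma isLeaf_star {D : Type} (d : D) (n : ℕ) (x : Pos) : IsLeaf (star d n) x ↔ x ≠ [] := by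
  unfold IsLeaf
  simp only [star_append]
  constructor
  · intro h hx
    exact h 0 ⟨hx, Nat.zero_le _⟩
  · intro h i hi
    exact h hi.1

lemma path_star {D : Type} (d : D) (n : ℕ) (x : Pos) (p : List Pos) :
    IsDownPath (star d n) x p ↔
      (x ∈ (star d n).pos ∧ p = [x]) ∨ (x = [] ∧ ∃ i ≤ n, p = [[], [i]]) := by
  constructor
  · rintro ⟨h1, h2, h3, h4⟩
    match p, h1 with
    | [y], _ =>
      simp at h2
      subst h2
      exact Or.inl ⟨h3 _ (by simp), rfl⟩
    | y :: z :: r, _ =>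
      simp at h2
      subst h2
      rw [List.Chain'] at h4
      obtain ⟨⟨i, rfl⟩, h5⟩ := List.isChain_cons_cons.1 h4
      obtain ⟨rfl, hi⟩ := (star_append d n _ _).1 (h3 (y ++ [i]) (by simp))
      match r with
      | [] => exact Or.inr ⟨rfl, i, hi, rfl⟩
      | w :: r =>
        obtain ⟨⟨j, rfl⟩, _⟩ := List.isChain_cons_cons.1 h5
        have := (star_append d n _ _).1 (h3 (([] ++ [i]) ++ [j]) (by simp))
        simp at this
  · rintro (⟨h, rfl⟩ | ⟨rfl, i, hi, rfl⟩)
    · exact ⟨by simp, by simp, by simpa using h, List.isChain_singleton _⟩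
    · refine ⟨by simp, by simp, ?_,
        List.isChain_cons_cons.2 ⟨⟨i, rfl⟩, List.isChain_singleton _⟩⟩
      intro y hy
      rw [mem_star]
      simp at hy
      rcases hy with rfl | rfl
      · exact Or.inl rfl
      · exact Or.inr ⟨i, hi, rfl⟩

/-- Collapse the duplicated child. -/
def fold (x : Pos) : Pos := if x = [1] then [0] else x

lemma fold_nil : fold [] = [] := by simp [fold]

lemma fold_mem {D : Type} (d : D) {x : Pos} (hx : x ∈ (star d 1).pos) :
    fold x ∈ (star d 0).pos := by
  rw [mem_star] at *
  rcases hx with rfl | ⟨i, hi, rfl⟩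
  · simp [fold]
  · interval_cases i <;> simp [fold]

lemma fold_eq_nil (x : Pos) : fold x = [] ↔ x = [] := by
  unfold fold
  split_ifs with h
  · simp [h]
  · rfl

/-- The set of data paths is invariant under duplication. -/
lemma path_fold {D : Type} (d : D) (bl : Pos → ℕ) (x : Pos) (hx : x ∈ (star d 1).pos)
    (P : List (ℕ × ℕ) → Prop) (R : D → Prop) :
    (∃ p y, IsDownPath (star d 1) x p ∧ p.getLast? = some y ∧
      P (p.map fun z => ((star d 1).label z, bl (fold z))) ∧ R ((star d 1).data y)) ↔
    (∃ p y, IsDownPath (star d 0) (fold x) p ∧ p.getLast? = some y ∧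
      P (p.map fun z => ((star d 0).label z, bl z)) ∧ R ((star d 0).data y)) := by
  constructor
  · rintro ⟨p, y, hp, hy, hP, hR⟩
    rw [path_star] at hp
    rcases hp with ⟨h, rfl⟩ | ⟨rfl, i, hi, rfl⟩
    · exact ⟨[fold x], fold x, (path_star _ _ _ _).2 (Or.inl ⟨fold_mem d h, rfl⟩), rfl, hP, hR⟩
    · refine ⟨[[], [0]], [0], (path_star _ _ _ _).2 (Or.inr ⟨fold_nil, 0, le_rfl, rfl⟩), rfl, ?_, hR⟩
      interval_cases i <;> simpa [fold, star] using hP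
  · rintro ⟨p, y, hp, hy, hP, hR⟩
    rw [path_star] at hp
    rcases hp with ⟨h, rfl⟩ | ⟨h, i, hi, rfl⟩
    · exact ⟨[x], x, (path_star _ _ _ _).2 (Or.inl ⟨hx, rfl⟩), rfl, hP, hR⟩
    · rw [fold_eq_nil] at h
      subst h
      refine ⟨[[], [0]], [0], (path_star _ _ _ _).2 (Or.inr ⟨rfl, 0, by omega, rfl⟩), rfl, ?_, hR⟩
      interval_cases i
      simpa [fold, star] using hP

lemma basic_fold {D : Type} (d : D) (bl : Pos → ℕ) (x : Pos) (hx : x ∈ (star d 1).pos)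
    (q : ℕ) (e : D) (t : CTest) :
    cBasicHolds (star d 1) (fun z => bl (fold z)) x q e t ↔
      cBasicHolds (star d 0) bl (fold x) q e t := by
  unfold cBasicHolds
  split
  · rfl
  · rfl
  · exact path_fold d bl x hx (fun l => l ∈ (decodeRE t.2).matches') (fun a => a = e)
  · exact path_fold d bl x hx (fun l => l ∈ (decodeRE t.2).matches') (fun a => a ≠ e)
  · exact (fold_eq_nil x).symm
  · rw [isLeaf_star, isLeaf_star, Ne, Ne, fold_eq_nil]
  · rfl
  · rfl

/-- Every BUDTA language is closed under duplicating the child. -/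
lemma accepts_dup {D : Type} (d : D) (N : CBUDTA) (h : CAccepts N (star d 0)) :
    CAccepts N (star d 1) := by
  obtain ⟨bl, hbl, ρ, ⟨h1, h2, h3, h4⟩, h5⟩ := h
  refine ⟨fun z => bl (fold z), fun x hx => hbl _ (fold_mem d hx), fun z => ρ (fold z),
    ⟨fun x hx => h1 _ (fold_mem d hx), fun x hx => h2 _ (fold_mem d hx), ?_, ?_⟩, ?_⟩
  · intro x hx hl
    refine h3 _ (fold_mem d hx) ?_
    rw [isLeaf_star] at *
    rwa [Ne, fold_eq_nil]
  · intro y i hyi qd hqd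
    obtain ⟨rfl, hi⟩ := (star_append d 1 y i).1 hyi
    have hf : fold ([] ++ [i]) = [] ++ [0] := by interval_cases i <;> simp [fold]
    have hqd' : qd ∈ ρ ([] ++ [0]) := by rw [← hf]; exact hqd
    obtain ⟨tr, htr, ht, ha⟩ := h4 [] 0 ((star_append d 0 [] 0).2 ⟨rfl, le_rfl⟩) qd hqd'
    refine ⟨tr, htr, ?_, ?_⟩
    · intro nt hnt
      rw [basic_fold d bl _ hyi, hf]
      exact ht nt hnt
    · intro a haa
      have := ha a haa
      unfold cActOK at this ⊢
      have hs : ∀ e ∈ subtreeData (star d 1) ([] ++ [i]),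
          e ∈ subtreeData (star d 0) ([] ++ [0]) := by
        rintro e ⟨y, _, _, rfl⟩
        exact ⟨[0], (mem_star _ _ _).2 (Or.inr ⟨0, le_rfl, rfl⟩), by simp, rfl⟩
      simp only [fold_nil]
      split at this
      · trivial
      · exact this
      · exact this
      · exact this
      · exact fun e he => this e (hs e he)
  · intro qd hqd
    simp only [fold_nil] at hqd
    obtain ⟨t, ht, h6⟩ := h5 qd hqd
    refine ⟨t, ht, fun nt hnt => ?_⟩
    rw [basic_fold d bl _ (star d 1).root_mem, fold_nil]
    exact h6 nt hnt

/-- Automaton that accepts (on stars) iff there are at least two children. -/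
def twoKids : CBUDTA :=
  (1, 2, 1, 0,
    [([], [(1, 0)]),
     ([(false, (2, Nat.pair 2 52)), (false, (2, Nat.pair 2 400))], [(0, 0)])])

lemma decode0 : decodeRE (Nat.pair 2 52) =
    RegularExpression.comp (RegularExpression.char (0, 0)) (RegularExpression.char (0, 0)) := by
  have h : Nat.unpair 8 = (2, 2) := by rw [show 8 = Nat.pair 2 2 by decide, Nat.unpair_pair]
  simp [decodeRE, decodeREAux, h]
  rfl

lemma decode1 : decodeRE (Nat.pair 2 400) =
    RegularExpression.comp (RegularExpression.char (0, 0)) (RegularExpression.char (0, 1)) := by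
  have h : Nat.unpair 66 = (2, 8) := by rw [show 66 = Nat.pair 2 8 by decide, Nat.unpair_pair]
  have h0 : Nat.unpair 1 = (0, 1) := Nat.unpair_pair 0 1
  simp [decodeRE, decodeREAux, h, h0]
  rfl

lemma match_comp (a b : ℕ × ℕ) (l : List (ℕ × ℕ)) :
    l ∈ (RegularExpression.comp (RegularExpression.char a) (RegularExpression.char b)).matches' ↔
      l = [a, b] := by
  simp only [RegularExpression.matches', Language.mem_mul]
  constructor
  · rintro ⟨x, hx, y, hy, rfl⟩
    rw [Set.mem_singleton_iff.1 hx, Set.mem_singleton_iff.1 hy]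
    rfl
  · rintro rfl
    exact ⟨[a], rfl, [b], rfl, rfl⟩

lemma twoKids_WF : WF twoKids := by
  simp [WF, twoKids, initState, qSize, trans]
  rintro a b (⟨rfl, _⟩ | ⟨rfl, _⟩) <;> simp

lemma twoKids_accepts {D : Type} (d : D) : CAccepts twoKids (star d 1) := by
  refine ⟨fun z => if z = [1] then 1 else 0, ?_, fun _ => {(0, d)}, ⟨?_, ?_, ?_, ?_⟩, ?_⟩
  · intro x _
    simp only [twoKids, bSize]
    split_ifs <;> omega
  · intro x _
    exact Set.finite_singleton _
  · rintro x _ qd rfl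
    simp [twoKids, qSize]
  · intro x _ _
    exact ⟨d, rfl⟩
  · rintro y i _ qd rfl
    refine ⟨([], [(1, 0)]), by simp [twoKids, trans], by simp [cTestHolds], ?_⟩
    intro a ha
    simp at ha
    subst ha
    simp [cActOK]
  · rintro qd rfl
    refine ⟨[(false, (2, Nat.pair 2 52)), (false, (2, Nat.pair 2 400))],
      by simp [twoKids, trans], ?_⟩
    intro nt hnt
    simp only [List.mem_cons, List.not_mem_nil, or_false] at hnt
    rcases hnt with rfl | rfl
    · simp only [cBasicHolds, decode0, match_comp, iff_true]
      exact ⟨[[], [0]], [0], (path_star _ _ _ _).2 (Or.inr ⟨rfl, 0, by omega, rfl⟩), rfl,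
        by simp [star], rfl⟩
    · simp only [cBasicHolds, decode1, match_comp, iff_true]
      exact ⟨[[], [1]], [1], (path_star _ _ _ _).2 (Or.inr ⟨rfl, 1, by omega, rfl⟩), rfl,
        by simp [star], rfl⟩

/-- On a star with a single child, paths of length two from any node end in the only child. -/
lemma only_child {D : Type} (d e : D) (bl : Pos → ℕ) (x : Pos) (q k j : ℕ)
    (hk : decodeRE k =
      RegularExpression.comp (RegularExpression.char (0, 0)) (RegularExpression.char (0, j)))
    (h : cBasicHolds (star d 0) bl x q e (2, k)) : x = [] ∧ bl [0] = j := by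
  simp only [cBasicHolds, hk, match_comp] at h
  obtain ⟨p, y, hp, _, hm, _⟩ := h
  rcases (path_star _ _ _ _).1 hp with ⟨_, rfl⟩ | ⟨rfl, i, hi, rfl⟩
  · simp at hm
  · interval_cases i
    simp at hm
    exact ⟨rfl, hm.2.2⟩

lemma twoKids_rejects {D : Type} (d : D) : ¬ CAccepts twoKids (star d 0) := by
  rintro ⟨bl, _, ρ, ⟨_, _, h3, h4⟩, h5⟩
  have hm : ([] ++ [0] : Pos) ∈ (star d 0).pos := (star_append d 0 [] 0).2 ⟨rfl, le_rfl⟩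
  obtain ⟨e, he⟩ := h3 _ hm ((isLeaf_star _ _ _).2 (by simp))
  obtain ⟨tr, htr, ht, ha⟩ := h4 [] 0 hm (initState twoKids, e) (by rw [he]; rfl)
  have key : ∀ (x : Pos) (q : ℕ) (f : D), cTestHolds (star d 0) bl x q f
      [(false, (2, Nat.pair 2 52)), (false, (2, Nat.pair 2 400))] → False := by
    intro x q f hc
    have a0 := (hc (false, (2, Nat.pair 2 52)) (by simp)).2 rfl
    have a1 := (hc (false, (2, Nat.pair 2 400)) (by simp)).2 rfl
    have b0 := (only_child d f bl x q _ 0 decode0 a0).2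
    have b1 := (only_child d f bl x q _ 1 decode1 a1).2
    omega
  simp only [twoKids, trans, List.mem_cons, List.not_mem_nil, or_false] at htr
  rcases htr with rfl | rfl
  · have hk : ((0 : ℕ), e) ∈ ρ [] := ha (1, 0) (by simp)
    obtain ⟨t, ht, h6⟩ := h5 _ hk
    simp only [twoKids, trans, List.mem_cons, List.not_mem_nil, or_false, Prod.mk.injEq] at ht
    rcases ht with ht | ht
    · simp at ht
    · obtain ⟨rfl, _⟩ := ht
      exact key _ _ _ h6
  · exact key _ _ _ ht

/-- **BUDTA are not closed under effective complementation**: there is no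
computable function that, given a (well-formed, coded) BUDTA `M`, computes a
BUDTA over the same alphabet accepting exactly those data trees over that
alphabet that are not accepted by `M`. -/
theorem budta_no_effective_complementation (D : Type) [Infinite D] :
    ¬ ∃ F : CBUDTA → CBUDTA, Computable F ∧
      ∀ M : CBUDTA, WF M →
        ∀ τ : DataTree ℕ D, TreeWF (alphSize M) τ →
          (CAccepts (F M) τ ↔ ¬ CAccepts M τ) := by
  rintro ⟨F, _, hF⟩
  obtain ⟨d⟩ : Nonempty D := inferInstance
  have hwf : ∀ n, TreeWF (alphSize twoKids) (star d n) := by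
    intro n x _
    simp [star, alphSize, twoKids]
  have h0 := (hF twoKids twoKids_WF (star d 0) (hwf 0)).2 (twoKids_rejects d)
  exact (hF twoKids twoKids_WF (star d 1) (hwf 1)).1 (accepts_dup d _ h0) (twoKids_accepts d)

end CodedBUDA
end
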